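/- Suppose p > 3. Let g be a non-classical finite-dimensional restricted simple Lie algebra over k and let t be a torus of g of maximal dimension. Then dim_k g = rk(g) + (p^{μ(g)} − 1)·dim_k g_α for some root α of g relative to t, and moreover dim_k g_α = max{ m ∈ ℕ : m·(p^{μ(g)} − 1) < dim_k g }. -/

import Mathlib

/-!
Preliminary definitions: restricted Lie algebras (following Strade–Farnsteiner),
tori, the invariants `μ` and `rk`.
-/

open scoped TensorProduct

section Defs

variable (p : ℕ) (k : Type*) [Field k] {L : Type*} [LieRing L] [LieAlgebra k L]

/-- Jacobson's formula for a `p`-operation `op` on a Lie algebra `L`: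
`(x+y)^{[p]} = x^{[p]} + y^{[p]} + ∑_{i=1}^{p-1} sᵢ(x,y)`, where the `sᵢ(x,y)` are
determined by `∑ i·sᵢ(x,y)·tⁱ⁻¹ = ad(t•x + y)^{p-1}(x)` in `L ⊗ k[t]`. -/
def JacobsonFormula (op : L → L) : Prop :=
  ∀ x y : L, ∃ s : ℕ → L,
    ((LieAlgebra.ad (Polynomial k) (Polynomial k ⊗[k] L)
        (Polynomial.X ⊗ₜ[k] x + (1 : Polynomial k) ⊗ₜ[k] y)) ^ (p - 1))
        ((1 : Polynomial k) ⊗ₜ[k] x)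
      = ∑ i ∈ Finset.range (p - 1), (Polynomial.X ^ i : Polynomial k) ⊗ₜ[k] (((i + 1) • s (i + 1) : L)) ∧
    op (x + y) = op x + op y + ∑ i ∈ Finset.range (p - 1), s (i + 1)

/-- `op` is a `p`-map (restricted structure) on the Lie algebra `L`. -/
structure IsPMap (op : L → L) : Prop where
  ad_op : ∀ x : L, LieAlgebra.ad k L (op x) = (LieAlgebra.ad k L x) ^ p
  op_smul : ∀ (c : k) (x : L), op (c • x) = c ^ p • op x
  jacobson : JacobsonFormula p k op

variable {p}

/-- An element of a restricted Lie algebra is semisimple if it lies in the span of its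
iterated `p`-th powers. -/
def IsSemisimpleElt (op : L → L) (x : L) : Prop :=
  x ∈ Submodule.span k {y : L | ∃ m : ℕ, 1 ≤ m ∧ y = op^[m] x}

/-- An element is `p`-nilpotent if some iterate of the `p`-map kills it. -/
def IsPNilpotentElt (op : L → L) (x : L) : Prop :=
  ∃ m : ℕ, op^[m] x = 0

/-- A torus of a restricted Lie algebra: a `p`-subalgebra consisting of semisimple
elements. -/
def IsTorus (op : L → L) (t : LieSubalgebra k L) : Prop :=
  (∀ x ∈ t, op x ∈ t) ∧ ∀ x ∈ t, IsSemisimpleElt k op x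

/-- `μ(L)`: the maximal dimension of a torus of the restricted Lie algebra `(L, op)`. -/
noncomputable def mu (op : L → L) : ℕ :=
  sSup {d : ℕ | ∃ t : LieSubalgebra k L, IsTorus k op t ∧ Module.finrank k t = d}

/-- The restriction of the `p`-map to a `p`-subalgebra. -/
def subOp (op : L → L) (K : LieSubalgebra k L) (h : ∀ x ∈ K, op x ∈ K) : K → K :=
  fun x => ⟨op x, h x x.2⟩

end Defs

/-- The rank of a (restricted) Lie algebra: the minimal dimension of a Cartan
subalgebra. By Premet's theorem this agrees with `dim C_L(t)` for any torus of maximal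
dimension. -/
noncomputable def lieRank (k L : Type*) [Field k] [LieRing L] [LieAlgebra k L] : ℕ :=
  sInf {d : ℕ | ∃ H : LieSubalgebra k L, H.IsCartanSubalgebra ∧ Module.finrank k H = d}

/-- The canonical projection onto the quotient by a Lie ideal, as a morphism of Lie
algebras. -/
def quotMk {k L : Type*} [Field k] [LieRing L] [LieAlgebra k L] (I : LieIdeal k L) :
    L →ₗ⁅k⁆ L ⧸ I :=
  { I.toSubmodule.mkQ with map_lie' := rfl }

section Modules

variable (p : ℕ) (k : Type*) [Field k] {L : Type*} [LieRing L] [LieAlgebra k L]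

/-- A restricted module over the restricted Lie algebra `(L, op)`: the `p`-map acts as the
`p`-th power of the action. -/
def IsRestrictedModule (op : L → L) (V : Type*) [AddCommGroup V] [Module k V]
    [LieRingModule L V] [LieModule k L V] : Prop :=
  ∀ (x : L) (v : V), ⁅op x, v⁆ = ((LieModule.toEnd k L V x) ^ p) v

/-- The weight space of a linear character `χ` of a subalgebra `t` on a module `V`. -/
def charWeightSpace (t : LieSubalgebra k L) (χ : t →ₗ[k] k) (V : Type*) [AddCommGroup V]
    [Module k V] [LieRingModule L V] [LieModule k L V] : Submodule k V where
  carrier := {v | ∀ x : t, ⁅(x : L), v⁆ = χ x • v}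
  add_mem' := by
    intro a b ha hb x
    rw [lie_add, ha x, hb x, smul_add]
  zero_mem' := by
    intro x
    rw [lie_zero, smul_zero]
  smul_mem' := by
    intro c a ha x
    rw [lie_smul, ha x, smul_comm]

end Modules

/-!
The truncated polynomial ring `A(n) = k[X₁,…,Xₙ]/(X₁^p,…,Xₙ^p)`, its partial derivatives,
the Jacobson–Witt algebra `W(n) = Der(A(n))`, and related Lie algebras of Cartan type.
-/

set_option synthInstance.maxHeartbeats 1000000
set_option maxHeartbeats 1600000

section Trunc

variable (p : ℕ) (k : Type*) [Field k] (n : ℕ)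

/-- The defining ideal `(X₁^p, …, Xₙ^p)`. -/
noncomputable abbrev truncIdeal : Ideal (MvPolynomial (Fin n) k) :=
  Ideal.span {f | ∃ i : Fin n, f = MvPolynomial.X i ^ p}

/-- The truncated polynomial ring `A(n) := k[X₁,…,Xₙ]/(X₁^p,…,Xₙ^p)`. -/
noncomputable abbrev TruncPoly := MvPolynomial (Fin n) k ⧸ truncIdeal p k n

variable [CharP k p]

theorem pderiv_mem_truncIdeal (i : Fin n) {f : MvPolynomial (Fin n) k}
    (hf : f ∈ truncIdeal p k n) : MvPolynomial.pderiv i f ∈ truncIdeal p k n := by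
  induction hf using Submodule.span_induction with
  | mem x hx =>
    obtain ⟨j, rfl⟩ := hx
    have h0 : (p : MvPolynomial (Fin n) k) = 0 := CharP.cast_eq_zero _ p
    rw [Derivation.leibniz_pow]
    rw [nsmul_eq_mul, h0, zero_mul]
    exact Ideal.zero_mem _
  | zero => simp only [map_zero]; exact Ideal.zero_mem _
  | add x y _ _ hx hy => rw [map_add]; exact Ideal.add_mem _ hx hy
  | smul a x hxmem hx =>
    rw [smul_eq_mul, Derivation.leibniz, smul_eq_mul, smul_eq_mul]
    exact Ideal.add_mem _ (Ideal.mul_mem_left _ _ hx) (Ideal.mul_mem_right _ _ hxmem)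

/-- The partial derivative `∂/∂Xᵢ` on the truncated polynomial ring, as a derivation. -/
noncomputable def truncPD (i : Fin n) :
    Derivation k (TruncPoly p k n) (TruncPoly p k n) where
  toFun := fun a => Quotient.liftOn' a
    (fun f => Ideal.Quotient.mk (truncIdeal p k n) (MvPolynomial.pderiv i f))
    (by
      intro f g hfg
      rw [Submodule.quotientRel_def] at hfg
      rw [Ideal.Quotient.eq]
      rw [← map_sub]
      exact pderiv_mem_truncIdeal p k n i hfg)
  map_add' := by
    rintro ⟨f⟩ ⟨g⟩
    show Ideal.Quotient.mk _ (MvPolynomial.pderiv i (f + g)) =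
      Ideal.Quotient.mk _ (MvPolynomial.pderiv i f) +
        Ideal.Quotient.mk _ (MvPolynomial.pderiv i g)
    rw [map_add, map_add]
  map_smul' := by
    rintro c ⟨f⟩
    show Ideal.Quotient.mkₐ k (truncIdeal p k n) (MvPolynomial.pderiv i (c • f)) =
      c • Ideal.Quotient.mkₐ k (truncIdeal p k n) (MvPolynomial.pderiv i f)
    rw [Derivation.map_smul, map_smul]
  map_one_eq_zero' := by
    show Ideal.Quotient.mk (truncIdeal p k n) (MvPolynomial.pderiv i 1) = 0
    simp only [Derivation.map_one_eq_zero, map_zero]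
  leibniz' := by
    rintro ⟨f⟩ ⟨g⟩
    show Ideal.Quotient.mk (truncIdeal p k n) (MvPolynomial.pderiv i (f * g)) =
      (Ideal.Quotient.mk (truncIdeal p k n) f) *
          (Ideal.Quotient.mk (truncIdeal p k n) (MvPolynomial.pderiv i g)) +
        (Ideal.Quotient.mk (truncIdeal p k n) g) *
          (Ideal.Quotient.mk (truncIdeal p k n) (MvPolynomial.pderiv i f))
    rw [Derivation.leibniz, smul_eq_mul, smul_eq_mul, map_add, map_mul, map_mul]

/-- The image of the variable `Xᵢ` in the truncated polynomial ring. -/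
noncomputable def truncX (i : Fin n) : TruncPoly p k n :=
  Ideal.Quotient.mk (truncIdeal p k n) (MvPolynomial.X i)

end Trunc

section CartanAlgebras

variable (p : ℕ) (k : Type*) [Field k] [CharP k p]

/-- The restricted Jacobson–Witt algebra `W(n) := Der(A(n))`. -/
noncomputable abbrev WittAlg (n : ℕ) :=
  Derivation k (TruncPoly p k n) (TruncPoly p k n)

/-- The divergence of a derivation `D = ∑ fᵢ ∂ᵢ`, namely `∑ ∂ᵢ(fᵢ) = ∑ ∂ᵢ(D(xᵢ))`. -/
noncomputable def divergence (n : ℕ) (D : WittAlg p k n) : TruncPoly p k n :=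
  ∑ i : Fin n, truncPD p k n i (D (truncX p k n i))

/-- The linear embedding of `W(n)` into the associative algebra of `k`-linear
endomorphisms of `A(n)`; the `p`-map of `W(n)` is `D ↦ D^p` under this embedding. -/
noncomputable def derToEnd (n : ℕ) :
    WittAlg p k n →ₗ[k] Module.End k (TruncPoly p k n) where
  toFun D := D.toLinearMap
  map_add' := fun _ _ => rfl
  map_smul' := fun _ _ => rfl

/-- The Hamiltonian map `D_H : A(2r) → W(2r)`,
`f ↦ ∑ᵢ (∂ᵢ(f) ∂_{i+r} − ∂_{i+r}(f) ∂ᵢ)`. -/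
noncomputable def DH (r : ℕ) (f : TruncPoly p k (2 * r)) : WittAlg p k (2 * r) :=
  ∑ i : Fin r,
    (truncPD p k (2 * r) ⟨i.1, by have := i.isLt; omega⟩ f •
        truncPD p k (2 * r) ⟨i.1 + r, by have := i.isLt; omega⟩
      - truncPD p k (2 * r) ⟨i.1 + r, by have := i.isLt; omega⟩ f •
        truncPD p k (2 * r) ⟨i.1, by have := i.isLt; omega⟩)

/-- The contact map `D_K : A(2r+1) → W(2r+1)` (Strade–Farnsteiner, §4.5). -/
noncomputable def DK (r : ℕ) (f : TruncPoly p k (2 * r + 1)) : WittAlg p k (2 * r + 1) :=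
  (∑ i : Fin r,
    ((truncX p k (2 * r + 1) ⟨i.1, by have := i.isLt; omega⟩ *
        truncPD p k (2 * r + 1) (Fin.last (2 * r)) f
      - truncPD p k (2 * r + 1) ⟨i.1 + r, by have := i.isLt; omega⟩ f) •
        truncPD p k (2 * r + 1) ⟨i.1, by have := i.isLt; omega⟩
    + (truncX p k (2 * r + 1) ⟨i.1 + r, by have := i.isLt; omega⟩ *
        truncPD p k (2 * r + 1) (Fin.last (2 * r)) f
      + truncPD p k (2 * r + 1) ⟨i.1, by have := i.isLt; omega⟩ f) •
        truncPD p k (2 * r + 1) ⟨i.1 + r, by have := i.isLt; omega⟩))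
  + ((2 : TruncPoly p k (2 * r + 1)) * f
      - ∑ i : Fin (2 * r), truncX p k (2 * r + 1) ⟨i.1, by have := i.isLt; omega⟩ *
          truncPD p k (2 * r + 1) ⟨i.1, by have := i.isLt; omega⟩ f) •
      truncPD p k (2 * r + 1) (Fin.last (2 * r))

/-- The derived subalgebra `[K, K]` of a Lie subalgebra. -/
noncomputable def derivedSub {L : Type*} [LieRing L] [LieAlgebra k L]
    (K : LieSubalgebra k L) : LieSubalgebra k L :=
  LieSubalgebra.lieSpan k L {z | ∃ x ∈ K, ∃ y ∈ K, z = ⁅x, y⁆}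

/-- `K''(2r+1) = {D ∈ W(n) | D(ω_K) ∈ A(n)·ω_K}`, realized as the image of `D_K`. -/
noncomputable def contactAmbient (r : ℕ) : LieSubalgebra k (WittAlg p k (2 * r + 1)) :=
  LieSubalgebra.lieSpan k _ (Set.range (DK p k r))

/-- The restricted contact algebra `K(2r+1) := [K''(2r+1), K''(2r+1)]`. -/
noncomputable def contactAlg (r : ℕ) : LieSubalgebra k (WittAlg p k (2 * r + 1)) :=
  derivedSub k (contactAmbient p k r)

/-- `H'(2r) := D_H(A(2r))`, the image of the Hamiltonian map. -/
noncomputable def hamiltonianAmbient (r : ℕ) : LieSubalgebra k (WittAlg p k (2 * r)) :=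
  LieSubalgebra.lieSpan k _ (Set.range (DH p k r))

/-- The restricted Hamiltonian algebra `H(2r) := H'(2r)^{(1)}`. -/
noncomputable def hamiltonianAlg (r : ℕ) : LieSubalgebra k (WittAlg p k (2 * r)) :=
  derivedSub k (hamiltonianAmbient p k r)

/-- `S̃(n) := {D ∈ W(n) | div(D) = 0}`. -/
noncomputable def specialAmbient (n : ℕ) : LieSubalgebra k (WittAlg p k n) :=
  LieSubalgebra.lieSpan k _ {D | divergence p k n D = 0}

/-- The restricted special algebra `S(n) := S̃(n)^{(1)}`. -/
noncomputable def specialAlg (n : ℕ) : LieSubalgebra k (WittAlg p k n) :=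
  derivedSub k (specialAmbient p k n)

/-- A torus of a `p`-subalgebra `K` of the Jacobson–Witt algebra `W(n)` (whose `p`-map is
`D ↦ D^p`, the `p`-th power in `End_k(A(n))`): a subalgebra of `K` closed under the
`p`-power map and consisting of semisimple elements. -/
def IsTorusIn (n : ℕ) (K : LieSubalgebra k (WittAlg p k n))
    (T : Submodule k (WittAlg p k n)) : Prop :=
  (∀ x ∈ T, x ∈ K) ∧
  (∀ x ∈ T, ∀ y ∈ T, ⁅x, y⁆ ∈ T) ∧
  (∀ x ∈ T, ∃ y ∈ T, derToEnd p k n y = (derToEnd p k n x) ^ p) ∧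
  (∀ x ∈ T, derToEnd p k n x ∈ Submodule.span k
    {z : Module.End k (TruncPoly p k n) | ∃ m : ℕ, 1 ≤ m ∧ z = (derToEnd p k n x) ^ (p ^ m)})

/-- `μ(K)`: the maximal dimension of a torus of `K ⊆ W(n)`. -/
noncomputable def muIn (n : ℕ) (K : LieSubalgebra k (WittAlg p k n)) : ℕ :=
  sSup {d : ℕ | ∃ T : Submodule k (WittAlg p k n),
    IsTorusIn p k n K T ∧ Module.finrank k T = d}

end CartanAlgebras

/-- The rank of a Lie subalgebra `K`: the minimal dimension of a Cartan subalgebra of the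
Lie algebra `K`. -/
noncomputable def lieRankOf (k : Type*) [Field k] {L : Type*} [LieRing L] [LieAlgebra k L]
    (K : LieSubalgebra k L) : ℕ :=
  sInf {d : ℕ | ∃ H : LieSubalgebra k K, H.IsCartanSubalgebra ∧ Module.finrank k H = d}
section Melikian

variable (p : ℕ) (k : Type*) [Field k] [CharP k p]

/-- The underlying vector space `W(2) ⊕ A(2) ⊕ W̃(2)` of the Melikian algebra. -/
noncomputable abbrev MelikianCarrier :=
  (WittAlg p k 2) × (TruncPoly p k 2) × (WittAlg p k 2)

/-- The bracket of the restricted Melikian algebra `M(1,1)` (char 5), given on the three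
summands `W(2) ⊕ A(2) ⊕ W̃(2)` by `[D, Ẽ] = [D,E]~ + 2 div(D) Ẽ`,
`[D, f] = D(f) − 2 div(D) f`, `[f, Ẽ] = fE`,
`[f, g] = 2(g ∂₂(f) − f ∂₂(g)) ∂̃₁ + 2(f ∂₁(g) − g ∂₁(f)) ∂̃₂` and
`[f₁∂̃₁ + f₂∂̃₂, g₁∂̃₁ + g₂∂̃₂] = f₁ g₂ − f₂ g₁`. -/
noncomputable def melikianBracket (x y : MelikianCarrier p k) : MelikianCarrier p k :=
  (⁅x.1, y.1⁆ + x.2.1 • y.2.2 - y.2.1 • x.2.2,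
   x.1 (y.2.1) - y.1 (x.2.1)
     - (2 : TruncPoly p k 2) * divergence p k 2 x.1 * y.2.1
     + (2 : TruncPoly p k 2) * divergence p k 2 y.1 * x.2.1
     + (x.2.2 (truncX p k 2 0) * y.2.2 (truncX p k 2 1)
        - x.2.2 (truncX p k 2 1) * y.2.2 (truncX p k 2 0)),
   ⁅x.1, y.2.2⁆ + ((2 : TruncPoly p k 2) * divergence p k 2 x.1) • y.2.2
     - ⁅y.1, x.2.2⁆ - ((2 : TruncPoly p k 2) * divergence p k 2 y.1) • x.2.2
     + ((2 : TruncPoly p k 2) * (y.2.1 * truncPD p k 2 1 x.2.1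
         - x.2.1 * truncPD p k 2 1 y.2.1)) • truncPD p k 2 0
     + ((2 : TruncPoly p k 2) * (x.2.1 * truncPD p k 2 0 y.2.1
         - y.2.1 * truncPD p k 2 0 x.2.1)) • truncPD p k 2 1)

/-- `L` is (isomorphic to) the restricted Melikian algebra `M(1,1)`; this occurs only in
characteristic `5`. -/
def IsMelikian (L : Type*) [LieRing L] [LieAlgebra k L] : Prop :=
  p = 5 ∧ ∃ e : L ≃ₗ[k] MelikianCarrier p k,
    ∀ x y : L, e ⁅x, y⁆ = melikianBracket p k (e x) (e y)

end Melikian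

section Classification

variable (p : ℕ) (k : Type*) [Field k] [CharP k p]

/-- `L` is one of the restricted simple Lie algebras of Cartan type:
`W(n)` (n ≥ 1), `S(n)` (n ≥ 3), `H(2r)` (r ≥ 1) or `K(2r+1)` (r ≥ 1). -/
def IsCartanTypeSimple (L : Type*) [LieRing L] [LieAlgebra k L] : Prop :=
  (∃ n : ℕ, 1 ≤ n ∧ Nonempty (L ≃ₗ⁅k⁆ WittAlg p k n)) ∨
  (∃ n : ℕ, 3 ≤ n ∧ Nonempty (L ≃ₗ⁅k⁆ specialAlg p k n)) ∨
  (∃ r : ℕ, 1 ≤ r ∧ Nonempty (L ≃ₗ⁅k⁆ hamiltonianAlg p k r)) ∨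
  (∃ r : ℕ, 1 ≤ r ∧ Nonempty (L ≃ₗ⁅k⁆ contactAlg p k r))

/-- By the classification of restricted simple Lie algebras in characteristic `p > 3`, a
*non-classical* restricted simple Lie algebra is of Cartan type or Melikian. -/
def IsNonClassicalRestrictedSimple (L : Type*) [LieRing L] [LieAlgebra k L] : Prop :=
  IsCartanTypeSimple p k L ∨ IsMelikian p k L

end Classification


section P0
variable {p : ℕ} [Fact p.Prime] {k : Type*} [Field k] [CharP k p]

/-- the embedding of the prime field -/
noncomputable def cz (p : ℕ) (k : Type*) [Field k] [CharP k p] : ZMod p →+* k :=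
  ZMod.castHom (dvd_refl p) k

theorem cz_inj : Function.Injective (cz p k) := (cz p k).injective

theorem cz_pow (l : ZMod p) : (cz p k l) ^ p = cz p k l := by
  rw [← map_pow, ZMod.pow_card]

theorem cz_of_fixed {m : k} (h : m ^ p = m) : ∃ l : ZMod p, cz p k l = m := by
  classical
  by_contra hcon
  push Not at hcon
  have hp : 1 < p := (Fact.out : p.Prime).one_lt
  let P : Polynomial k := Polynomial.X ^ p - Polynomial.X
  have hP : P ≠ 0 := FiniteField.X_pow_card_sub_X_ne_zero k hp
  have hdeg : P.natDegree = p := FiniteField.X_pow_card_sub_X_natDegree_eq k hp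
  let S : Finset k := insert m (Finset.univ.image (cz p k))
  have hS : S ⊆ P.roots.toFinset := by
    intro x hx
    rw [Multiset.mem_toFinset, Polynomial.mem_roots hP]
    simp only [S, Finset.mem_insert, Finset.mem_image, Finset.mem_univ, true_and] at hx
    rcases hx with rfl | ⟨l, rfl⟩
    · simp [P, h]
    · simp [P, cz_pow]
  have h1 : S.card = p + 1 := by
    rw [Finset.card_insert_of_notMem, Finset.card_image_of_injective _ cz_inj]
    · simp [ZMod.card]
    · simp only [Finset.mem_image, Finset.mem_univ, true_and, not_exists]
      exact hcon
  have h2 := Finset.card_le_card hS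
  have h3 := Multiset.toFinset_card_le P.roots
  have h4 := Polynomial.card_roots' P
  omega

section ss
variable {V : Type*} [AddCommGroup V] [Module k V]

/-- semisimplicity in the weak form -/
def SSop (f : Module.End k V) : Prop :=
  ∀ (m : k) (v : V), f (f v - m • v) = m • (f v - m • v) → f v = m • v

end ss
end P0

section P0b
variable {k : Type*} [Field k] {V : Type*} [AddCommGroup V] [Module k V]

theorem SSop.maxGen {f : Module.End k V} (hf : SSop f) (m : k) :
    f.maxGenEigenspace m = f.eigenspace m := by
  apply le_antisymm
  · intro v hv
    rw [Module.End.mem_maxGenEigenspace] at hv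
    obtain ⟨n, hn⟩ := hv
    rw [Module.End.mem_eigenspace_iff]
    induction n generalizing v with
    | zero => simp at hn; simp [hn]
    | succ n ih =>
      rw [pow_succ] at hn
      have := ih (v := (f - m • 1) v) hn
      apply hf
      simpa using this
  · exact Module.End.genEigenspace_le_maximal f m 1

theorem SSop.iSup_top [IsAlgClosed k] [FiniteDimensional k V] {f : Module.End k V} (hf : SSop f) :
    ⨆ m, f.eigenspace m = ⊤ := by
  rw [← Module.End.iSup_maxGenEigenspace_eq_top f]
  simp_rw [hf.maxGen]

theorem simDiag [IsAlgClosed k] [FiniteDimensional k V] {I : Type*} (f : I → Module.End k V)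
    (hf : ∀ i, SSop (f i)) (hc : ∀ i j, Commute (f i) (f j)) :
    ∃ (n : ℕ) (b : Module.Basis (Fin n) k V) (e : Fin n → I → k), ∀ j i, f i (b j) = e j i • b j := by
  have h := Module.End.iSup_iInf_maxGenEigenspace_eq_top_of_iSup_maxGenEigenspace_eq_top_of_commute f
    (fun i j _ => hc i j) (fun i => Module.End.iSup_maxGenEigenspace_eq_top (f i))
  let S : Set V := {v | ∃ χ : I → k, ∀ i, f i v = χ i • v}
  have hS : ⊤ ≤ Submodule.span k S := by
    rw [← h]
    refine iSup_le fun χ => ?_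
    intro v hv
    apply Submodule.subset_span
    refine ⟨χ, fun i => ?_⟩
    have := (Submodule.mem_iInf _).1 hv i
    rw [(hf i).maxGen, Module.End.mem_eigenspace_iff] at this
    exact this
  let b := Module.Basis.ofSpan hS
  have hfin : Finite _ := Module.Finite.finite_basis b
  have hft := Fintype.ofFinite (((linearIndepOn_empty k id).extend (Set.empty_subset S)))
  let b' := b.reindex (Fintype.equivFin _)
  have hb : ∀ j, b' j ∈ S := by
    intro j
    have := Module.Basis.ofSpan_subset hS
    apply this
    simp only [b', Module.Basis.reindex_apply]
    exact ⟨_, rfl⟩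
  choose e he using hb
  exact ⟨_, b', e, he⟩

/-- dimension of joint eigenspaces -/
theorem finrank_joint {n : ℕ} {I : Type*} (b : Module.Basis (Fin n) k V) (f : I → Module.End k V)
    (e : Fin n → I → k) (he : ∀ j i, f i (b j) = e j i • b j) (c : I → k) (U : Submodule k V)
    (hU : ∀ v, v ∈ U ↔ ∀ i, f i v = c i • v) (s : Finset (Fin n)) (hs : ∀ j, j ∈ s ↔ ∀ i, e j i = c i) :
    Module.finrank k U = s.card := by
  classical
  have hUe : U = Submodule.span k (b '' (s : Set (Fin n))) := by
    ext v
    rw [hU, Module.Basis.mem_span_image]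
    have key : ∀ i j, b.repr (f i v) j = e j i * b.repr v j := by
      intro i j
      have : f i v = ∑ j, b.repr v j • (e j i • b j) := by
        conv_lhs => rw [← b.sum_repr v]
        rw [map_sum]
        simp [he]
      rw [this, map_sum, Finset.sum_apply']
      simp [Finsupp.single_apply, mul_comm]
    constructor
    · intro h j hj
      simp only [Finset.mem_coe, Finsupp.mem_support_iff] at hj ⊢
      rw [hs]
      intro i
      have := key i j
      rw [h i] at this
      simp only [map_smul, Finsupp.smul_apply, smul_eq_mul] at this
      exact (mul_right_cancel₀ hj this).symm
    · intro h i
      apply b.repr.injective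
      ext j
      rw [key]
      simp only [map_smul, Finsupp.smul_apply, smul_eq_mul]
      by_cases hj : b.repr v j = 0
      · simp [hj]
      · have : j ∈ s := h (by simpa using hj)
        rw [(hs j).1 this]
  rw [hUe]
  rw [Set.image_eq_range]
  have : LinearIndependent k (fun x : (s : Set (Fin n)) => b x) := 
    b.linearIndependent.comp _ Subtype.val_injective
  have h2 := finrank_span_eq_card (R := k) this
  simpa using h2

end P0b


section P1
set_option linter.unusedSectionVars false
variable {p : ℕ} [Fact p.Prime] {k : Type*} [Field k] [CharP k p]
  {L : Type*} [LieRing L] [LieAlgebra k L]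

theorem IsPMap.ad_iter {op : L → L} (hop : IsPMap p k op) (m : ℕ) (x : L) :
    LieAlgebra.ad k L (op^[m] x) = (LieAlgebra.ad k L x) ^ (p ^ m) := by
  induction m generalizing x with
  | zero => simp
  | succ m ih =>
    rw [Function.iterate_succ_apply, ih, hop.ad_op, ← pow_mul, pow_succ']

/-- trivial centre -/
def NoCenter (k L : Type*) [Field k] [LieRing L] [LieAlgebra k L] : Prop :=
  ∀ x : L, LieAlgebra.ad k L x = 0 → x = 0

theorem NoCenter.ext (hc : NoCenter k L) {x y : L}
    (h : LieAlgebra.ad k L x = LieAlgebra.ad k L y) : x = y := by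
  have := hc (x - y) (by rw [map_sub, h, sub_self])
  exact sub_eq_zero.1 this

theorem ad_commute {x y : L} (h : ⁅x, y⁆ = 0) :
    Commute (LieAlgebra.ad k L x) (LieAlgebra.ad k L y) := by
  ext v
  simp only [Module.End.mul_apply, LieAlgebra.ad_apply]
  rw [leibniz_lie x y v, h, zero_lie, zero_add]

theorem IsPMap.op_add {op : L → L} (hop : IsPMap p k op) (hc : NoCenter k L) {x y : L}
    (h : ⁅x, y⁆ = 0) : op (x + y) = op x + op y := by
  apply hc.ext
  have : CharP (Module.End k L) p ∨ Subsingleton L := by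
    by_cases hs : Subsingleton L
    · exact Or.inr hs
    · left
      rw [not_subsingleton_iff_nontrivial] at hs
      exact charP_of_injective_algebraMap (algebraMap k (Module.End k L)).injective p
  rcases this with hp | hs
  · rw [map_add, hop.ad_op, hop.ad_op, hop.ad_op, map_add]
    exact add_pow_char_of_commute p (ad_commute h)
  · ext v; exact Subsingleton.elim _ _

theorem IsPMap.op_zero {op : L → L} (hop : IsPMap p k op) : op 0 = 0 := by
  have := hop.op_smul 0 0
  rwa [zero_smul, zero_pow (Fact.out : p.Prime).ne_zero, zero_smul] at this

theorem IsPMap.iter_zero {op : L → L} (hop : IsPMap p k op) (m : ℕ) : op^[m] 0 = 0 :=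
  Function.iterate_fixed hop.op_zero m

theorem IsPMap.lie_iter_zero {op : L → L} (hop : IsPMap p k op) {x y : L}
    (h : ⁅x, y⁆ = 0) (m : ℕ) : ⁅op^[m] x, y⁆ = 0 := by
  have : (LieAlgebra.ad k L (op^[m] x)) y = 0 := by
    rw [hop.ad_iter]
    obtain ⟨q, hq⟩ := Nat.exists_eq_succ_of_ne_zero (pow_ne_zero m (Fact.out : p.Prime).ne_zero)
    rw [hq, pow_succ, Module.End.mul_apply, LieAlgebra.ad_apply, h, map_zero]
  simpa using this

theorem IsPMap.ss {op : L → L} (hop : IsPMap p k op) {x : L} (hx : IsSemisimpleElt k op x) :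
    SSop (LieAlgebra.ad k L x) := by
  intro m v hv
  set f := LieAlgebra.ad k L x with hf
  -- powers act by scalars
  have hpw : ∀ n, 2 ≤ n → ((f - algebraMap k _ m) ^ n) v = 0 := by
    intro n hn
    obtain ⟨q, rfl⟩ := Nat.exists_eq_add_of_le hn
    rw [add_comm, pow_add, Module.End.mul_apply]
    have : ((f - algebraMap k (Module.End k L) m) ^ 2 : Module.End k L) v = 0 := by
      rw [pow_two, Module.End.mul_apply]
      simp only [LinearMap.sub_apply, Module.algebraMap_end_apply]
      rw [map_sub, ← sub_eq_zero] at hv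
      rw [map_sub]
      exact hv
    rw [this, map_zero]
  have hpw2 : ∀ n, 1 ≤ n → (f ^ (p ^ n)) v = (m ^ (p ^ n)) • v := by
    intro n hn
    by_cases hs : Subsingleton L
    · exact Subsingleton.elim _ _
    rw [not_subsingleton_iff_nontrivial] at hs
    have : CharP (Module.End k L) p :=
      charP_of_injective_algebraMap (algebraMap k (Module.End k L)).injective p
    have h1 : (f - algebraMap k _ m) ^ (p ^ n) = f ^ (p ^ n) - (algebraMap k _ m) ^ (p ^ n) :=
      sub_pow_char_pow_of_commute p n (Algebra.commutes m f).symm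
    have h2 := hpw (p ^ n) (by
      calc 2 ≤ p := (Fact.out : p.Prime).two_le
        _ = p ^ 1 := (pow_one p).symm
        _ ≤ p ^ n := Nat.pow_le_pow_right (Fact.out : p.Prime).pos hn)
    rw [h1, LinearMap.sub_apply, ← map_pow (algebraMap k (Module.End k L)), Module.algebraMap_end_apply, sub_eq_zero] at h2
    exact h2
  have hspan : ∀ y ∈ Submodule.span k {y : L | ∃ m : ℕ, 1 ≤ m ∧ y = op^[m] x},
      ∃ c : k, (LieAlgebra.ad k L y) v = c • v := by
    intro y hy
    induction hy using Submodule.span_induction with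
    | mem y hy =>
      obtain ⟨n, hn, rfl⟩ := hy
      exact ⟨_, by rw [hop.ad_iter]; exact hpw2 n hn⟩
    | zero => exact ⟨0, by simp⟩
    | add a b _ _ ha hb =>
      obtain ⟨c, hc⟩ := ha
      obtain ⟨d, hd⟩ := hb
      exact ⟨c + d, by rw [map_add, LinearMap.add_apply, hc, hd, add_smul]⟩
    | smul a b _ hb =>
      obtain ⟨d, hd⟩ := hb
      exact ⟨a * d, by rw [map_smul, LinearMap.smul_apply, hd, mul_smul]⟩
  obtain ⟨c, hc⟩ := hspan x hx
  rw [← hf] at hc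
  rw [hc]
  rw [hc, ← sub_smul, map_smul, hc, smul_smul, smul_smul, ← sub_eq_zero, ← sub_smul] at hv
  rcases smul_eq_zero.1 hv with h | h
  · have : (c - m) * (c - m) = 0 := by rw [← h]; ring
    rw [sub_eq_zero.1 (mul_self_eq_zero.1 this)]
  · simp [h]

/-- a commutative `p`-closed subspace -/
structure PAb (op : L → L) (Y : Submodule k L) : Prop where
  ab : ∀ x ∈ Y, ∀ y ∈ Y, ⁅x, y⁆ = 0
  cl : ∀ x ∈ Y, op x ∈ Y

theorem PAb.iter_mem {op : L → L} {Y : Submodule k L} (hY : PAb op Y) (m : ℕ) {x : L} (hx : x ∈ Y) :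
    op^[m] x ∈ Y := by
  induction m with
  | zero => exact hx
  | succ m ih => rw [Function.iterate_succ_apply']; exact hY.cl _ ih

theorem PAb.iter_add {op : L → L} (hop : IsPMap p k op) (hc : NoCenter k L) {Y : Submodule k L}
    (hY : PAb op Y) (m : ℕ) {x y : L} (hx : x ∈ Y) (hy : y ∈ Y) :
    op^[m] (x + y) = op^[m] x + op^[m] y := by
  induction m with
  | zero => rfl
  | succ m ih =>
    rw [Function.iterate_succ_apply', ih, hop.op_add hc (hY.ab _ (hY.iter_mem m hx) _ (hY.iter_mem m hy)),
      ← Function.iterate_succ_apply' op, ← Function.iterate_succ_apply' op]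

theorem IsPMap.iter_smul {op : L → L} (hop : IsPMap p k op) (m : ℕ) (c : k) (x : L) :
    op^[m] (c • x) = c ^ (p ^ m) • op^[m] x := by
  induction m with
  | zero => simp
  | succ m ih =>
    rw [Function.iterate_succ_apply', ih, hop.op_smul, ← pow_mul, ← pow_succ,
      ← Function.iterate_succ_apply' op]

variable [IsAlgClosed k]

theorem exists_root (m : ℕ) (c : k) : ∃ d : k, d ^ (p ^ m) = c :=
  IsAlgClosed.exists_pow_nat_eq c (pow_pos (Fact.out : p.Prime).pos m)

/-- image under the iterate -/
def PAb.img {op : L → L} (hop : IsPMap p k op) (hc : NoCenter k L) {Y : Submodule k L}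
    (hY : PAb op Y) (m : ℕ) : Submodule k L where
  carrier := {z | ∃ y ∈ Y, op^[m] y = z}
  add_mem' := by
    rintro _ _ ⟨x, hx, rfl⟩ ⟨y, hy, rfl⟩
    exact ⟨x + y, Y.add_mem hx hy, hY.iter_add hop hc m hx hy⟩
  zero_mem' := ⟨0, Y.zero_mem, hop.iter_zero m⟩
  smul_mem' := by
    rintro c _ ⟨x, hx, rfl⟩
    obtain ⟨d, hd⟩ := exists_root (p := p) m c
    exact ⟨d • x, Y.smul_mem d hx, by rw [hop.iter_smul, hd]⟩

theorem PAb.img_pab {op : L → L} (hop : IsPMap p k op) (hc : NoCenter k L) {Y : Submodule k L}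
    (hY : PAb op Y) (m : ℕ) : PAb op (hY.img hop hc m) where
  ab := by
    rintro _ ⟨x, hx, rfl⟩ _ ⟨y, hy, rfl⟩
    exact hY.ab _ (hY.iter_mem m hx) _ (hY.iter_mem m hy)
  cl := by
    rintro _ ⟨x, hx, rfl⟩
    exact ⟨op x, hY.cl x hx, by rw [← Function.iterate_succ_apply' op, Function.iterate_succ_apply]⟩

/-- a `p`-torus -/
structure PT (op : L → L) (Y : Submodule k L) : Prop extends PAb op Y where
  inj : ∀ x ∈ Y, op x = 0 → x = 0

theorem PAb.exists_torus [FiniteDimensional k L] {op : L → L} (hop : IsPMap p k op)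
    (hc : NoCenter k L) {Y : Submodule k L} (hY : PAb op Y) :
    ∃ m, PT op (hY.img hop hc m) := by
  let K : ℕ →o Submodule k L := ⟨fun m =>
    { carrier := {y | y ∈ Y ∧ op^[m] y = 0}
      add_mem' := by
        rintro x y ⟨hx, hx0⟩ ⟨hy, hy0⟩
        exact ⟨Y.add_mem hx hy, by rw [hY.iter_add hop hc m hx hy, hx0, hy0, add_zero]⟩
      zero_mem' := ⟨Y.zero_mem, hop.iter_zero m⟩
      smul_mem' := by
        rintro c x ⟨hx, hx0⟩
        exact ⟨Y.smul_mem c hx, by rw [hop.iter_smul, hx0, smul_zero]⟩ }, by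
    intro a b hab x hx
    obtain ⟨c, rfl⟩ := Nat.exists_eq_add_of_le' hab
    exact ⟨hx.1, by
      have := hx.2
      change op^[c + a] x = 0
      rw [Function.iterate_add_apply, this, hop.iter_zero]⟩⟩
  obtain ⟨m, hm⟩ := monotone_stabilizes_iff_noetherian.2 (inferInstance : IsNoetherian k L) K
  refine ⟨m, { hY.img_pab hop hc m with inj := ?_ }⟩
  rintro _ ⟨x, hx, rfl⟩ h0
  have h1 : x ∈ K (m + 1) := ⟨hx, by rw [Function.iterate_succ_apply' op]; exact h0⟩
  rw [← hm (m + 1) (Nat.le_succ m)] at h1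
  exact h1.2

theorem PAb.op_sum {op : L → L} (hop : IsPMap p k op) (hc : NoCenter k L) {Y : Submodule k L}
    (hY : PAb op Y) {ι : Type*} (s : Finset ι) (f : ι → L) (hf : ∀ i, f i ∈ Y) :
    op (∑ i ∈ s, f i) = ∑ i ∈ s, op (f i) := by
  classical
  induction s using Finset.induction_on with
  | empty => simp [hop.op_zero]
  | insert a s ha ih =>
    rw [Finset.sum_insert ha, Finset.sum_insert ha,
      hop.op_add hc (hY.ab _ (hf a) _ (Y.sum_mem fun i _ => hf i)), ih]

theorem PT.linInd {op : L → L} (hop : IsPMap p k op) (hc : NoCenter k L) {Y : Submodule k L}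
    (hY : PT op Y) {ι : Type*} [Fintype ι] (f : ι → L) (hf : ∀ i, f i ∈ Y)
    (hl : LinearIndependent k f) : LinearIndependent k (fun i => op (f i)) := by
  rw [Fintype.linearIndependent_iff] at hl ⊢
  intro g hg i
  have hr : ∀ i, ∃ d : k, d ^ p = g i := fun i => by
    have := exists_root (p := p) 1 (g i)
    rwa [pow_one] at this
  choose d hd using hr
  have h1 : op (∑ i, d i • f i) = 0 := by
    rw [hY.toPAb.op_sum hop hc _ _ (fun i => Y.smul_mem _ (hf i)), ← hg]
    exact Finset.sum_congr rfl fun i _ => by rw [hop.op_smul, hd]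
  have h2 := hY.inj _ (Y.sum_mem fun i _ => Y.smul_mem _ (hf i)) h1
  rw [← hd i, hl d h2 i, zero_pow (Fact.out : p.Prime).ne_zero]

theorem PT.semisimple [FiniteDimensional k L] {op : L → L} (hop : IsPMap p k op) (hc : NoCenter k L) {Y : Submodule k L}
    (hY : PT op Y) {x : L} (hx : x ∈ Y) : IsSemisimpleElt k op x := by
  set U' := Submodule.span k {y : L | ∃ m : ℕ, 1 ≤ m ∧ y = op^[m] x} with hU'
  set U := Submodule.span k {y : L | ∃ m : ℕ, y = op^[m] x} with hU
  have hle : U' ≤ U := Submodule.span_mono (by rintro _ ⟨m, _, rfl⟩; exact ⟨m, rfl⟩)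
  have hUY : U ≤ Y := Submodule.span_le.2 (by rintro _ ⟨m, rfl⟩; exact hY.iter_mem m hx)
  have hop' : ∀ u ∈ U, op u ∈ U' := by
    intro u hu
    have : u ∈ U ∧ op u ∈ U' := by
      induction hu using Submodule.span_induction with
      | mem y hy =>
        refine ⟨Submodule.subset_span hy, ?_⟩
        obtain ⟨m, rfl⟩ := hy
        exact Submodule.subset_span ⟨m + 1, by omega, by rw [Function.iterate_succ_apply']⟩
      | zero => exact ⟨U.zero_mem, by rw [hop.op_zero]; exact U'.zero_mem⟩
      | add a b _ _ ha hb =>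
        refine ⟨U.add_mem ha.1 hb.1, ?_⟩
        rw [hop.op_add hc (hY.ab _ (hUY ha.1) _ (hUY hb.1))]
        exact U'.add_mem ha.2 hb.2
      | smul a b _ hb =>
        refine ⟨U.smul_mem a hb.1, ?_⟩
        rw [hop.op_smul]
        exact U'.smul_mem _ hb.2
    exact this.2
  let b := Module.finBasis k U
  have hli : LinearIndependent k (fun i => op (b i : L)) :=
    hY.linInd hop hc _ (fun i => hUY (b i).2) (b.linearIndependent.map' U.subtype U.ker_subtype)
  have hli' : LinearIndependent k (fun i => (⟨op (b i : L), hop' _ (b i).2⟩ : U')) :=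
    LinearIndependent.of_comp U'.subtype hli
  have h1 := hli'.fintype_card_le_finrank
  rw [Fintype.card_fin] at h1
  have := Submodule.eq_of_le_of_finrank_le hle h1
  change x ∈ U'
  rw [this]
  exact Submodule.subset_span ⟨0, rfl⟩

/-- torus as Lie subalgebra -/
def PAb.sub {op : L → L} {Y : Submodule k L} (hY : PAb op Y) : LieSubalgebra k L :=
  { Y with
    lie_mem' := by
      intro x y hx hy
      have := hY.ab x hx y hy
      rw [this]
      exact Y.zero_mem }

theorem PT.isTorus [FiniteDimensional k L] {op : L → L} (hop : IsPMap p k op) (hc : NoCenter k L)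
    {Y : Submodule k L} (hY : PT op Y) : IsTorus k op hY.toPAb.sub :=
  ⟨fun x hx => hY.cl x hx, fun _ hx => hY.semisimple hop hc hx⟩

theorem torus_ab [FiniteDimensional k L] {op : L → L} (hop : IsPMap p k op)
    {t : LieSubalgebra k L} (ht : IsTorus k op t) : ∀ x ∈ t, ∀ y ∈ t, ⁅x, y⁆ = 0 := by
  intro x hx y hy
  let f : Module.End k t := LieAlgebra.ad k t ⟨x, hx⟩
  have hf : ∀ v : t, ((f v : t) : L) = LieAlgebra.ad k L x (v : L) := fun v => rfl
  have hss : SSop f := by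
    intro m v hv
    apply Subtype.ext
    have h1 := congrArg (fun v : t => (v : L)) hv
    simp only [hf, AddSubgroupClass.coe_sub, SetLike.val_smul] at h1
    have := hop.ss (ht.2 x hx) m v h1
    rw [hf, this]; rfl
  have htop := hss.iSup_top
  have hle : (⨆ m, f.eigenspace m) ≤ LinearMap.ker f := by
    refine iSup_le fun m => ?_
    intro v hv
    rw [Module.End.mem_eigenspace_iff] at hv
    rw [LinearMap.mem_ker]
    have h1 : ⁅x, (v : L)⁆ = m • (v : L) := by
      have := congrArg (fun v : t => (v : L)) hv
      simpa [hf] using this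
    have h2 : ⁅(v : L), x⁆ = 0 := by
      have := hop.ss (ht.2 v v.2) 0 x (by
        simp only [zero_smul, sub_zero, LieAlgebra.ad_apply]
        rw [← lie_skew (v : L) x, h1]
        simp)
      simpa using this
    apply Subtype.ext
    rw [hf]
    simp only [LieAlgebra.ad_apply, ZeroMemClass.coe_zero]
    rw [← lie_skew, h2, neg_zero]
  rw [htop, top_le_iff, LinearMap.ker_eq_top] at hle
  have := hf ⟨y, hy⟩
  rw [hle] at this
  simpa using this.symm

theorem IsTorus.pt [FiniteDimensional k L] {op : L → L} (hop : IsPMap p k op)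
    {t : LieSubalgebra k L} (ht : IsTorus k op t) : PT op t.toSubmodule where
  ab := torus_ab hop ht
  cl := ht.1
  inj := by
    intro x hx h0
    have := ht.2 x hx
    have h1 : Submodule.span k {y : L | ∃ m : ℕ, 1 ≤ m ∧ y = op^[m] x} ≤ ⊥ := by
      rw [Submodule.span_le]
      rintro _ ⟨m, hm, rfl⟩
      obtain ⟨q, rfl⟩ := Nat.exists_eq_add_of_le' hm
      rw [Function.iterate_succ_apply, h0, hop.iter_zero]
      rfl
    simpa using h1 this

/-- a torus inside `Y` is inside all images -/
theorem PT.sub_img [FiniteDimensional k L] {op : L → L} (hop : IsPMap p k op) (hc : NoCenter k L)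
    {T Y : Submodule k L} (hT : PT op T) (hY : PAb op Y) (h : T ≤ Y) (m : ℕ) :
    T ≤ hY.img hop hc m := by
  have hone : ∀ x ∈ T, ∃ y ∈ T, op y = x := by
    intro x hx
    let b := Module.finBasis k T
    have hli : LinearIndependent k (fun i => op (b i : L)) :=
      hT.linInd hop hc _ (fun i => (b i).2) (b.linearIndependent.map' T.subtype T.ker_subtype)
    have hli' : LinearIndependent k (fun i => (⟨op (b i : L), hT.cl _ (b i).2⟩ : T)) :=
      LinearIndependent.of_comp T.subtype hli
    have hsp := hli'.span_eq_top_of_card_eq_finrank' (by simp)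
    have h3 : (⟨x, hx⟩ : T) ∈ (⊤ : Submodule k T) := trivial
    rw [← hsp, Submodule.mem_span_range_iff_exists_fun] at h3
    obtain ⟨c, hcx⟩ := h3
    have hr : ∀ i, ∃ d : k, d ^ p = c i := fun i => by
      have := exists_root (p := p) 1 (c i)
      rwa [pow_one] at this
    choose d hd using hr
    refine ⟨∑ i, d i • (b i : L), T.sum_mem fun i _ => T.smul_mem _ (b i).2, ?_⟩
    rw [hT.toPAb.op_sum hop hc _ _ (fun i => T.smul_mem _ (b i).2)]
    have := congrArg (fun v : T => (v : L)) hcx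
    simp only [Submodule.coe_sum, Submodule.coe_smul] at this
    rw [← this]
    exact Finset.sum_congr rfl fun i _ => by rw [hop.op_smul, hd]
  intro x hx
  have : ∃ y ∈ T, op^[m] y = x := by
    induction m generalizing x with
    | zero => exact ⟨x, hx, rfl⟩
    | succ m ih =>
      obtain ⟨y, hy, rfl⟩ := hone x hx
      obtain ⟨z, hz, rfl⟩ := ih hy
      exact ⟨z, hz, by rw [Function.iterate_succ_apply']⟩
  obtain ⟨y, hy, hyx⟩ := this
  exact ⟨y, h hy, hyx⟩

end P1


section P1b
set_option linter.unusedSectionVars false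
variable {p : ℕ} [Fact p.Prime] {k : Type*} [Field k] [CharP k p]
  {L : Type*} [LieRing L] [LieAlgebra k L]

theorem IsPMap.op_sum' {op : L → L} (hop : IsPMap p k op) (hc : NoCenter k L)
    {ι : Type*} (s : Finset ι) (f : ι → L) (hf : ∀ i j, ⁅f i, f j⁆ = 0) :
    op (∑ i ∈ s, f i) = ∑ i ∈ s, op (f i) := by
  classical
  induction s using Finset.induction_on with
  | empty => simp [hop.op_zero]
  | insert a s ha ih =>
    rw [Finset.sum_insert ha, Finset.sum_insert ha,
      hop.op_add hc (by rw [lie_sum]; exact Finset.sum_eq_zero fun i _ => hf a i), ih]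

theorem IsPMap.op_comb {op : L → L} (hop : IsPMap p k op) (hc : NoCenter k L)
    {ι : Type*} [Fintype ι] (f : ι → L) (hf : ∀ i j, ⁅f i, f j⁆ = 0) (h1 : ∀ i, op (f i) = f i)
    (c : ι → k) : op (∑ i, c i • f i) = ∑ i, (c i) ^ p • f i := by
  rw [hop.op_sum' hc _ (fun i => c i • f i) (fun i j => by rw [smul_lie, lie_smul, hf]; simp)]
  exact Finset.sum_congr rfl fun i _ => by rw [hop.op_smul, h1]

theorem IsPMap.toral_iff {op : L → L} (hop : IsPMap p k op) (hc : NoCenter k L) (x : L) :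
    LieAlgebra.ad k L x ^ p = LieAlgebra.ad k L x ↔ op x = x := by
  rw [← hop.ad_op]
  exact ⟨fun h => hc.ext h, fun h => by rw [h]⟩

theorem PT.of_toral {op : L → L} (hop : IsPMap p k op) (hc : NoCenter k L)
    {ι : Type*} [Fintype ι] (f : ι → L) (hl : LinearIndependent k f)
    (hf : ∀ i j, ⁅f i, f j⁆ = 0) (h1 : ∀ i, op (f i) = f i) :
    PT op (Submodule.span k (Set.range f)) where
  ab := by
    intro x hx y hy
    rw [Submodule.mem_span_range_iff_exists_fun] at hx hy
    obtain ⟨c, rfl⟩ := hx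
    obtain ⟨d, rfl⟩ := hy
    rw [sum_lie]
    refine Finset.sum_eq_zero fun i _ => ?_
    rw [lie_sum]
    refine Finset.sum_eq_zero fun j _ => ?_
    rw [smul_lie, lie_smul, hf]; simp
  cl := by
    intro x hx
    rw [Submodule.mem_span_range_iff_exists_fun] at hx ⊢
    obtain ⟨c, rfl⟩ := hx
    exact ⟨_, (hop.op_comb hc f hf h1 c).symm⟩
  inj := by
    intro x hx h0
    rw [Submodule.mem_span_range_iff_exists_fun] at hx
    obtain ⟨c, rfl⟩ := hx
    rw [hop.op_comb hc f hf h1 c] at h0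
    rw [Fintype.linearIndependent_iff] at hl
    have := hl _ h0
    refine Finset.sum_eq_zero fun i _ => ?_
    rw [pow_eq_zero_iff (Fact.out : p.Prime).ne_zero |>.1 (this i), zero_smul]

variable [IsAlgClosed k] [FiniteDimensional k L]

theorem PT.data {op : L → L} (hop : IsPMap p k op) (hc : NoCenter k L) {T : Submodule k L}
    (hT : PT op T) : ∃ (n : ℕ) (b : Module.Basis (Fin n) k L)
      (h : Module.Basis (Fin (Module.finrank k T)) k T)
      (w : Fin n → Fin (Module.finrank k T) → ZMod p),
      ∀ j i, ⁅(h i : L), b j⁆ = cz p k (w j i) • b j := by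
  obtain ⟨n, b, e, he⟩ := simDiag (fun x : T => LieAlgebra.ad k L (x : L))
    (fun x => hop.ss (hT.semisimple hop hc x.2)) (fun x y => ad_commute (hT.ab _ x.2 _ y.2))
  have he' : ∀ j (x : T), ⁅(x : L), b j⁆ = e j x • b j := he
  have hadd : ∀ j (x y : T), e j (x + y) = e j x + e j y := by
    intro j x y
    apply smul_left_injective k (b.ne_zero j)
    simp only
    rw [← he', add_smul, ← he', ← he', Submodule.coe_add, add_lie]
  have hsm : ∀ j (c : k) (x : T), e j (c • x) = c * e j x := by
    intro j c x
    apply smul_left_injective k (b.ne_zero j)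
    simp only
    rw [← he', mul_smul, ← he', Submodule.coe_smul, smul_lie]
  let χ : Fin n → Module.Dual k T := fun j => 
    { toFun := e j, map_add' := hadd j, map_smul' := hsm j }
  have hχ : ∀ j (x : T), ⁅(x : L), b j⁆ = χ j x • b j := he
  have hsep : ∀ x : T, (∀ j, χ j x = 0) → x = 0 := by
    intro x hx
    apply Subtype.ext
    apply hc
    apply b.ext
    intro j
    rw [LieAlgebra.ad_apply, hχ, hx, zero_smul]; rfl
  have hspan : ⊤ ≤ Submodule.span k (Set.range χ) := by
    have h0 : (Submodule.span k (Set.range χ)).dualCoannihilator = ⊥ := by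
      rw [eq_bot_iff]
      intro x hx
      rw [Submodule.mem_dualCoannihilator] at hx
      exact hsep x fun j => hx _ (Submodule.subset_span ⟨j, rfl⟩)
    rw [top_le_iff]
    rw [← Subspace.dualCoannihilator_dualAnnihilator_eq (W := Submodule.span k (Set.range χ)), h0,
      Submodule.dualAnnihilator_bot]
  let B0 := Module.Basis.ofSpan hspan
  have hfin : Finite _ := Module.Finite.finite_basis B0
  have hft := Fintype.ofFinite (((linearIndepOn_empty k id).extend (Set.empty_subset (Set.range χ))))
  have hcard : Fintype.card (((linearIndepOn_empty k id).extend (Set.empty_subset (Set.range χ)))) =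
      Module.finrank k T := by
    rw [← Module.finrank_eq_card_basis B0, Subspace.dual_finrank_eq]
  let B : Module.Basis (Fin (Module.finrank k T)) k (Module.Dual k T) :=
    B0.reindex (Fintype.equivFinOfCardEq hcard)
  have hB : ∀ i, ∃ j, χ j = B i := by
    intro i
    apply Module.Basis.ofSpan_subset hspan
    simp only [B, Module.Basis.reindex_apply]
    exact ⟨_, rfl⟩
  let h : Module.Basis (Fin (Module.finrank k T)) k T := B.dualBasis.map (Module.evalEquiv k T).symm
  have hh : ∀ i i', B i' (h i) = if i = i' then 1 else 0 := by
    intro i i'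
    have : B i' (h i) = (Module.evalEquiv k T (h i)) (B i') := rfl
    rw [this]
    simp only [h, Module.Basis.map_apply, LinearEquiv.apply_symm_apply]
    rw [Module.Basis.dualBasis_apply_self]
    simp [eq_comm]
  have hpw : ∀ j (x : T), χ j ⟨op x, hT.cl x x.2⟩ = (χ j x) ^ p := by
    intro j x
    apply smul_left_injective k (b.ne_zero j)
    simp only
    rw [← hχ]
    have h1 : ⁅op (x : L), b j⁆ = (LieAlgebra.ad k L (x : L) ^ p) (b j) := by
      rw [← hop.ad_op]; rfl
    rw [h1]
    have : ∀ m : ℕ, (LieAlgebra.ad k L (x : L) ^ m) (b j) = (χ j x) ^ m • b j := by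
      intro m
      induction m with
      | zero => simp
      | succ m ih =>
        rw [pow_succ', Module.End.mul_apply, ih, map_smul, LieAlgebra.ad_apply, hχ, smul_smul,
          pow_succ]
    exact this p
  have hsepB : ∀ x y : T, (∀ i, B i x = B i y) → x = y := by
    intro x y hxy
    rw [← sub_eq_zero]
    apply hsep
    intro j
    have : χ j ∈ Submodule.span k (Set.range B) := by rw [B.span_eq]; trivial
    generalize χ j = g at this ⊢
    induction this using Submodule.span_induction with
    | mem f hf => obtain ⟨i, rfl⟩ := hf; rw [map_sub, hxy, sub_self]
    | zero => rfl
    | add f g _ _ hf hg => rw [LinearMap.add_apply, hf, hg, add_zero]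
    | smul c f _ hf => rw [LinearMap.smul_apply, hf, smul_zero]
  have hopfix : ∀ i, (⟨op (h i), hT.cl _ (h i).2⟩ : T) = h i := by
    intro i
    apply hsepB
    intro i'
    obtain ⟨j, hj⟩ := hB i'
    rw [← hj, hpw, hj, hh]
    split_ifs
    · rw [one_pow]
    · rw [zero_pow (Fact.out : p.Prime).ne_zero]
  have hfix : ∀ j i, ∃ l : ZMod p, cz p k l = χ j (h i) := by
    intro j i
    apply cz_of_fixed
    rw [← hpw, hopfix]
  choose w hw using hfix
  exact ⟨n, b, h, w, fun j i => by rw [hχ, hw]⟩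

end P1b


section P1c
set_option linter.unusedSectionVars false
variable {p : ℕ} [Fact p.Prime]

theorem card_dot {d : ℕ} (v : Fin d → ZMod p) (hv : v ≠ 0) :
    p * (Finset.univ.filter fun a : Fin d → ZMod p => a ⬝ᵥ v = 0).card = p ^ d := by
  classical
  let f : (Fin d → ZMod p) →ₗ[ZMod p] ZMod p :=
    { toFun := fun a => a ⬝ᵥ v, map_add' := fun a b => add_dotProduct a b v,
      map_smul' := fun c a => smul_dotProduct c a v }
  obtain ⟨i, hi⟩ := Function.ne_iff.1 hv
  have hsurj : Function.Surjective f := by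
    intro x
    refine ⟨Pi.single i (x * (v i)⁻¹), ?_⟩
    change Pi.single i (x * (v i)⁻¹) ⬝ᵥ v = x
    rw [single_dotProduct, mul_assoc, inv_mul_cancel₀ hi, mul_one]
  have h1 := LinearMap.finrank_range_add_finrank_ker f
  rw [LinearMap.range_eq_top.2 hsurj] at h1
  simp only [finrank_top, Module.finrank_self, Module.finrank_fin_fun] at h1
  have h2 : (Finset.univ.filter fun a : Fin d → ZMod p => a ⬝ᵥ v = 0).card =
      Fintype.card (LinearMap.ker f) := by
    rw [Fintype.card_subtype]
    congr 1
    ext a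
    simp [f]
  rw [h2, Module.card_eq_pow_finrank (K := ZMod p), ZMod.card, ← pow_succ']
  congr 1
  omega

theorem radon {n d : ℕ} (w : Fin n → Fin (d + 1) → ZMod p) (c : ℕ)
    (hc : ∀ a : Fin (d + 1) → ZMod p, a ≠ 0 → ∀ l : ZMod p, l ≠ 0 →
      (Finset.univ.filter fun j => a ⬝ᵥ w j = l).card = c) (lam : Fin (d + 1) → ZMod p) (hl : lam ≠ 0) :
    (Finset.univ.filter fun j => w j = lam).card * p ^ d = c := by
  classical
  have hp : 0 < p := (Fact.out : p.Prime).pos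
  have hp1 : 1 < p := (Fact.out : p.Prime).one_lt
  -- number of zeros
  have hz : ∀ a : Fin (d + 1) → ZMod p, a ≠ 0 →
      (Finset.univ.filter fun j => a ⬝ᵥ w j = 0).card + (p - 1) * c = n := by
    intro a ha
    have h1 := Finset.card_eq_sum_card_fiberwise (f := fun j : Fin n => a ⬝ᵥ w j) (s := Finset.univ)
      (t := Finset.univ) (fun _ _ => Finset.mem_coe.2 (Finset.mem_univ _))
    rw [Finset.card_univ, Fintype.card_fin] at h1
    refine Eq.trans ?_ h1.symm
    rw [← Finset.add_sum_erase _ _ (Finset.mem_univ (0 : ZMod p))]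
    rw [Finset.sum_congr rfl (g := fun _ => c)]
    · rw [Finset.sum_const, Finset.card_erase_of_mem (Finset.mem_univ _), Finset.card_univ, ZMod.card,
        smul_eq_mul]
    · intro l hl'
      exact hc a ha l (Finset.ne_of_mem_erase hl')
  have hd : ∀ v : Fin (d + 1) → ZMod p, v ≠ 0 →
      (Finset.univ.filter fun a : Fin (d + 1) → ZMod p => a ⬝ᵥ v = 0).card = p ^ d := by
    intro v hv
    have := card_dot v hv
    rw [pow_succ'] at this
    exact Nat.eq_of_mul_eq_mul_left hp this
  -- double count
  have hcomm : ∑ a : Fin (d + 1) → ZMod p, (Finset.univ.filter fun j => a ⬝ᵥ (w j - lam) = 0).card =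
      ∑ j, (Finset.univ.filter fun a : Fin (d + 1) → ZMod p => a ⬝ᵥ (w j - lam) = 0).card := by
    simp_rw [Finset.card_filter]
    exact Finset.sum_comm
  set N := (Finset.univ.filter fun j => w j = lam).card with hN
  have hR : (∑ j, (Finset.univ.filter fun a : Fin (d + 1) → ZMod p => a ⬝ᵥ (w j - lam) = 0).card : ℤ) =
      N * (p ^ (d + 1) : ℤ) + ((n : ℤ) - N) * p ^ d := by
    rw [← Finset.sum_filter_add_sum_filter_not Finset.univ (fun j => w j = lam)]
    congr 1
    · rw [Finset.sum_congr rfl (g := fun _ => (p ^ (d + 1) : ℤ))]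
      · rw [Finset.sum_const, nsmul_eq_mul]
      · intro j hj
        rw [(Finset.mem_filter.1 hj).2]
        simp [ZMod.card]
    · rw [Finset.sum_congr rfl (g := fun _ => (p ^ d : ℤ))]
      · rw [Finset.sum_const, nsmul_eq_mul]
        congr 1
        have := Finset.card_filter_add_card_filter_not (s := (Finset.univ : Finset (Fin n))) (fun j => w j = lam)
        rw [Finset.card_univ, Fintype.card_fin] at this
        rw [eq_sub_iff_add_eq, add_comm]
        exact_mod_cast this
      · intro j hj
        have := hd (w j - lam) (sub_ne_zero.2 (Finset.mem_filter.1 hj).2)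
        rw [this]
        push_cast; rfl
  have hLs : ∀ a : Fin (d + 1) → ZMod p,
      ((Finset.univ.filter fun j => a ⬝ᵥ (w j - lam) = 0).card : ℤ) =
        c + (if a ⬝ᵥ lam = 0 then ((n : ℤ) - p * c) else 0) + (if a = 0 then ((p - 1) * c : ℤ) else 0) := by
    intro a
    by_cases ha : a = 0
    · subst ha
      simp
      ring
    · simp only [dotProduct_sub, sub_eq_zero]
      by_cases h0 : a ⬝ᵥ lam = 0
      · have := hz a ha
        rw [h0, if_pos rfl, if_neg ha]
        have h2 : (((Finset.univ.filter fun j => a ⬝ᵥ w j = 0).card : ℤ)) + (p - 1) * c = n := by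
          zify [hp1.le] at this; linarith
        linarith
      · rw [if_neg h0, if_neg ha, hc a ha _ h0]
        ring
  have hL : (∑ a : Fin (d + 1) → ZMod p, ((Finset.univ.filter fun j => a ⬝ᵥ (w j - lam) = 0).card : ℤ)) =
      (p ^ (d + 1) : ℤ) * c + p ^ d * ((n : ℤ) - p * c) + (p - 1) * c := by
    simp_rw [hLs]
    rw [Finset.sum_add_distrib, Finset.sum_add_distrib, Finset.sum_const, ← Finset.sum_filter,
      Finset.sum_const, hd lam hl, Finset.sum_ite_eq' Finset.univ 0]
    simp [ZMod.card]
  have hcomm' : (∑ a : Fin (d + 1) → ZMod p, ((Finset.univ.filter fun j => a ⬝ᵥ (w j - lam) = 0).card : ℤ)) = 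
      (∑ j, (Finset.univ.filter fun a : Fin (d + 1) → ZMod p => a ⬝ᵥ (w j - lam) = 0).card : ℤ) := by
    exact_mod_cast hcomm
  rw [hL, hR] at hcomm'
  have h3 : ((p : ℤ) - 1) * ((N : ℤ) * p ^ d - c) = 0 := by
    rw [pow_succ] at hcomm'
    linarith
  have h4 : ((p : ℤ) - 1) ≠ 0 := by
    have : (1 : ℤ) < p := by exact_mod_cast hp1
    linarith
  have h5 := (mul_eq_zero.1 h3).resolve_left h4
  have h6 : (N : ℤ) * p ^ d = c := by linarith
  exact_mod_cast h6

theorem radon_zero {n d : ℕ} (w : Fin n → Fin (d + 1) → ZMod p) (C : ℕ)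
    (hC : ∀ lam : Fin (d + 1) → ZMod p, lam ≠ 0 → (Finset.univ.filter fun j => w j = lam).card = C) :
    (Finset.univ.filter fun j => w j = 0).card + (p ^ (d + 1) - 1) * C = n := by
  classical
  have h1 := Finset.card_eq_sum_card_fiberwise (f := fun j : Fin n => w j) (s := Finset.univ)
      (t := Finset.univ) (fun _ _ => Finset.mem_coe.2 (Finset.mem_univ _))
  rw [Finset.card_univ, Fintype.card_fin] at h1
  refine Eq.trans ?_ h1.symm
  rw [← Finset.add_sum_erase _ _ (Finset.mem_univ (0 : Fin (d + 1) → ZMod p))]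
  rw [Finset.sum_congr rfl (g := fun _ => C)]
  · rw [Finset.sum_const, Finset.card_erase_of_mem (Finset.mem_univ _), Finset.card_univ,
        smul_eq_mul]
    simp [ZMod.card]
  · intro l hl'
    exact hC l (Finset.ne_of_mem_erase hl')

end P1c


section P1d
set_option linter.unusedSectionVars false
variable {p : ℕ} [Fact p.Prime] {k : Type*} [Field k] [CharP k p]
  {L : Type*} [LieRing L] [LieAlgebra k L] [IsAlgClosed k] [FiniteDimensional k L]

theorem coe_ad_pow (H : LieSubalgebra k L) (x y : H) (m : ℕ) :
    (((LieAlgebra.ad k H x) ^ m) y : L) = ((LieAlgebra.ad k L (x : L)) ^ m) (y : L) := by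
  induction m with
  | zero => rfl
  | succ m ih =>
    rw [pow_succ', pow_succ', Module.End.mul_apply, Module.End.mul_apply, ← ih]
    rfl

theorem ad_pow_mem (H : LieSubalgebra k L) {x y : L} (hx : x ∈ H) (hy : y ∈ H) (m : ℕ) :
    ((LieAlgebra.ad k L x) ^ m) y ∈ H := by
  have := coe_ad_pow H ⟨x, hx⟩ ⟨y, hy⟩ m
  simp only at this
  rw [← this]
  exact Subtype.mem _

theorem csa_torus {op : L → L} (hop : IsPMap p k op) (hc : NoCenter k L) (H : LieSubalgebra k L)
    (hH : H.IsCartanSubalgebra) :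
    ∃ T : Submodule k L, PT op T ∧ ∀ x, x ∈ H ↔ ∀ y ∈ T, ⁅y, x⁆ = 0 := by
  have hp : 1 < p := (Fact.out : p.Prime).one_lt
  have hcl : ∀ x ∈ H, op x ∈ H := by
    intro x hx
    rw [← hH.self_normalizing, LieSubalgebra.mem_normalizer_iff]
    intro y hy
    have : ⁅op x, y⁆ = ((LieAlgebra.ad k L x) ^ p) y := by rw [← hop.ad_op]; rfl
    rw [this]
    exact ad_pow_mem H hx hy p
  have hcl' : ∀ m, ∀ x ∈ H, op^[m] x ∈ H := by
    intro m x hx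
    induction m with
    | zero => exact hx
    | succ m ih => rw [Function.iterate_succ_apply']; exact hcl _ ih
  have hnil := (LieAlgebra.isNilpotent_iff_forall (R := k) (L := H)).1 hH.nilpotent
  have hZ : ∀ x ∈ H, ∃ m, ∀ y ∈ H, ⁅op^[m] x, y⁆ = 0 := by
    intro x hx
    obtain ⟨m, hm⟩ := hnil ⟨x, hx⟩
    refine ⟨m, fun y hy => ?_⟩
    have h1 : ⁅op^[m] x, y⁆ = ((LieAlgebra.ad k L x) ^ (p ^ m)) y := by rw [← hop.ad_iter]; rfl
    have h2 := coe_ad_pow H ⟨x, hx⟩ ⟨y, hy⟩ (p ^ m)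
    rw [pow_eq_zero_of_le (Nat.lt_pow_self hp).le hm] at h2
    rw [h1]
    exact h2.symm
  let Y : Submodule k L :=
    { carrier := {y | y ∈ H ∧ ∀ x ∈ H, ⁅y, x⁆ = 0}
      add_mem' := by
        rintro a b ⟨ha, ha'⟩ ⟨hb, hb'⟩
        exact ⟨H.add_mem ha hb, fun x hx => by rw [add_lie, ha' x hx, hb' x hx, add_zero]⟩
      zero_mem' := ⟨H.zero_mem, fun x _ => zero_lie x⟩
      smul_mem' := by
        rintro c a ⟨ha, ha'⟩
        exact ⟨H.smul_mem c ha, fun x hx => by rw [smul_lie, ha' x hx, smul_zero]⟩ }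
  have hY : PAb op Y :=
    { ab := fun x hx y hy => hx.2 y hy.1
      cl := fun x hx => ⟨hcl x hx.1, fun y hy => hop.lie_iter_zero (hx.2 y hy) 1⟩ }
  obtain ⟨M, hM⟩ := hY.exists_torus hop hc
  refine ⟨_, hM, fun x => ⟨?_, ?_⟩⟩
  · rintro hx _ ⟨y, hy, rfl⟩
    exact hop.lie_iter_zero (hy.2 x hx) M
  · intro hx
    have hmem : x ∈ LieAlgebra.zeroRootSubalgebra k L H := by
      rw [LieAlgebra.mem_zeroRootSubalgebra]
      intro y
      obtain ⟨m, hm⟩ := hZ y y.2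
      refine ⟨p ^ (M + m), ?_⟩
      have h1 : LieModule.toEnd k H L y = LieAlgebra.ad k L (y : L) := rfl
      rw [h1, ← hop.ad_iter, Function.iterate_add_apply]
      exact hx _ ⟨op^[m] y, ⟨hcl' m y y.2, hm⟩, rfl⟩
    rwa [LieAlgebra.zeroRootSubalgebra_eq_of_is_cartan] at hmem

/-- centralizer -/
def centz (T : Submodule k L) : LieSubalgebra k L where
  carrier := {x | ∀ y ∈ T, ⁅y, x⁆ = 0}
  add_mem' := fun {a b} ha hb y hy => by rw [lie_add, ha y hy, hb y hy, add_zero]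
  zero_mem' := fun y _ => lie_zero y
  smul_mem' := fun c a ha y hy => by rw [lie_smul, ha y hy, smul_zero]
  lie_mem' := fun {a b} ha hb y hy => by
    rw [leibniz_lie, ha y hy, hb y hy, zero_lie, lie_zero, add_zero]

theorem mu_bdd (op : L → L) :
    BddAbove {d : ℕ | ∃ t : LieSubalgebra k L, IsTorus k op t ∧ Module.finrank k t = d} := by
  refine ⟨Module.finrank k L, ?_⟩
  rintro _ ⟨t, _, rfl⟩
  exact Submodule.finrank_le t.toSubmodule

theorem PT.le_mu {op : L → L} (hop : IsPMap p k op) (hc : NoCenter k L)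
    {Y : Submodule k L} (hY : PT op Y) : Module.finrank k Y ≤ mu k op :=
  le_csSup (mu_bdd op) ⟨_, hY.isTorus hop hc, rfl⟩

theorem csa_of_max {op : L → L} (hop : IsPMap p k op) (hc : NoCenter k L) {T : Submodule k L}
    (hT : PT op T) (hmax : Module.finrank k T = mu k op) : (centz T).IsCartanSubalgebra := by
  constructor
  · rw [LieAlgebra.isNilpotent_iff_forall (R := k)]
    intro ⟨x, hx⟩
    have hxc : ∀ y ∈ T, ⁅x, y⁆ = 0 := fun y hy => by rw [← lie_skew, hx y hy, neg_zero]
    let U := Submodule.span k {y : L | ∃ m : ℕ, y = op^[m] x}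
    have hUT : ∀ u ∈ U, ∀ y ∈ T, ⁅u, y⁆ = 0 := by
      intro u hu y hy
      induction hu using Submodule.span_induction with
      | mem u hu => obtain ⟨m, rfl⟩ := hu; exact hop.lie_iter_zero (hxc y hy) m
      | zero => exact zero_lie y
      | add a b _ _ ha hb => rw [add_lie, ha, hb, add_zero]
      | smul c a _ ha => rw [smul_lie, ha, smul_zero]
    have hUU : ∀ u ∈ U, ∀ v ∈ U, ⁅u, v⁆ = 0 := by
      intro u hu v hv
      induction hu using Submodule.span_induction with
      | mem u hu =>
        obtain ⟨m, rfl⟩ := hu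
        induction hv using Submodule.span_induction with
        | mem u hu =>
          obtain ⟨m', rfl⟩ := hu
          apply hop.lie_iter_zero
          rw [← lie_skew, hop.lie_iter_zero (lie_self x) m', neg_zero]
        | zero => exact lie_zero _
        | add a b _ _ ha hb => rw [lie_add, ha, hb, add_zero]
        | smul c a _ ha => rw [lie_smul, ha, smul_zero]
      | zero => exact zero_lie _
      | add a b _ _ ha hb => rw [add_lie, ha, hb, add_zero]
      | smul c a _ ha => rw [smul_lie, ha, smul_zero]
    have hUcl : ∀ u ∈ U, u ∈ U ∧ op u ∈ U := by
      intro u hu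
      induction hu using Submodule.span_induction with
      | mem y hy =>
        refine ⟨Submodule.subset_span hy, ?_⟩
        obtain ⟨m, rfl⟩ := hy
        exact Submodule.subset_span ⟨m + 1, by rw [Function.iterate_succ_apply']⟩
      | zero => exact ⟨U.zero_mem, by rw [hop.op_zero]; exact U.zero_mem⟩
      | add a b _ _ ha hb =>
        refine ⟨U.add_mem ha.1 hb.1, ?_⟩
        rw [hop.op_add hc (hUU _ ha.1 _ hb.1)]
        exact U.add_mem ha.2 hb.2
      | smul a b _ hb =>
        refine ⟨U.smul_mem a hb.1, ?_⟩
        rw [hop.op_smul]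
        exact U.smul_mem _ hb.2
    have hY : PAb op (T ⊔ U) :=
      { ab := by
          intro a ha b hb
          obtain ⟨a1, ha1, a2, ha2, rfl⟩ := Submodule.mem_sup.1 ha
          obtain ⟨b1, hb1, b2, hb2, rfl⟩ := Submodule.mem_sup.1 hb
          rw [add_lie, lie_add, lie_add, hT.ab _ ha1 _ hb1, hUT _ ha2 _ hb1, hUU _ ha2 _ hb2,
            ← lie_skew, hUT _ hb2 _ ha1]
          simp
        cl := by
          intro a ha
          obtain ⟨a1, ha1, a2, ha2, rfl⟩ := Submodule.mem_sup.1 ha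
          rw [hop.op_add hc (by rw [← lie_skew, hUT _ ha2 _ ha1, neg_zero])]
          exact Submodule.mem_sup.2 ⟨_, hT.cl _ ha1, _, (hUcl _ ha2).2, rfl⟩ }
    obtain ⟨M, hM⟩ := hY.exists_torus hop hc
    have hle := hT.sub_img hop hc hY le_sup_left M
    have heq := Submodule.eq_of_le_of_finrank_le hle (by rw [hmax]; exact hM.le_mu hop hc)
    have hxT : op^[M] x ∈ T := by
      rw [heq]
      exact ⟨x, Submodule.mem_sup_right (Submodule.subset_span ⟨0, rfl⟩), rfl⟩
    refine ⟨p ^ M, ?_⟩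
    ext ⟨y, hy⟩
    rw [coe_ad_pow]
    simp only
    rw [← hop.ad_iter]
    exact hy _ hxT
  · apply le_antisymm
    · intro y hy x hx
      rw [LieSubalgebra.mem_normalizer_iff] at hy
      have hxc : x ∈ centz T := fun z hz => hT.ab z hz x hx
      have h1 : ⁅x, ⁅y, x⁆⁆ = 0 := hy x hxc x hx
      have h2 : ⁅x, ⁅x, y⁆⁆ = 0 := by rw [← lie_skew x y, lie_neg, h1, neg_zero]
      have := hop.ss (hT.semisimple hop hc hx) 0 y (by simpa using h2)
      simpa using this
    · exact LieSubalgebra.le_normalizer _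

end P1d


section P1e
set_option linter.unusedSectionVars false

/-- numerical data sufficient for the theorem -/
def GoodData (p : ℕ) (k : Type*) [Field k] [CharP k p] (L : Type*) [LieRing L] [LieAlgebra k L] : Prop :=
  ∃ c B d0 : ℕ, 1 ≤ d0 ∧ c ≤ B * p ^ (d0 - 1) ∧
    Module.finrank k L + B + 1 ≤ p * c + p ^ d0 ∧
    (∀ h : L, h ≠ 0 → LieAlgebra.ad k L h ^ p = LieAlgebra.ad k L h →
      (∀ l : ZMod p, l ≠ 0 → Module.finrank k ((LieAlgebra.ad k L h).eigenspace (cz p k l)) = c) ∨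
      ((∀ h' : L, LieAlgebra.ad k L h' ^ p = LieAlgebra.ad k L h' → ⁅h, h'⁆ = 0 → ∃ a : k, h' = a • h) ∧
        2 ≤ d0 ∧ Module.finrank k L + B ≤ Module.finrank k ((LieAlgebra.ad k L h).eigenspace 0) + p * c)) ∧
    ∃ hh : Fin d0 → L, LinearIndependent k hh ∧ (∀ i j, ⁅hh i, hh j⁆ = 0) ∧
      ∀ i, LieAlgebra.ad k L (hh i) ^ p = LieAlgebra.ad k L (hh i)

variable {p : ℕ} [Fact p.Prime] {k : Type*} [Field k] [CharP k p]
  {L : Type*} [LieRing L] [LieAlgebra k L] [IsAlgClosed k] [FiniteDimensional k L]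

theorem torus_count {op : L → L} (hop : IsPMap p k op) (hc : NoCenter k L) {T : Submodule k L}
    (hT : PT op T) {n d : ℕ} (b : Module.Basis (Fin n) k L) (h : Module.Basis (Fin (d + 1)) k T)
    (w : Fin n → Fin (d + 1) → ZMod p) (hw : ∀ j i, ⁅(h i : L), b j⁆ = cz p k (w j i) • b j)
    {c B d0 : ℕ}
    (hh : ∀ h : L, h ≠ 0 → LieAlgebra.ad k L h ^ p = LieAlgebra.ad k L h →
      (∀ l : ZMod p, l ≠ 0 → Module.finrank k ((LieAlgebra.ad k L h).eigenspace (cz p k l)) = c) ∨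
      ((∀ h' : L, LieAlgebra.ad k L h' ^ p = LieAlgebra.ad k L h' → ⁅h, h'⁆ = 0 → ∃ a : k, h' = a • h) ∧
        2 ≤ d0 ∧ Module.finrank k L + B ≤ Module.finrank k ((LieAlgebra.ad k L h).eigenspace 0) + p * c)) :
    (∃ C, C * p ^ d = c ∧
      ∀ lam : Fin (d + 1) → ZMod p, lam ≠ 0 → (Finset.univ.filter fun j => w j = lam).card = C) ∨
    (d = 0 ∧ 2 ≤ d0 ∧ n + B ≤ (Finset.univ.filter fun j => w j = 0).card + p * c) := by
  classical
  have hn : Module.finrank k L = n := by rw [Module.finrank_eq_card_basis b, Fintype.card_fin]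
  have hadw : ∀ j (a : Fin (d + 1) → ZMod p),
      ⁅∑ i, cz p k (a i) • (h i : L), b j⁆ = cz p k (a ⬝ᵥ w j) • b j := by
    intro j a
    rw [sum_lie]
    simp only [smul_lie, hw, smul_smul, ← map_mul]
    rw [← Finset.sum_smul, ← map_sum]
    rfl
  have htor : ∀ x : L, ∀ e : Fin n → ZMod p, (∀ j, ⁅x, b j⁆ = cz p k (e j) • b j) →
      LieAlgebra.ad k L x ^ p = LieAlgebra.ad k L x := by
    intro x e he
    apply b.ext
    intro j
    have : ∀ m : ℕ, (LieAlgebra.ad k L x ^ m) (b j) = (cz p k (e j)) ^ m • b j := by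
      intro m
      induction m with
      | zero => simp
      | succ m ih =>
        rw [pow_succ', Module.End.mul_apply, ih, map_smul, LieAlgebra.ad_apply, he, smul_smul,
          pow_succ]
    rw [this, cz_pow, LieAlgebra.ad_apply, he]
  have hfr : ∀ a : Fin (d + 1) → ZMod p, ∀ l : ZMod p,
      Module.finrank k ((LieAlgebra.ad k L (∑ i, cz p k (a i) • (h i : L))).eigenspace (cz p k l)) =
        (Finset.univ.filter fun j => a ⬝ᵥ w j = l).card := by
    intro a l
    refine finrank_joint (I := Unit) b (fun _ => LieAlgebra.ad k L (∑ i, cz p k (a i) • (h i : L)))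
      (fun j _ => cz p k (a ⬝ᵥ w j)) (fun j _ => hadw j a) (fun _ => cz p k l) _ ?_ _ ?_
    · intro v; rw [Module.End.mem_eigenspace_iff]; simp
    · intro j
      simp [(cz_inj (p := p) (k := k)).eq_iff]
  have hne : ∀ a : Fin (d + 1) → ZMod p, a ≠ 0 → (∑ i, cz p k (a i) • (h i : L)) ≠ 0 := by
    intro a ha h0
    apply ha
    have hli : LinearIndependent k (fun i => (h i : L)) :=
      h.linearIndependent.map' T.subtype T.ker_subtype
    rw [Fintype.linearIndependent_iff] at hli
    ext i
    have := hli _ h0 i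
    rw [← map_zero (cz p k)] at this
    exact congrArg ZMod.val (cz_inj this) |> fun hh => by
      have := ZMod.val_injective p hh
      rw [this]; rfl
  by_cases hall : ∀ a : Fin (d + 1) → ZMod p, a ≠ 0 → ∀ l : ZMod p, l ≠ 0 →
      (Finset.univ.filter fun j => a ⬝ᵥ w j = l).card = c
  · left
    have hp : 0 < p ^ d := pow_pos (Fact.out : p.Prime).pos d
    refine ⟨c / p ^ d, ?_, ?_⟩
    · have h1 := radon w c hall (Pi.single 0 1) (by simp)
      rw [← h1, Nat.mul_div_cancel _ hp]
    · intro lam hl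
      have h1 := radon w c hall lam hl
      rw [← h1, Nat.mul_div_cancel _ hp]
  · right
    push Not at hall
    obtain ⟨a, ha, l, hl, hne'⟩ := hall
    have h2 := (hh _ (hne a ha) (htor _ _ (fun j => hadw j a))).resolve_left (by
      intro h3
      exact hne' (by rw [← hfr, h3 l hl]))
    obtain ⟨h3, h4, h5⟩ := h2
    have hprop : ∀ i, ∃ s : k, (h i : L) = s • ∑ i, cz p k (a i) • (h i : L) := by
      intro i
      apply h3 _ (htor _ _ (fun j => hw j i))
      rw [sum_lie]
      exact Finset.sum_eq_zero fun i' _ => by rw [smul_lie, hT.ab _ (h i').2 _ (h i).2, smul_zero]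
    have hd : d = 0 := by
      have hli : LinearIndependent k (fun i => (h i : L)) :=
        h.linearIndependent.map' T.subtype T.ker_subtype
      have hle : Submodule.span k (Set.range fun i => (h i : L)) ≤
          Submodule.span k {∑ i, cz p k (a i) • (h i : L)} := by
        rw [Submodule.span_le]
        rintro _ ⟨i, rfl⟩
        obtain ⟨s, hs⟩ := hprop i
        exact Submodule.mem_span_singleton.2 ⟨s, hs.symm⟩
      have h6 := Submodule.finrank_mono hle
      rw [finrank_span_eq_card hli, Fintype.card_fin] at h6
      have h7 := finrank_span_le_card (R := k) ({∑ i, cz p k (a i) • (h i : L)} : Set L)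
      simp at h7
      omega
    refine ⟨hd, h4, ?_⟩
    rw [← map_zero (cz p k), hfr, hn] at h5
    refine h5.trans (Nat.add_le_add_right (Finset.card_le_card ?_) _)
    intro j hj
    subst hd
    simp only [Finset.mem_filter, Finset.mem_univ, true_and] at hj ⊢
    ext i
    have hi : i = 0 := Fin.ext (by omega)
    subst hi
    simp [dotProduct] at hj
    rcases hj with hj | hj
    · exact absurd (by
        ext i
        have hi : i = 0 := Fin.ext (by omega)
        rw [hi, hj]; rfl) ha
    · rw [hj]; rfl

theorem main_abstract {op : L → L} (hop : IsPMap p k op) (hc : NoCenter k L)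
    (hG : GoodData p k L)
    (t : LieSubalgebra k L) (ht : IsTorus k op t)
    (htmax : Module.finrank k t = mu k op) :
    ∃ χ : (t : LieSubalgebra k L) →ₗ[k] k, χ ≠ 0 ∧ charWeightSpace k t χ L ≠ ⊥ ∧
      Module.finrank k L = lieRank k L
        + (p ^ (mu k op) - 1) * Module.finrank k (charWeightSpace k t χ L) ∧
      Module.finrank k (charWeightSpace k t χ L)
        = sSup {m : ℕ | m * (p ^ (mu k op) - 1) < Module.finrank k L} := by
  classical
  have hp0 : 0 < p := (Fact.out : p.Prime).pos
  obtain ⟨c, B, d0, hd0, hcB, hN, hh, hhv, hhl, hhc, hht⟩ := hG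
  have hT : PT op t.toSubmodule := ht.pt hop
  have hmu : d0 ≤ mu k op := by
    have h1 := (PT.of_toral hop hc hhv hhl hhc (fun i => (hop.toral_iff hc _).1 (hht i))).le_mu hop hc
    rwa [finrank_span_eq_card hhl, Fintype.card_fin] at h1
  obtain ⟨n, b, h, w, hw⟩ := hT.data hop hc
  have hn : Module.finrank k L = n := by rw [Module.finrank_eq_card_basis b, Fintype.card_fin]
  obtain ⟨d, hd⟩ : ∃ d, mu k op = d + 1 := ⟨mu k op - 1, by omega⟩
  have hdT : Module.finrank k t.toSubmodule = d + 1 := by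
    rw [← hd, ← htmax]; rfl
  -- recast
  obtain ⟨h, w, hw⟩ : ∃ (h : Module.Basis (Fin (d + 1)) k t.toSubmodule)
      (w : Fin n → Fin (d + 1) → ZMod p), ∀ j i, ⁅(h i : L), b j⁆ = cz p k (w j i) • b j := by
    rw [← hdT]; exact ⟨h, w, hw⟩
  have hcount := torus_count hop hc hT b h w hw hh
  have hfirst : ∃ C, C * p ^ d = c ∧
      ∀ lam : Fin (d + 1) → ZMod p, lam ≠ 0 → (Finset.univ.filter fun j => w j = lam).card = C := by
    rcases hcount with h1 | ⟨h1, h2, _⟩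
    · exact h1
    · omega
  obtain ⟨C, hCc, hC⟩ := hfirst
  have hz := radon_zero w C hC
  set R := (Finset.univ.filter fun j => w j = 0).card with hR
  -- weight spaces
  have hwt : ∀ (χ : t →ₗ[k] k) (lam : Fin (d + 1) → ZMod p), (∀ i, χ (h i) = cz p k (lam i)) →
      Module.finrank k (charWeightSpace k t χ L) = (Finset.univ.filter fun j => w j = lam).card := by
    intro χ lam hχ
    refine finrank_joint b (fun i => LieAlgebra.ad k L (h i : L))
      (fun j i => cz p k (w j i)) hw (fun i => cz p k (lam i)) _ ?_ _ ?_
    · intro v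
      constructor
      · intro hv i
        rw [LieAlgebra.ad_apply, ← hχ]
        exact hv (h i)
      · intro hv x
        have hx : x ∈ Submodule.span k (Set.range h) := by rw [h.span_eq]; trivial
        change ⁅(x : L), v⁆ = χ x • v
        induction hx using Submodule.span_induction with
        | mem x hx => obtain ⟨i, rfl⟩ := hx; rw [hχ]; exact hv i
        | zero => rw [map_zero, zero_smul]; exact zero_lie v
        | add x y _ _ hx hy =>
          rw [map_add, add_smul, ← hx, ← hy]
          exact add_lie (x : L) (y : L) v
        | smul a x _ hx =>
          rw [map_smul, smul_eq_mul, mul_smul, ← hx]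
          exact smul_lie a (x : L) v
    · intro j
      simp [(cz_inj (p := p) (k := k)).eq_iff, funext_iff]
  -- centralizer dimension, general
  have hcent : ∀ (T : Submodule k L) (d' : ℕ) (n' : ℕ) (b : Module.Basis (Fin n') k L)
      (h : Module.Basis (Fin d') k T) (w : Fin n' → Fin d' → ZMod p)
      (_ : ∀ j i, ⁅(h i : L), b j⁆ = cz p k (w j i) • b j) (U : Submodule k L)
      (_ : ∀ x, x ∈ U ↔ ∀ y ∈ T, ⁅y, x⁆ = 0),
      Module.finrank k U = (Finset.univ.filter fun j => w j = 0).card := by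
    intro T d' n' b h w hw U hU
    refine finrank_joint b (fun i => LieAlgebra.ad k L (h i : L))
      (fun j i => cz p k (w j i)) hw (fun i => 0) _ ?_ _ ?_
    · intro v
      rw [hU]
      constructor
      · intro hv i
        rw [LieAlgebra.ad_apply, zero_smul]
        exact hv _ (h i).2
      · intro hv x hx
        have hx' : (⟨x, hx⟩ : T) ∈ Submodule.span k (Set.range h) := by rw [h.span_eq]; trivial
        have : ∀ x : T, x ∈ Submodule.span k (Set.range h) → ⁅(x : L), v⁆ = 0 := by
          intro x hx
          induction hx using Submodule.span_induction with
          | mem x hx => obtain ⟨i, rfl⟩ := hx; have := hv i; rwa [zero_smul] at this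
          | zero => exact zero_lie v
          | add x y _ _ hx hy => rw [Submodule.coe_add, add_lie, hx, hy, add_zero]
          | smul a x _ hx => rw [Submodule.coe_smul, smul_lie, hx, smul_zero]
        exact this _ hx'
    · intro j
      simp [funext_iff, map_eq_zero_iff _ (cz_inj (p := p) (k := k))]
  have hRc : Module.finrank k (centz t.toSubmodule) = R :=
    hcent t.toSubmodule (d + 1) n b h w hw (centz t.toSubmodule).toSubmodule (fun x => Iff.rfl)
  have hcsa := csa_of_max hop hc hT htmax
  -- numerics
  have hpd : 1 ≤ p ^ (d + 1) := Nat.one_le_pow _ _ hp0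
  have hRn : R + p * c = n + C := by
    have h1 : (p ^ (d + 1) - 1) * C + C = p * c := by
      rw [← Nat.succ_mul, ← hCc, Nat.succ_eq_add_one, Nat.sub_add_cancel hpd, pow_succ]; ring
    omega
  have hCB : C ≤ B := by
    have h1 : C * p ^ d ≤ B * p ^ d := by
      rw [hCc]
      refine hcB.trans (Nat.mul_le_mul_left _ (Nat.pow_le_pow_right hp0 (by omega)))
    exact Nat.le_of_mul_le_mul_right h1 (pow_pos hp0 d)
  have hrank : lieRank k L = R := by
    apply le_antisymm
    · exact Nat.sInf_le ⟨_, hcsa, hRc⟩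
    · refine le_csInf ⟨R, _, hcsa, hRc⟩ ?_
      rintro _ ⟨H, hH, rfl⟩
      obtain ⟨T, hT', hHT⟩ := csa_torus hop hc H hH
      obtain ⟨n', b', h', w', hw'⟩ := hT'.data hop hc
      have hn' : Module.finrank k L = n' := by rw [Module.finrank_eq_card_basis b', Fintype.card_fin]
      have hle := hT'.le_mu hop hc
      have hfin : Module.finrank k H = _ := hcent T _ n' b' h' w' hw' H.toSubmodule hHT
      rw [hfin]
      revert hle h' w'
      generalize Module.finrank k T = e
      intro h' w' hw' _ hle
      rcases e with _ | e
      · have : (Finset.univ.filter fun j => w' j = 0) = Finset.univ := by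
          rw [Finset.filter_eq_self]
          intro j _
          exact Subsingleton.elim _ _
        rw [this, Finset.card_univ, Fintype.card_fin]
        have : R ≤ n := by omega
        omega
      · rcases torus_count hop hc hT' b' h' w' hw' hh with ⟨C', hC', hC''⟩ | ⟨h1, h2, h3⟩
        · have hz' := radon_zero w' C' hC''
          have h1 : (p ^ (e + 1) - 1) * C' + C' = p * c := by
            rw [← Nat.succ_mul, ← hC', Nat.succ_eq_add_one,
              Nat.sub_add_cancel (Nat.one_le_pow _ _ hp0), pow_succ]; ring
          have h2 : C ≤ C' := by
            have : C * p ^ d ≤ C' * p ^ d := by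
              rw [hCc, ← hC']
              exact Nat.mul_le_mul_left _ (Nat.pow_le_pow_right hp0 (by omega))
            exact Nat.le_of_mul_le_mul_right this (pow_pos hp0 d)
          omega
        · omega
  have hRpos : 0 < R := by
    rw [← hRc]
    have : Module.finrank k t.toSubmodule ≤ Module.finrank k (centz t.toSubmodule) :=
      Submodule.finrank_mono (s := t.toSubmodule) (t := (centz t.toSubmodule).toSubmodule)
        (fun x hx y hy => hT.ab y hy x hx)
    omega
  have hCpos : 0 < C := by
    rcases Nat.eq_zero_or_pos C with h0 | h0
    · exfalso
      rw [h0, mul_zero, add_zero] at hz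
      have h1 : Module.finrank k (centz t.toSubmodule).toSubmodule = Module.finrank k L := by
        rw [hn, ← hz]; exact hRc
      have h2 := Submodule.eq_top_of_finrank_eq h1
      apply h.ne_zero 0
      apply Subtype.ext
      apply hc
      ext y
      have : y ∈ (centz t.toSubmodule).toSubmodule := by rw [h2]; trivial
      exact this _ (h 0).2
    · exact h0
  let lam : Fin (d + 1) → ZMod p := Pi.single 0 1
  have hlam : lam ≠ 0 := by simp [lam]
  let χ : t →ₗ[k] k := h.constr k (fun i => cz p k (lam i))
  have hχ : ∀ i, χ (h i) = cz p k (lam i) := fun i => h.constr_basis k _ i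
  have hdim : Module.finrank k (charWeightSpace k t χ L) = C := by rw [hwt χ lam hχ, hC lam hlam]
  refine ⟨χ, ?_, ?_, ?_, ?_⟩
  · intro h0
    have := hχ 0
    rw [h0] at this
    simp [lam] at this
  · intro h0
    rw [h0, finrank_bot] at hdim
    omega
  · rw [hdim, hrank, hd, hn]
    exact hz.symm
  · rw [hdim, hd, hn]
    have hlt : R < p ^ (d + 1) := by
      have : p ^ d0 ≤ p ^ (d + 1) := Nat.pow_le_pow_right hp0 (by omega)
      omega
    have hlt' : R ≤ p ^ (d + 1) - 1 := by omega
    have hbdd : ∀ m ∈ {m : ℕ | m * (p ^ (d + 1) - 1) < n}, m ≤ C := by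
      intro m hm
      by_contra hcon
      push Not at hcon
      have h1 : (C + 1) * (p ^ (d + 1) - 1) ≤ m * (p ^ (d + 1) - 1) := Nat.mul_le_mul_right _ hcon
      have h2 : (C + 1) * (p ^ (d + 1) - 1) = (p ^ (d + 1) - 1) * C + (p ^ (d + 1) - 1) := by ring
      simp only [Set.mem_setOf_eq] at hm
      omega
    apply le_antisymm
    · refine le_csSup ⟨C, hbdd⟩ ?_
      simp only [Set.mem_setOf_eq]
      rw [mul_comm]
      omega
    · exact csSup_le ⟨0, by simp only [Set.mem_setOf_eq]; omega⟩ hbdd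

theorem GoodData.of_equiv {L' : Type*} [LieRing L'] [LieAlgebra k L'] (e : L ≃ₗ⁅k⁆ L')
    (h : GoodData p k L') : GoodData p k L := by
  obtain ⟨c, B, d0, hd0, hcB, hN, hh, hhv, hhl, hhc, hht⟩ := h
  have hpow : ∀ (x : L) (m : ℕ) (v : L),
      e ((LieAlgebra.ad k L x ^ m) v) = (LieAlgebra.ad k L' (e x) ^ m) (e v) := by
    intro x m v
    induction m with
    | zero => rfl
    | succ m ih =>
      rw [pow_succ', pow_succ', Module.End.mul_apply, Module.End.mul_apply, ← ih,
        LieAlgebra.ad_apply, LieAlgebra.ad_apply, LieEquiv.map_lie]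
  have hfr : Module.finrank k L = Module.finrank k L' := e.toLinearEquiv.finrank_eq
  have htor : ∀ x : L, LieAlgebra.ad k L x ^ p = LieAlgebra.ad k L x ↔
      LieAlgebra.ad k L' (e x) ^ p = LieAlgebra.ad k L' (e x) := by
    intro x
    constructor
    · intro h
      ext v
      obtain ⟨v, rfl⟩ : ∃ w, e w = v := e.surjective v
      rw [← hpow, h]; simp [LieEquiv.map_lie]
    · intro h
      ext v
      refine e.injective (?_ : e _ = e _)
      rw [hpow, h]; simp [LieEquiv.map_lie]
  have heig : ∀ (x : L) (a : k), Module.finrank k ((LieAlgebra.ad k L x).eigenspace a) =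
      Module.finrank k ((LieAlgebra.ad k L' (e x)).eigenspace a) := by
    intro x a
    refine LinearEquiv.finrank_eq (e.toLinearEquiv.submoduleMap _ |>.trans (LinearEquiv.ofEq _ _ ?_))
    ext v
    rw [Submodule.mem_map, Module.End.mem_eigenspace_iff]
    constructor
    · rintro ⟨y, hy, rfl⟩
      rw [Module.End.mem_eigenspace_iff] at hy
      have := congrArg e hy
      simpa [LieEquiv.map_lie] using this
    · intro hv
      obtain ⟨y, rfl⟩ : ∃ w, e w = v := e.surjective v
      refine ⟨y, ?_, rfl⟩
      rw [Module.End.mem_eigenspace_iff]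
      refine e.injective (?_ : e _ = e _)
      simpa [LieEquiv.map_lie] using hv
  refine ⟨c, B, d0, hd0, hcB, by rw [hfr]; exact hN, ?_, fun i => e.symm (hhv i), ?_, ?_, ?_⟩
  · intro x hx hxt
    have := hh (e x) (by simpa using hx) ((htor x).1 hxt)
    simp only [heig, hfr]
    refine this.imp id ?_
    rintro ⟨h1, h2⟩
    refine ⟨fun h' ht' hc' => ?_, h2⟩
    obtain ⟨a, ha⟩ := h1 (e h') ((htor h').1 ht') (by rw [← LieEquiv.map_lie, hc', map_zero])
    exact ⟨a, e.injective (show e h' = e (a • x) by rw [ha, map_smul])⟩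
  · exact hhl.map' e.symm.toLinearEquiv.toLinearMap (LinearEquiv.ker _)
  · intro i j
    rw [← LieEquiv.map_lie, hhc, map_zero]
  · intro i
    rw [htor]
    simpa using hht i

end P1e


section P2
open scoped TensorProduct
set_option linter.unusedSectionVars false
variable {p : ℕ} [Fact p.Prime] {k : Type*} [Field k] [CharP k p]

theorem pleib {U V W : Type*} [AddCommGroup U] [Module k U] [AddCommGroup V] [Module k V]
    [AddCommGroup W] [Module k W] (b : U →ₗ[k] V →ₗ[k] W)
    (f : Module.End k U) (g : Module.End k V) (h : Module.End k W)
    (H : ∀ u v, h (b u v) = b (f u) v + b u (g v)) (u : U) (v : V) :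
    (h ^ p) (b u v) = b ((f ^ p) u) v + b u ((g ^ p) v) := by
  let X : Module.End k (U ⊗[k] V) := LinearMap.rTensor V f
  let Y : Module.End k (U ⊗[k] V) := LinearMap.lTensor U g
  let m : U ⊗[k] V →ₗ[k] W := TensorProduct.lift b
  have hXY : Commute X Y := by
    refine TensorProduct.ext' fun u v => ?_
    simp [X, Y, Module.End.mul_apply]
  have hm : ∀ z, h (m z) = m ((X + Y) z) := by
    intro z
    induction z using TensorProduct.induction_on with
    | zero => simp
    | tmul u v => simp [m, X, Y, H]
    | add a b ha hb => rw [map_add, map_add, ha, hb, map_add, map_add]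
  have hmp : ∀ (j : ℕ) z, (h ^ j) (m z) = m (((X + Y) ^ j) z) := by
    intro j
    induction j with
    | zero => intro z; rfl
    | succ j ih => intro z; rw [pow_succ', Module.End.mul_apply, ih, hm, pow_succ', Module.End.mul_apply]
  obtain ⟨r, hr⟩ := hXY.exists_add_pow_prime_eq (Fact.out : p.Prime)
  have hXp : ∀ j u v, (X ^ j) (u ⊗ₜ[k] v) = ((f ^ j) u) ⊗ₜ[k] v := by
    intro j
    induction j with
    | zero => intro u v; rfl
    | succ j ih => intro u v; rw [pow_succ', Module.End.mul_apply, ih, pow_succ', Module.End.mul_apply]; simp [X]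
  have hYp : ∀ j u v, (Y ^ j) (u ⊗ₜ[k] v) = u ⊗ₜ[k] ((g ^ j) v) := by
    intro j
    induction j with
    | zero => intro u v; rfl
    | succ j ih => intro u v; rw [pow_succ', Module.End.mul_apply, ih, pow_succ', Module.End.mul_apply]; simp [Y]
  have h0 : ∀ z : U ⊗[k] V, ((p : Module.End k (U ⊗[k] V)) * X * Y * r) z = 0 := by
    intro z
    rw [mul_assoc, mul_assoc, Module.End.mul_apply, Module.End.natCast_apply, ← Nat.cast_smul_eq_nsmul k,
      CharP.cast_eq_zero, zero_smul]
  have := hmp p (u ⊗ₜ[k] v)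
  rw [hr, LinearMap.add_apply, LinearMap.add_apply, h0, add_zero, hXp, hYp, map_add] at this
  simpa [m] using this

/-- projector onto the `l`-eigenspace -/
noncomputable def Pj {V : Type*} [AddCommGroup V] [Module k V] (p : ℕ) (f : Module.End k V) (m : k) : Module.End k V :=
  1 - (f - m • 1) ^ (p - 1)

section pj
variable {V : Type*} [AddCommGroup V] [Module k V] {f : Module.End k V}

theorem sub_pow_toral (hf : f ^ p = f) (l : ZMod p) :
    (f - cz p k l • (1 : Module.End k V)) ^ p = f - cz p k l • 1 := by
  have hc : Commute f (-(cz p k l • (1 : Module.End k V))) := by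
    refine Commute.neg_right ?_
    exact (Commute.one_right f).smul_right _
  obtain ⟨r, hr⟩ := hc.exists_add_pow_prime_eq (Fact.out : p.Prime)
  rw [sub_eq_add_neg, hr, hf]
  have h1 : (-(cz p k l • (1 : Module.End k V))) ^ p = -(cz p k l • (1 : Module.End k V)) := by
    rw [← neg_smul, smul_pow, one_pow, ← map_neg, cz_pow]
  have h2 : (p : Module.End k V) = 0 := by
    ext v
    rw [Module.End.natCast_apply, ← Nat.cast_smul_eq_nsmul k, CharP.cast_eq_zero, zero_smul]; rfl
  rw [h1, h2]; simp

theorem Pj_mem (hf : f ^ p = f) (l : ZMod p) (v : V) :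
    f (Pj p f (cz p k l) v) = cz p k l • Pj p f (cz p k l) v := by
  have h := sub_pow_toral hf l
  have h2 : (f - cz p k l • (1 : Module.End k V)) * Pj p f (cz p k l) = 0 := by
    rw [Pj, mul_sub, mul_one, ← pow_succ', Nat.sub_add_cancel (Fact.out : p.Prime).one_le, h, sub_self]
  have := LinearMap.congr_fun h2 v
  rw [Module.End.mul_apply, LinearMap.sub_apply] at this
  simpa [sub_eq_zero] using this

theorem Pj_eig (l s : ZMod p) {v : V} (hv : f v = cz p k s • v) :
    Pj p f (cz p k l) v = if s = l then v else 0 := by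
  have h1 : ∀ j, ((f - cz p k l • (1 : Module.End k V)) ^ j) v = (cz p k (s - l)) ^ j • v := by
    intro j
    induction j with
    | zero => simp
    | succ j ih =>
      rw [pow_succ', Module.End.mul_apply, ih, map_smul]
      have : (f - cz p k l • (1 : Module.End k V)) v = cz p k (s - l) • v := by
        simp [hv, sub_smul]
      rw [this, smul_smul, pow_succ]
  rw [Pj, LinearMap.sub_apply, h1, ← map_pow]
  have hp1 : p - 1 ≠ 0 := by have := (Fact.out : p.Prime).two_le; omega
  split_ifs with h
  · subst h; simp [hp1]
  · rw [ZMod.pow_card_sub_one_eq_one (sub_ne_zero.2 h)]; simp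

theorem ssop_toral (hf : f ^ p = f) : SSop f := by
  intro m v hv
  have hpow : ∀ j, (f ^ j) (f v - m • v) = m ^ j • (f v - m • v) := by
    intro j
    induction j with
    | zero => simp
    | succ j ih => rw [pow_succ', Module.End.mul_apply, ih, map_smul, hv, smul_smul, pow_succ]
  by_cases h0 : f v - m • v = 0
  · exact sub_eq_zero.1 h0
  · have h1 := hpow p
    rw [hf, hv, ← sub_eq_zero, ← sub_smul] at h1
    have hm : m ^ p = m := by
      rcases smul_eq_zero.1 h1 with h | h
      · exact (sub_eq_zero.1 h).symm
      · exact absurd h h0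
    obtain ⟨l, rfl⟩ := cz_of_fixed hm
    have h2 := sub_pow_toral hf l
    have h3 : (f - cz p k l • (1 : Module.End k V)) v = f v - cz p k l • v := by simp
    have h4 : ((f - cz p k l • (1 : Module.End k V)) ^ p) v = 0 := by
      obtain ⟨j, hj⟩ : ∃ j, p = j + 2 := ⟨p - 2, by have := (Fact.out : p.Prime).two_le; omega⟩
      have h5 : (f - cz p k l • (1 : Module.End k V)) (f v - cz p k l • v) = 0 := by
        simp only [LinearMap.sub_apply, LinearMap.smul_apply, Module.End.one_apply]
        rw [hv, sub_self]
      have : ∀ F : Module.End k V, F (F v) = 0 → (F ^ p) v = 0 := by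
        intro F hF
        rw [hj, pow_add, Module.End.mul_apply, pow_two, Module.End.mul_apply, hF, map_zero]
      exact this _ (by rw [h3, h5])
    rw [h2, h3] at h4
    exact sub_eq_zero.1 h4

theorem sum_Pj [IsAlgClosed k] [FiniteDimensional k V] (hf : f ^ p = f) (v : V) :
    ∑ l : ZMod p, Pj p f (cz p k l) v = v := by
  have htop := (ssop_toral hf).iSup_top
  have hv : v ∈ ⨆ m, f.eigenspace m := by rw [htop]; trivial
  induction hv using Submodule.iSup_induction' with
  | mem m x hx =>
    rw [Module.End.mem_eigenspace_iff] at hx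
    by_cases h0 : x = 0
    · subst h0; simp
    have hpow : ∀ j, (f ^ j) x = m ^ j • x := by
      intro j
      induction j with
      | zero => simp
      | succ j ih => rw [pow_succ', Module.End.mul_apply, ih, map_smul, hx, smul_smul, pow_succ]
    have h1 := hpow p
    rw [hf, hx, ← sub_eq_zero, ← sub_smul] at h1
    have hm : m ^ p = m := by
      rcases smul_eq_zero.1 h1 with h | h
      · exact (sub_eq_zero.1 h).symm
      · exact absurd h h0
    obtain ⟨s, rfl⟩ := cz_of_fixed hm
    simp_rw [Pj_eig _ s hx]
    simp
  | zero => simp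
  | add x y _ _ hx hy => simp only [map_add, Finset.sum_add_distrib, hx, hy]

end pj

end P2


section P2b
set_option linter.unusedSectionVars false
variable {p : ℕ} [Fact p.Prime] {k : Type*} [Field k] [CharP k p]
variable {ι : Type*} [Fintype ι] [DecidableEq ι] {A : Type*} [CommRing A] [Algebra k A]

theorem der_sum {J : Type*} (s : Finset J) (D : J → Derivation k A A) (a : A) :
    (∑ j ∈ s, D j) a = ∑ j ∈ s, D j a := by
  induction s using Finset.cons_induction with
  | empty => simp
  | cons j s hj ih => rw [Finset.sum_cons, Finset.sum_cons, Derivation.add_apply, ih]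

/-- truncated polynomial algebra, abstractly -/
structure TA (p : ℕ) {k : Type*} [Field k] {ι : Type*} [Fintype ι] [DecidableEq ι]
    {A : Type*} [CommRing A] [Algebra k A]
    (x : ι → A) (d : ι → Derivation k A A) (ε : A →ₐ[k] k) : Prop where
  dx : ∀ i j, d i (x j) = if i = j then 1 else 0
  xp : ∀ i, x i ^ p = 0
  gen : Algebra.adjoin k (Set.range x) = ⊤
  eps : ∀ i, ε (x i) = 0

namespace TA
variable {x : ι → A} {d : ι → Derivation k A A} {ε : A →ₐ[k] k}

theorem dext (T : TA p x d ε) {D E : Derivation k A A} (h : ∀ i, D (x i) = E (x i)) : D = E := by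
  refine Derivation.ext_of_adjoin_eq_top _ T.gen ?_
  rintro _ ⟨i, rfl⟩
  exact h i

theorem decomp (T : TA p x d ε) (D : Derivation k A A) : D = ∑ i, D (x i) • d i := by
  refine T.dext fun j => ?_
  rw [der_sum]
  simp [T.dx]

theorem dcomm (T : TA p x d ε) (i j : ι) : ⁅d i, d j⁆ = 0 := by
  refine T.dext fun l => ?_
  rw [Derivation.commutator_apply, T.dx, T.dx]
  split_ifs <;> simp

theorem dcomm' (T : TA p x d ε) (i j : ι) (a : A) : d i (d j a) = d j (d i a) := by
  have := congrArg (fun D : Derivation k A A => D a) (T.dcomm i j)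
  rw [Derivation.commutator_apply] at this
  exact sub_eq_zero.1 this

theorem ind (T : TA p x d ε) {P : A → Prop} (h1 : ∀ i, P (x i)) (h2 : ∀ r, P (algebraMap k A r))
    (h3 : ∀ a b, P a → P b → P (a + b)) (h4 : ∀ a b, P a → P b → P (a * b)) (a : A) : P a := by
  have ha : a ∈ Algebra.adjoin k (Set.range x) := by rw [T.gen]; trivial
  induction ha using Algebra.adjoin_induction with
  | mem y hy => obtain ⟨i, rfl⟩ := hy; exact h1 i
  | algebraMap r => exact h2 r
  | add a b _ _ ha hb => exact h3 a b ha hb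
  | mul a b _ _ ha hb => exact h4 a b ha hb

theorem nontriv (T : TA p x d ε) : Nontrivial A := ε.toRingHom.domain_nontrivial

theorem charP (T : TA p x d ε) : CharP A p := by
  have := T.nontriv
  exact charP_of_injective_algebraMap (algebraMap k A).injective p

theorem pow_p (T : TA p x d ε) (a : A) : a ^ p = algebraMap k A (ε a ^ p) := by
  have := T.charP
  have hp0 : p ≠ 0 := (Fact.out : p.Prime).ne_zero
  refine T.ind (P := fun a => a ^ p = algebraMap k A (ε a ^ p)) ?_ ?_ ?_ ?_ a
  · intro i; simp [T.xp, T.eps, hp0]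
  · intro r; simp
  · intro a b ha hb
    rw [add_pow_char, ha, hb, map_add, add_pow_char, map_add]
  · intro a b ha hb
    rw [mul_pow, ha, hb, map_mul, mul_pow, map_mul]

theorem unit (T : TA p x d ε) {a : A} (h : ε a ≠ 0) : IsUnit a := by
  have h1 : IsUnit (a ^ p) := by
    rw [T.pow_p]
    exact (IsUnit.mk0 _ (pow_ne_zero p h)).map (algebraMap k A)
  exact (isUnit_pow_iff (Fact.out : p.Prime).ne_zero).1 h1

theorem mon_span (T : TA p x d ε) :
    Submodule.span k (Set.range fun e : ι → Fin p => ∏ i, x i ^ (e i : ℕ)) = ⊤ := by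
  rw [eq_top_iff]
  have h1 := Algebra.adjoin_eq_span k (Set.range x)
  rw [T.gen] at h1
  intro a _
  have ha : a ∈ Subalgebra.toSubmodule (⊤ : Subalgebra k A) := trivial
  rw [h1] at ha
  refine (Submodule.span_le.2 ?_) ha
  intro b hb
  have h2 : ∃ e : ι → ℕ, b = ∏ i, x i ^ e i := by
    induction hb using Submonoid.closure_induction with
    | mem y hy =>
      obtain ⟨i, rfl⟩ := hy
      refine ⟨Pi.single i 1, ?_⟩
      rw [Finset.prod_eq_single i]
      · simp
      · intro j _ hj; simp [hj]
      · simp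
    | one => exact ⟨0, by simp⟩
    | mul a b _ _ ha hb =>
      obtain ⟨e, rfl⟩ := ha
      obtain ⟨f, rfl⟩ := hb
      exact ⟨e + f, by simp [pow_add, Finset.prod_mul_distrib]⟩
  obtain ⟨e, rfl⟩ := h2
  by_cases he : ∀ i, e i < p
  · exact Submodule.subset_span ⟨fun i => ⟨e i, he i⟩, rfl⟩
  · push Not at he
    obtain ⟨i, hi⟩ := he
    have : ∏ i, x i ^ e i = 0 := by
      refine Finset.prod_eq_zero (Finset.mem_univ i) ?_
      obtain ⟨j, hj⟩ := Nat.exists_eq_add_of_le hi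
      rw [hj, pow_add, T.xp, zero_mul]
    rw [this]; exact Submodule.zero_mem _

theorem fin (T : TA p x d ε) : FiniteDimensional k A := by
  refine Module.finite_def.2 ?_
  rw [← T.mon_span]
  exact Submodule.fg_span (Set.finite_range _)

theorem finrank_le (T : TA p x d ε) : Module.finrank k A ≤ p ^ Fintype.card ι := by
  have h1 := finrank_range_le_card (R := k) (fun e : ι → Fin p => ∏ i, x i ^ (e i : ℕ))
  rw [Set.finrank, T.mon_span, finrank_top] at h1
  simpa using h1

theorem second (T : TA p x d ε) (a : A) :
    a - algebraMap k A (ε a) - ∑ i, ε (d i a) • x i ∈ (RingHom.ker ε) ^ 2 := by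
  have hx : ∀ i, x i ∈ RingHom.ker ε := fun i => T.eps i
  have key : ∀ b ∈ RingHom.ker ε, ∀ c ∈ RingHom.ker ε, b * c ∈ (RingHom.ker ε) ^ 2 := by
    intro b hb c hc; rw [pow_two]; exact Ideal.mul_mem_mul hb hc
  refine T.ind (P := fun a => a - algebraMap k A (ε a) - ∑ i, ε (d i a) • x i ∈ (RingHom.ker ε) ^ 2)
    ?_ ?_ ?_ ?_ a
  · intro i
    have : ∑ j, ε (d j (x i)) • x j = x i := by
      rw [Finset.sum_eq_single i]
      · simp [T.dx]
      · intro j _ hj; simp [T.dx, hj]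
      · simp
    rw [this, T.eps]; simp
  · intro r; simp
  · intro a b ha hb
    have : a + b - algebraMap k A (ε (a + b)) - ∑ i, ε (d i (a + b)) • x i =
      (a - algebraMap k A (ε a) - ∑ i, ε (d i a) • x i) +
      (b - algebraMap k A (ε b) - ∑ i, ε (d i b) • x i) := by
      simp only [map_add, add_smul, Finset.sum_add_distrib]; ring
    rw [this]; exact Ideal.add_mem _ ha hb
  · intro a b ha hb
    have h1 : ∀ c : A, c - algebraMap k A (ε c) ∈ RingHom.ker ε := by
      intro c
      have : ε (c - algebraMap k A (ε c)) = 0 := by simp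
      exact this
    have : a * b - algebraMap k A (ε (a * b)) - ∑ i, ε (d i (a * b)) • x i =
      algebraMap k A (ε b) * (a - algebraMap k A (ε a) - ∑ i, ε (d i a) • x i) +
      algebraMap k A (ε a) * (b - algebraMap k A (ε b) - ∑ i, ε (d i b) • x i) +
      (a - algebraMap k A (ε a)) * (b - algebraMap k A (ε b)) := by
      have h2 : ∑ i, ε (d i (a * b)) • x i = algebraMap k A (ε b) * ∑ i, ε (d i a) • x i +
          algebraMap k A (ε a) * ∑ i, ε (d i b) • x i := by
        rw [Finset.mul_sum, Finset.mul_sum, ← Finset.sum_add_distrib]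
        refine Finset.sum_congr rfl fun i _ => ?_
        rw [Derivation.leibniz, map_add, smul_eq_mul, smul_eq_mul, map_mul, map_mul, Algebra.smul_def,
          Algebra.smul_def, Algebra.smul_def, map_add, map_mul, map_mul]
        ring
      rw [h2, map_mul, map_mul]; ring
    rw [this]
    exact Ideal.add_mem _ (Ideal.add_mem _ (Ideal.mul_mem_left _ _ ha) (Ideal.mul_mem_left _ _ hb))
      (key _ (h1 a) _ (h1 b))

theorem nilp (T : TA p x d ε) : IsNilpotent (RingHom.ker ε) := by
  have := T.fin
  have : IsNoetherianRing A := IsNoetherianRing.of_finite k A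
  rw [Ideal.FG.isNilpotent_iff_le_nilradical (IsNoetherian.noetherian _)]
  intro a ha
  refine ⟨p, ?_⟩
  have ha' : ε a = 0 := ha
  rw [T.pow_p, ha', zero_pow (Fact.out : p.Prime).ne_zero, map_zero]
  rfl

theorem good_eig [IsAlgClosed k] (T : TA p x d ε) {D : Derivation k A A} (hD : (D : Module.End k A) ^ p = D)
    (h0 : D ≠ 0) : ∃ (l : ZMod p) (y : A), l ≠ 0 ∧ D y = cz p k l • y ∧
      (IsUnit y ∨ (y ^ p = 0 ∧ ∃ E : Derivation k A A, E y = 1)) := by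
  have := T.fin
  by_contra hcon
  push Not at hcon
  apply h0
  have hkey : ∀ (l : ZMod p) (y : A), l ≠ 0 → D y = cz p k l • y → y ∈ (RingHom.ker ε) ^ 2 := by
    intro l y hl hy
    obtain ⟨h1, h2⟩ := hcon l y hl hy
    have h3 : ε y = 0 := by
      by_contra h; exact h1 (T.unit h)
    have h4 : y ^ p = 0 := by rw [T.pow_p, h3, zero_pow (Fact.out : p.Prime).ne_zero, map_zero]
    have h5 : ∀ i, ε (d i y) = 0 := by
      intro i
      by_contra h
      obtain ⟨u, hu⟩ := T.unit h
      refine h2 h4 ((↑u⁻¹ : A) • d i) ?_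
      rw [Derivation.smul_apply, ← hu, smul_eq_mul, Units.inv_mul]
    have := T.second y
    simpa [h3, h5] using this
  have hran : ∀ a, D a ∈ (RingHom.ker ε) ^ 2 := by
    intro a
    rw [show D a = D (∑ l : ZMod p, Pj p (D : Module.End k A) (cz p k l) a) by rw [sum_Pj hD], map_sum]
    refine Ideal.sum_mem _ fun l _ => ?_
    have h1 := Pj_mem hD l a
    by_cases hl : l = 0
    · subst hl
      have h2 : D (Pj p (D : Module.End k A) (cz p k 0) a) = 0 := by
        refine Eq.trans h1 ?_
        rw [map_zero, zero_smul]
      rw [h2]; exact Ideal.zero_mem _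
    · have h2 := hkey l _ hl h1
      erw [h1]
      rw [Algebra.smul_def]
      exact Ideal.mul_mem_left _ _ h2
  have hstep : ∀ j, ∀ a ∈ (RingHom.ker ε) ^ j, D a ∈ (RingHom.ker ε) ^ (j + 1) := by
    intro j
    induction j with
    | zero => intro a _; exact Ideal.pow_le_pow_right (by norm_num) (hran a)
    | succ j ih =>
      intro a ha
      rw [pow_succ'] at ha
      induction ha using Submodule.mul_induction_on' with
      | mem_mul_mem b hb c hc =>
        rw [Derivation.leibniz, smul_eq_mul, smul_eq_mul]
        refine Ideal.add_mem _ ?_ ?_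
        · rw [pow_succ']; exact Ideal.mul_mem_mul hb (ih c hc)
        · have h1 := Ideal.mul_mem_mul hc (hran b)
          rw [← pow_add] at h1
          exact h1
      | add b _ c _ hb hc => rw [map_add]; exact Ideal.add_mem _ hb hc
  have hpow : ∀ j a, ((D : Module.End k A) ^ j) a ∈ (RingHom.ker ε) ^ j := by
    intro j
    induction j with
    | zero => intro a; simp
    | succ j ih => intro a; rw [pow_succ' (D : Module.End k A), Module.End.mul_apply]; exact hstep j _ (ih a)
  have hDpow : ∀ j, (D : Module.End k A) ^ (p ^ j) = D := by
    intro j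
    induction j with
    | zero => simp
    | succ j ih => rw [pow_succ, pow_mul, ih, hD]
  obtain ⟨j, hj⟩ := T.nilp
  ext a
  have h1 := hpow (p ^ j) a
  rw [hDpow] at h1
  have h2 := Ideal.pow_le_pow_right (Nat.lt_pow_self (Fact.out : p.Prime).one_lt).le h1
  rw [hj] at h2
  simpa using h2

end TA
end P2b


section P2c
set_option linter.unusedSectionVars false
variable {p : ℕ} [Fact p.Prime] {k : Type*} [Field k] [CharP k p] [IsAlgClosed k]

theorem sum_eig {V : Type*} [AddCommGroup V] [Module k V] [FiniteDimensional k V]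
    {f : Module.End k V} (hf : f ^ p = f) :
    ∑ l : ZMod p, Module.finrank k (f.eigenspace (cz p k l)) = Module.finrank k V := by
  classical
  obtain ⟨n, b, e, he⟩ := simDiag (fun _ : Unit => f) (fun _ => ssop_toral hf) (fun _ _ => Commute.refl f)
  have h1 : ∀ j, ∃ l : ZMod p, cz p k l = e j () := by
    intro j
    apply cz_of_fixed
    have hpow : ∀ i, (f ^ i) (b j) = (e j ()) ^ i • b j := by
      intro i
      induction i with
      | zero => simp
      | succ i ih => rw [pow_succ', Module.End.mul_apply, ih, map_smul, he j (), smul_smul, pow_succ]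
    have h2 := hpow p
    rw [hf, he j (), ← sub_eq_zero, ← sub_smul] at h2
    rcases smul_eq_zero.1 h2 with h | h
    · exact (sub_eq_zero.1 h).symm
    · exact absurd h (b.ne_zero j)
  choose w hw using h1
  have h2 : ∀ l : ZMod p, Module.finrank k (f.eigenspace (cz p k l)) =
      (Finset.univ.filter fun j => w j = l).card := by
    intro l
    refine finrank_joint b (fun _ : Unit => f) e he (fun _ => cz p k l) _ ?_ _ ?_
    · intro v; rw [Module.End.mem_eigenspace_iff]; exact ⟨fun h _ => h, fun h => h ()⟩
    · intro j
      simp only [Finset.mem_filter, Finset.mem_univ, true_and]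
      constructor
      · rintro h ⟨⟩; rw [← hw, h]
      · intro h; have := h (); rw [← hw] at this; exact cz_inj this
  simp_rw [h2]
  rw [Module.finrank_eq_card_basis b, ← Finset.card_eq_sum_card_fiberwise]
  · simp
  · intro j _; simp

theorem map_rank {V W : Type*} [AddCommGroup V] [Module k V] [FiniteDimensional k V]
    [AddCommGroup W] [Module k W]
    (g : V →ₗ[k] W) (S : Submodule k V) :
    Module.finrank k (S.map g) + Module.finrank k (S ⊓ LinearMap.ker g : Submodule k V) = Module.finrank k S := by
  have h := LinearMap.finrank_range_add_finrank_ker (g.domRestrict S)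
  rw [LinearMap.range_domRestrict] at h
  rw [← h]
  congr 1
  have h2 : (S ⊓ LinearMap.ker g : Submodule k V) = (LinearMap.ker (g.domRestrict S)).map S.subtype := by
    ext v
    simp only [Submodule.mem_inf, LinearMap.mem_ker, Submodule.mem_map, Submodule.subtype_apply,
      Subtype.exists, LinearMap.domRestrict_apply]
    constructor
    · rintro ⟨h1, h2⟩; exact ⟨v, h1, h2, rfl⟩
    · rintro ⟨w, h1, h2, rfl⟩; exact ⟨h1, h2⟩
  rw [h2]
  exact Submodule.finrank_map_subtype_eq _ _

variable {ι : Type*} [Fintype ι] [DecidableEq ι] {A : Type*} [CommRing A] [Algebra k A]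
variable {x : ι → A} {d : ι → Derivation k A A} {ε : A →ₐ[k] k}

theorem TA.lemU (T : TA p x d ε) {D : Derivation k A A} (hD : (D : Module.End k A) ^ p = D)
    (h0 : D ≠ 0) {M : Type*} [AddCommGroup M] [Module k M] [Module A M] [IsScalarTower k A M]
    [FiniteDimensional k M] (θ : Module.End k M)
    (hθ : ∀ (a : A) (m : M), θ (a • m) = D a • m + a • θ m) (hθp : θ ^ p = θ)
    (hM : ∀ E : Derivation k A A, ∃ E' : Module.End k M, ∀ (a : A) (m : M), E' (a • m) = E a • m + a • E' m)
    (l l' : ZMod p) :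
    Module.finrank k (θ.eigenspace (cz p k l)) = Module.finrank k (θ.eigenspace (cz p k l')) := by
  classical
  obtain ⟨i, y, hi, hy, hyy⟩ := T.good_eig hD h0
  let Y : Module.End k M := Algebra.lsmul k k M y
  have hY : ∀ m, Y m = y • m := fun m => rfl
  have hYj : ∀ (j : ℕ) m, (Y ^ j) m = y ^ j • m := by
    intro j
    induction j with
    | zero => intro m; simp
    | succ j ih => intro m; rw [pow_succ', Module.End.mul_apply, ih, hY, smul_smul, pow_succ']
  have hYV : ∀ (s : ZMod p) m, θ m = cz p k s • m → θ (y • m) = cz p k (s + i) • (y • m) := by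
    intro s m hm
    rw [hθ, hy, hm, map_add, add_smul, smul_comm y, smul_assoc, add_comm]
  let f : ℕ → ZMod p → ℕ := fun j s => Module.finrank k ((θ.eigenspace (cz p k s)).map (Y ^ j))
  have hf0 : ∀ s, f 0 s = Module.finrank k (θ.eigenspace (cz p k s)) := by
    intro s
    have h1 : (θ.eigenspace (cz p k s)).map (Y ^ 0) = θ.eigenspace (cz p k s) := Submodule.map_id _
    exact congrArg (fun S : Submodule k M => Module.finrank k S) h1
  rw [← hf0, ← hf0]
  have horb : ∀ (s s' : ZMod p), ∃ j : ℕ, s' = s + j * i := by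
    intro s s'
    refine ⟨((s' - s) / i).val, ?_⟩
    rw [ZMod.natCast_zmod_val, div_mul_cancel₀ _ hi]; ring
  rcases hyy with hu | ⟨hyp, E, hE⟩
  · have hle : ∀ s, f 0 s ≤ f 0 (s + i) := by
      intro s
      rw [hf0, hf0]
      have hinj : Function.Injective Y := fun a b hab => by
        obtain ⟨u, rfl⟩ := hu
        have := congrArg (fun m => (↑u⁻¹ : A) • m) hab
        simpa [hY, smul_smul] using this
      have e1 := map_rank Y (θ.eigenspace (cz p k s))
      rw [LinearMap.ker_eq_bot.2 hinj, inf_bot_eq, finrank_bot, add_zero] at e1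
      rw [← e1]
      refine Submodule.finrank_mono ?_
      rintro _ ⟨m, hm, rfl⟩
      rw [SetLike.mem_coe, Module.End.mem_eigenspace_iff] at hm
      rw [Module.End.mem_eigenspace_iff, hY, hYV _ _ hm]
    have hle2 : ∀ (j : ℕ) s, f 0 s ≤ f 0 (s + j * i) := by
      intro j
      induction j with
      | zero => intro s; simp
      | succ j ih => intro s; refine (ih s).trans ((hle _).trans (le_of_eq ?_)); congr 1; push_cast; ring
    apply le_antisymm
    · obtain ⟨j, hj⟩ := horb l l'; rw [hj]; exact hle2 j l
    · obtain ⟨j, hj⟩ := horb l' l; rw [hj]; exact hle2 j l'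
  · obtain ⟨E', hE'⟩ := hM E
    have htf : ∀ (j : ℕ), j < p → ∀ m c : M, y ^ j • m = y ^ (j + 1) • c → ∃ c', m = y • c' := by
      intro j
      induction j with
      | zero => intro _ m c h; exact ⟨c, by simpa using h⟩
      | succ j ih =>
        intro hj m c h
        have hjk : ((j + 1 : ℕ) : k) ≠ 0 := by
          intro hz
          rw [CharP.cast_eq_zero_iff k p] at hz
          exact absurd (Nat.le_of_dvd (Nat.succ_pos j) hz) (by omega)
        have h1 := congrArg E' h
        rw [hE', hE', Derivation.leibniz_pow, Derivation.leibniz_pow, hE] at h1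
        simp only [Nat.add_sub_cancel, smul_eq_mul, mul_one] at h1
        have h2 : ((j + 1 : ℕ) : k) • (y ^ j • m) = y ^ (j + 1) • ((j + 1 + 1) • c + y • E' c - E' m) := by
          rw [Nat.cast_smul_eq_nsmul]
          rw [smul_sub, smul_add, smul_smul, ← pow_succ, eq_sub_iff_add_eq, ← smul_assoc, h1, smul_assoc,
            smul_comm (y ^ (j + 1)) (j + 1 + 1) c]
        refine ih (by omega) m (((j + 1 : ℕ) : k)⁻¹ • ((j + 1 + 1) • c + y • E' c - E' m)) ?_
        rw [smul_comm, ← h2, smul_smul, inv_mul_cancel₀ hjk, one_smul]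
    let q : ZMod p → ℕ := fun s => f 0 s - f 1 (s - i)
    have hsub : ∀ s, (θ.eigenspace (cz p k (s - i))).map Y ≤ θ.eigenspace (cz p k s) := by
      rintro s _ ⟨m, hm, rfl⟩
      rw [SetLike.mem_coe, Module.End.mem_eigenspace_iff] at hm
      rw [Module.End.mem_eigenspace_iff, hY, hYV _ _ hm, sub_add_cancel]
    have hrec : ∀ j, j < p → ∀ s, f j s = f (j + 1) (s - i) + q s := by
      intro j hj s
      have e1 := map_rank (Y ^ j) (θ.eigenspace (cz p k s))
      have e2 := map_rank (Y ^ j) ((θ.eigenspace (cz p k (s - i))).map Y)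
      have e3 : (θ.eigenspace (cz p k s) ⊓ LinearMap.ker (Y ^ j) : Submodule k M) =
          (θ.eigenspace (cz p k (s - i))).map Y ⊓ LinearMap.ker (Y ^ j) := by
        apply le_antisymm
        · rintro m ⟨hm1, hm2⟩
          refine ⟨?_, hm2⟩
          rw [SetLike.mem_coe, LinearMap.mem_ker, hYj] at hm2
          rw [SetLike.mem_coe, Module.End.mem_eigenspace_iff] at hm1
          obtain ⟨c, rfl⟩ := htf j hj m 0 (by rw [hm2, smul_zero])
          refine ⟨Pj p θ (cz p k (s - i)) c, ?_, ?_⟩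
          · rw [SetLike.mem_coe, Module.End.mem_eigenspace_iff]; exact Pj_mem hθp _ _
          · have h1 : Pj p θ (cz p k s) (y • c) = y • c := by rw [Pj_eig s s hm1, if_pos rfl]
            have h2 : y • c = ∑ r : ZMod p, y • Pj p θ (cz p k r) c := by
              rw [← Finset.smul_sum, sum_Pj hθp]
            rw [h2, map_sum] at h1
            rw [hY, h2, ← h1, Finset.sum_eq_single (s - i)]
            · rw [Pj_eig s s, if_pos rfl]
              rw [hYV (s - i) _ (Pj_mem hθp _ _), sub_add_cancel]
            · intro r _ hr
              rw [Pj_eig s (r + i) (hYV r _ (Pj_mem hθp _ _)), if_neg]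
              intro h; exact hr (by rw [← h]; ring)
            · simp
        · exact inf_le_inf_right _ (hsub s)
      have e4 : ((θ.eigenspace (cz p k (s - i))).map Y).map (Y ^ j) =
          (θ.eigenspace (cz p k (s - i))).map (Y ^ (j + 1)) := by
        rw [← Submodule.map_comp]; rfl
      have e5 := Submodule.finrank_mono (hsub s)
      rw [e3] at e1
      rw [e4] at e2
      have e6 : f 1 (s - i) = Module.finrank k ((θ.eigenspace (cz p k (s - i))).map Y) := by
        exact congrArg (fun g : Module.End k M => Module.finrank k ((θ.eigenspace (cz p k (s - i))).map g)) (pow_one Y)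
      simp only [q, hf0, e6]
      simp only [f]
      omega
    have hsum : ∀ j, j ≤ p → ∀ s, f 0 s = ∑ r ∈ Finset.range j, q (s - r * i) + f j (s - j * i) := by
      intro j
      induction j with
      | zero => intro _ s; simp
      | succ j ih =>
        intro hj s
        rw [ih (by omega) s, Finset.sum_range_succ, hrec j (by omega), add_assoc, add_comm (f _ _)]
        congr 3; push_cast; ring
    have hfp : ∀ s, f p s = 0 := by
      intro s
      have : Y ^ p = 0 := by ext m; rw [hYj, hyp, zero_smul]; rfl
      have h1 : (θ.eigenspace (cz p k s)).map (Y ^ p) = ⊥ := by rw [this]; exact Submodule.map_zero _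
      exact (congrArg (fun S : Submodule k M => Module.finrank k S) h1).trans (finrank_bot k M)
    have htot : ∀ s, f 0 s = ∑ r : ZMod p, q r := by
      intro s
      rw [hsum p le_rfl s, hfp, add_zero]
      refine Finset.sum_bij (fun r _ => s - r * i) (fun _ _ => Finset.mem_univ _) ?_ ?_ (fun _ _ => rfl)
      · intro a ha b hb hab
        rw [Finset.mem_range] at ha hb
        have h1 : (a : ZMod p) = b := mul_right_cancel₀ hi (sub_right_injective hab)
        rw [ZMod.natCast_eq_natCast_iff] at h1
        exact Nat.ModEq.eq_of_lt_of_lt h1 ha hb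
      · intro r _
        refine ⟨((s - r) / i).val, Finset.mem_range.2 (ZMod.val_lt _), ?_⟩
        rw [ZMod.natCast_zmod_val, div_mul_cancel₀ _ hi]; ring
    rw [htot, htot]

theorem TA.lemU' (T : TA p x d ε) {D : Derivation k A A} (hD : (D : Module.End k A) ^ p = D)
    (h0 : D ≠ 0) {M : Type*} [AddCommGroup M] [Module k M] [Module A M] [IsScalarTower k A M]
    [FiniteDimensional k M] (θ : Module.End k M)
    (hθ : ∀ (a : A) (m : M), θ (a • m) = D a • m + a • θ m) (hθp : θ ^ p = θ)
    (hM : ∀ E : Derivation k A A, ∃ E' : Module.End k M, ∀ (a : A) (m : M), E' (a • m) = E a • m + a • E' m)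
    (l : ZMod p) :
    p * Module.finrank k (θ.eigenspace (cz p k l)) = Module.finrank k M := by
  rw [← sum_eig hθp]
  rw [Finset.sum_congr rfl fun s _ => T.lemU hD h0 θ hθ hθp hM s l]
  simp [ZMod.card]

end P2c


section P3
set_option linter.unusedSectionVars false
variable {p : ℕ} [Fact p.Prime] {k : Type*} [Field k] [CharP k p]

theorem trunc_TA (n : ℕ) : ∃ ε : TruncPoly p k n →ₐ[k] k, TA p (truncX p k n) (truncPD p k n) ε := by
  have hp0 : p ≠ 0 := (Fact.out : p.Prime).ne_zero
  refine ⟨Ideal.Quotient.liftₐ _ (MvPolynomial.aeval fun _ => (0 : k)) ?_, ?_, ?_, ?_, ?_⟩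
  · intro a ha
    have : truncIdeal p k n ≤ RingHom.ker (MvPolynomial.aeval fun _ => (0 : k) : MvPolynomial (Fin n) k →ₐ[k] k) := by
      rw [Ideal.span_le]
      rintro _ ⟨i, rfl⟩
      simp [RingHom.mem_ker, hp0]
    exact this ha
  · intro i j
    show Ideal.Quotient.mk (truncIdeal p k n) (MvPolynomial.pderiv i (MvPolynomial.X j)) = _
    rw [MvPolynomial.pderiv_X]
    by_cases h : i = j
    · subst h; simp
    · simp [h]
  · intro i
    rw [truncX, ← map_pow]
    exact Ideal.Quotient.eq_zero_iff_mem.2 (Ideal.subset_span ⟨i, rfl⟩)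
  · have h1 : Set.range (truncX p k n) = (Ideal.Quotient.mkₐ k (truncIdeal p k n)) '' Set.range MvPolynomial.X := by
      rw [← Set.range_comp]; rfl
    rw [h1, ← AlgHom.map_adjoin, MvPolynomial.adjoin_range_X, Algebra.map_top, AlgHom.range_eq_top]
    exact Ideal.Quotient.mkₐ_surjective _ _
  · intro i
    show (MvPolynomial.aeval fun _ => (0 : k)) (MvPolynomial.X i) = (0 : k)
    rw [MvPolynomial.aeval_X]

variable {ι : Type*} [Fintype ι] [DecidableEq ι] {A : Type*} [CommRing A] [Algebra k A]

/-- the `p`-th power of a derivation -/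
noncomputable def derPow (p : ℕ) [Fact p.Prime] {k : Type*} [Field k] [CharP k p] {A : Type*} [CommRing A]
    [Algebra k A] (D : Derivation k A A) : Derivation k A A :=
  Derivation.mk' ((D : Module.End k A) ^ p) fun a b => by
    have := pleib (p := p) (LinearMap.mul k A) (D : Module.End k A) D D (by intro u v; simp; ring) a b
    simp only [LinearMap.mul_apply'] at this
    rw [this, smul_eq_mul, smul_eq_mul]; ring

theorem derPow_coe (D : Derivation k A A) : (derPow p D : Module.End k A) = (D : Module.End k A) ^ p := by
  ext a; rfl

theorem derPow_eq {D : Derivation k A A} (h : (D : Module.End k A) ^ p = D) : derPow p D = D := by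
  ext a
  exact LinearMap.congr_fun h a

theorem ad_derPow (D E : Derivation k A A) :
    (LieAlgebra.ad k (Derivation k A A) D ^ p) E = ⁅derPow p D, E⁆ := by
  let b : Derivation k A A →ₗ[k] A →ₗ[k] A :=
    { toFun := fun E => E
      map_add' := fun _ _ => rfl
      map_smul' := fun _ _ => rfl }
  ext a
  have := pleib (p := p) b (LieAlgebra.ad k (Derivation k A A) D) (D : Module.End k A) D (by
    intro u v
    show D (u v) = ⁅D, u⁆ v + u (D v)
    rw [Derivation.commutator_apply, sub_add_cancel]) E a
  rw [Derivation.commutator_apply]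
  exact (eq_sub_of_add_eq this.symm)

theorem ad_toral {D : Derivation k A A} (h : (D : Module.End k A) ^ p = D) :
    LieAlgebra.ad k (Derivation k A A) D ^ p = LieAlgebra.ad k (Derivation k A A) D := by
  ext1 E
  rw [ad_derPow, derPow_eq h]; rfl

theorem sub_ad_pow {L : Type*} [LieRing L] [LieAlgebra k L] (K : LieSubalgebra k L) (h z : K) (j : ℕ) :
    (((LieAlgebra.ad k K h ^ j) z : K) : L) = (LieAlgebra.ad k L (h : L) ^ j) (z : L) := by
  induction j with
  | zero => rfl
  | succ j ih => rw [pow_succ', pow_succ', Module.End.mul_apply, Module.End.mul_apply, ← ih]; rfl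

theorem sub_eig {L : Type*} [LieRing L] [LieAlgebra k L] (K : LieSubalgebra k L) (h : K) (a : k) :
    Module.finrank k ((LieAlgebra.ad k K h).eigenspace a) =
      Module.finrank k ((LieAlgebra.ad k L (h : L)).eigenspace a ⊓ K.toSubmodule : Submodule k L) := by
  have h2 : ((LieAlgebra.ad k L (h : L)).eigenspace a ⊓ K.toSubmodule : Submodule k L) =
      ((LieAlgebra.ad k K h).eigenspace a).map K.toSubmodule.subtype := by
    ext v
    rw [Submodule.mem_inf, Module.End.mem_eigenspace_iff, Submodule.mem_map]
    constructor
    · rintro ⟨h1, h2⟩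
      refine ⟨⟨v, h2⟩, ?_, rfl⟩
      rw [Module.End.mem_eigenspace_iff]
      exact Subtype.ext h1
    · rintro ⟨w, h1, rfl⟩
      rw [Module.End.mem_eigenspace_iff] at h1
      exact ⟨congrArg Subtype.val h1, w.2⟩
  rw [h2]
  exact (Submodule.finrank_map_subtype_eq K.toSubmodule _).symm

theorem ad_of_act {D : Derivation k A A} {E : Derivation k A A} (h : ∀ a, (D : Module.End k A) a = E a) : D = E := by
  ext a; exact h a

theorem GoodData.cartan {K : LieSubalgebra k (Derivation k A A)}
    (hC : ∀ D : Derivation k A A, (∀ z ∈ K, ⁅D, z⁆ = 0) → D = 0) {c B d0 : ℕ} (hd : 1 ≤ d0)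
    (hcB : c ≤ B * p ^ (d0 - 1)) (hN : Module.finrank k K + B + 1 ≤ p * c + p ^ d0)
    (hc : ∀ h ∈ K, h ≠ 0 → (h : Module.End k A) ^ p = h → ∀ l : ZMod p, l ≠ 0 →
      Module.finrank k ((LieAlgebra.ad k (Derivation k A A) h).eigenspace (cz p k l) ⊓ K.toSubmodule :
        Submodule k (Derivation k A A)) = c)
    (hh : Fin d0 → Derivation k A A) (hK : ∀ i, hh i ∈ K) (hli : LinearIndependent k hh)
    (hcm : ∀ i j, ⁅hh i, hh j⁆ = 0) (ht : ∀ i, (hh i : Module.End k A) ^ p = hh i) :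
    GoodData p k K := by
  refine ⟨c, B, d0, hd, hcB, hN, ?_, fun i => ⟨hh i, hK i⟩, ?_, ?_, ?_⟩
  · intro h h0 hp
    left
    intro l hl
    rw [sub_eig]
    refine hc h h.2 (fun hz => h0 (Subtype.ext hz)) ?_ l hl
    have h1 : derPow p (h : Derivation k A A) - h = 0 := by
      apply hC
      intro z hz
      rw [sub_lie, ← ad_derPow, sub_eq_zero, ← sub_ad_pow K h ⟨z, hz⟩, hp]; rfl
    rw [← derPow_coe, sub_eq_zero.1 h1]
  · refine LinearIndependent.of_comp K.toSubmodule.subtype ?_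
    exact hli
  · intro i j; exact Subtype.ext (hcm i j)
  · intro i
    ext1 z
    apply Subtype.ext
    rw [sub_ad_pow, ad_toral (ht i)]; rfl

end P3


section P3a
set_option linter.unusedSectionVars false
variable {p : ℕ} [Fact p.Prime] {k : Type*} [Field k] [CharP k p]
variable {ι : Type*} [Fintype ι] [DecidableEq ι] {A : Type*} [CommRing A] [Algebra k A]

theorem li_of_dual {V : Type*} [AddCommGroup V] [Module k V] {J : Type*} [Fintype J] [DecidableEq J]
    (v : J → V) (φ : J → V →ₗ[k] k) (h : ∀ i j, φ j (v i) = if i = j then 1 else 0) :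
    LinearIndependent k v := by
  rw [Fintype.linearIndependent_iff]
  intro g hg j
  have := congrArg (φ j) hg
  simpa [h] using this

namespace TA
variable {x : ι → A} {d : ι → Derivation k A A} {ε : A →ₐ[k] k}

/-- evaluation functional -/
noncomputable def coef (x : ι → A) (d : ι → Derivation k A A) (ε : A →ₐ[k] k) (i : ι) : Derivation k A A →ₗ[k] k where
  toFun D := ε (d i (D (x i)))
  map_add' D E := by simp
  map_smul' a D := by simp

theorem dcom (T : TA p x d ε) (i : ι) (D : Derivation k A A) (a : A) :
    d i (D a) = D (d i a) + ∑ j, d i (D (x j)) * d j a := by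
  have h1 := T.decomp ⁅d i, D⁆
  have h2 : ∀ j, ⁅d i, D⁆ (x j) = d i (D (x j)) := by
    intro j
    rw [Derivation.commutator_apply, T.dx]
    split_ifs <;> simp
  have h3 := congrArg (fun E : Derivation k A A => E a) h1
  simp only [h2] at h3
  rw [Derivation.commutator_apply, der_sum] at h3
  rw [← sub_eq_iff_eq_add', h3]
  rfl

theorem diag_comm (T : TA p x d ε) {D E : Derivation k A A} (h : ∀ j, ∃ a : k, D (x j) = a • x j)
    (h' : ∀ j, ∃ a : k, E (x j) = a • x j) : ⁅D, E⁆ = 0 := by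
  refine T.dext fun j => ?_
  obtain ⟨a, ha⟩ := h j
  obtain ⟨b, hb⟩ := h' j
  rw [Derivation.commutator_apply, ha, hb, D.map_smul, E.map_smul, ha, hb, smul_comm, sub_self]
  rfl

theorem diag_toral (T : TA p x d ε) {D : Derivation k A A}
    (h : ∀ j, ∃ a : ZMod p, D (x j) = cz p k a • x j) : (D : Module.End k A) ^ p = D := by
  rw [← derPow_coe]
  congr 1
  refine T.dext fun j => ?_
  obtain ⟨a, ha⟩ := h j
  show ((D : Module.End k A) ^ p) (x j) = _
  have h1 : ∀ m : ℕ, ((D : Module.End k A) ^ m) (x j) = (cz p k a) ^ m • x j := by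
    intro m
    induction m with
    | zero => simp
    | succ m ih =>
      rw [pow_succ' (D : Module.End k A), Module.End.mul_apply, ih, map_smul, pow_succ, mul_smul]
      exact congrArg _ ha
  rw [h1, cz_pow, ha]

theorem wEquiv (T : TA p x d ε) : Nonempty (Derivation k A A ≃ₗ[k] (ι → A)) := by
  let f : Derivation k A A →ₗ[k] (ι → A) :=
    { toFun := fun D i => D (x i)
      map_add' := fun _ _ => rfl
      map_smul' := fun _ _ => rfl }
  refine ⟨LinearEquiv.ofBijective f ⟨?_, ?_⟩⟩
  · intro D E h
    exact T.dext fun i => congrFun h i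
  · intro g
    refine ⟨∑ i, g i • d i, ?_⟩
    funext j
    show (∑ i, g i • d i) (x j) = g j
    rw [der_sum]
    simp [T.dx]

theorem wfin (T : TA p x d ε) : FiniteDimensional k (Derivation k A A) := by
  have := T.fin
  obtain ⟨e⟩ := T.wEquiv
  exact e.symm.finiteDimensional

theorem wrank (T : TA p x d ε) : Module.finrank k (Derivation k A A) = Fintype.card ι * Module.finrank k A := by
  have := T.fin
  obtain ⟨e⟩ := T.wEquiv
  rw [e.finrank_eq, Module.finrank_pi_fintype]
  simp

variable [IsAlgClosed k]

theorem eigA (T : TA p x d ε) {D : Derivation k A A} (hD : (D : Module.End k A) ^ p = D)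
    (h0 : D ≠ 0) (l : ZMod p) :
    p * Module.finrank k (Module.End.eigenspace (D : Module.End k A) (cz p k l)) = Module.finrank k A := by
  have := T.fin
  refine T.lemU' hD h0 (D : Module.End k A) ?_ hD ?_ l
  · intro a m
    show D (a * m) = D a * m + a * D m
    rw [Derivation.leibniz, smul_eq_mul, smul_eq_mul]; ring
  · intro E
    refine ⟨E, fun a m => ?_⟩
    show E (a * m) = E a * m + a * E m
    rw [Derivation.leibniz, smul_eq_mul, smul_eq_mul]; ring

theorem eigW (T : TA p x d ε) {D : Derivation k A A} (hD : (D : Module.End k A) ^ p = D)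
    (h0 : D ≠ 0) (l : ZMod p) :
    p * Module.finrank k ((LieAlgebra.ad k (Derivation k A A) D).eigenspace (cz p k l)) =
      Module.finrank k (Derivation k A A) := by
  have := T.fin
  have := T.wfin
  have h1 : ∀ (E : Derivation k A A) (a : A) (F : Derivation k A A), ⁅E, a • F⁆ = E a • F + a • ⁅E, F⁆ := by
    intro E a F
    ext b
    simp only [Derivation.commutator_apply, Derivation.add_apply, Derivation.smul_apply, smul_eq_mul,
      Derivation.leibniz]
    ring
  refine T.lemU' hD h0 _ ?_ (ad_toral hD) ?_ l
  · intro a m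
    exact h1 D a m
  · intro E
    exact ⟨LieAlgebra.ad k (Derivation k A A) E, fun a m => h1 E a m⟩

theorem xd_ne (T : TA p x d ε) (i : ι) : x i • d i ≠ 0 := by
  intro h
  have h1 := congrArg (fun D : Derivation k A A => ε (d i (D (x i)))) h
  simp [T.dx] at h1

theorem xd_x (T : TA p x d ε) (i j : ι) : (x i • d i) (x j) = cz p k (if i = j then 1 else 0) • x j := by
  rw [Derivation.smul_apply, T.dx]
  split_ifs with h
  · subst h; simp
  · simp

theorem adim (T : TA p x d ε) (i : ι) : ∃ a, p * a = Module.finrank k A :=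
  ⟨_, T.eigA (T.diag_toral fun j => ⟨_, T.xd_x i j⟩) (T.xd_ne i) 0⟩

theorem good_W (T : TA p x d ε) (n : ℕ) (hn : 1 ≤ n) (e : Fin n ≃ ι) :
    GoodData p k (⊤ : LieSubalgebra k (Derivation k A A)) := by
  have := T.fin
  have := T.wfin
  have hp2 := (Fact.out : p.Prime).two_le
  obtain ⟨a, ha⟩ := T.adim (e ⟨0, hn⟩)
  have hcard : Fintype.card ι = n := by rw [← Fintype.card_congr e, Fintype.card_fin]
  have hle := T.finrank_le
  rw [hcard] at hle
  have hW := T.wrank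
  rw [hcard] at hW
  have hpn : p ^ n = p * p ^ (n - 1) := by rw [← pow_succ', Nat.sub_add_cancel hn]
  refine GoodData.cartan (c := n * a) (B := n) (d0 := n) ?_ hn ?_ ?_ ?_ (fun i => x (e i) • d (e i)) ?_ ?_ ?_ ?_
  · intro D hD
    refine T.dext fun i => ?_
    have h1 : ∀ j, ⁅D, d j⁆ = 0 := fun j => hD _ trivial
    have h2 := congrArg (fun E : Derivation k A A => E (x i)) (hD (x i • d i) trivial)
    have h3 := congrArg (fun E : Derivation k A A => E (x i)) (h1 i)
    simp only [Derivation.commutator_apply, Derivation.smul_apply, T.dx, if_pos, Derivation.map_one_eq_zero, zero_sub,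
      smul_eq_mul, mul_one, Derivation.zero_apply, neg_eq_zero] at h2 h3
    rw [h3, mul_zero, sub_zero] at h2
    rw [h2]; rfl
  · refine Nat.mul_le_mul_left _ ?_
    have : p * a ≤ p * p ^ (n - 1) := by rw [ha, ← hpn]; exact hle
    exact Nat.le_of_mul_le_mul_left this (by omega)
  · have h1 : Module.finrank k (⊤ : LieSubalgebra k (Derivation k A A)) = n * (p * a) := by
      rw [ha, ← hW]
      exact finrank_top k (Derivation k A A)
    have h2 : n < p ^ n := Nat.lt_pow_self (by omega)
    rw [h1]
    have h3 : p * (n * a) = n * (p * a) := by ring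
    omega
  · intro h _ h0 hp l _
    have h1 := T.eigW hp h0 l
    have h2 : ((LieAlgebra.ad k (Derivation k A A) h).eigenspace (cz p k l) ⊓
      (⊤ : LieSubalgebra k (Derivation k A A)).toSubmodule) = (LieAlgebra.ad k (Derivation k A A) h).eigenspace (cz p k l) :=
      inf_top_eq _
    rw [h2]
    rw [hW, ← ha] at h1
    have : p * Module.finrank k ((LieAlgebra.ad k (Derivation k A A) h).eigenspace (cz p k l)) = p * (n * a) := by
      rw [h1]; ring
    exact Nat.eq_of_mul_eq_mul_left (by omega) this
  · intro i; trivial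
  · refine li_of_dual _ (fun j => coef x d ε (e j)) ?_
    intro i j
    show ε (d (e j) ((x (e i) • d (e i)) (x (e j)))) = _
    rw [T.xd_x, Derivation.map_smul, T.dx]
    simp
  · intro i j
    exact T.diag_comm (fun l => ⟨_, T.xd_x _ l⟩) (fun l => ⟨_, T.xd_x _ l⟩)
  · intro i
    exact T.diag_toral fun j => ⟨_, T.xd_x _ j⟩

end TA
end P3a


section P3b
set_option linter.unusedSectionVars false
variable {p : ℕ} [Fact p.Prime] {k : Type*} [Field k] [CharP k p]
variable {ι : Type*} [Fintype ι] [DecidableEq ι] {A : Type*} [CommRing A] [Algebra k A]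

theorem mem_derivedSub {L : Type*} [LieRing L] [LieAlgebra k L] {K : LieSubalgebra k L} {u v : L}
    (hu : u ∈ K) (hv : v ∈ K) : ⁅u, v⁆ ∈ derivedSub k K :=
  LieSubalgebra.subset_lieSpan ⟨u, hu, v, hv, rfl⟩

theorem derivedSub_le {L : Type*} [LieRing L] [LieAlgebra k L] (K : LieSubalgebra k L) :
    derivedSub k K ≤ K := by
  refine LieSubalgebra.lieSpan_le.2 ?_
  rintro _ ⟨u, hu, v, hv, rfl⟩
  exact K.lie_mem hu hv

theorem derived_eig {L : Type*} [LieRing L] [LieAlgebra k L] {K : LieSubalgebra k L} {h : L} (hh : h ∈ K)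
    {a : k} (ha : a ≠ 0) :
    ((LieAlgebra.ad k L h).eigenspace a ⊓ (derivedSub k K).toSubmodule : Submodule k L) =
      (LieAlgebra.ad k L h).eigenspace a ⊓ K.toSubmodule := by
  apply le_antisymm
  · exact inf_le_inf_left _ (derivedSub_le K)
  · rintro z ⟨h1, h2⟩
    refine ⟨h1, ?_⟩
    rw [SetLike.mem_coe, Module.End.mem_eigenspace_iff, LieAlgebra.ad_apply] at h1
    have h3 : z = a⁻¹ • ⁅h, z⁆ := by rw [h1, smul_smul, inv_mul_cancel₀ ha, one_smul]
    rw [SetLike.mem_coe, h3]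
    exact (derivedSub k K).smul_mem _ (mem_derivedSub hh h2)

/-- lieSpan of a bracket-closed submodule -/
theorem lieSpan_closed {L : Type*} [LieRing L] [LieAlgebra k L] (S : Submodule k L)
    (h : ∀ u ∈ S, ∀ v ∈ S, ⁅u, v⁆ ∈ S) (z : L) : z ∈ LieSubalgebra.lieSpan k L (S : Set L) ↔ z ∈ S := by
  constructor
  · intro hz
    have : LieSubalgebra.lieSpan k L (S : Set L) ≤ { S with lie_mem' := fun {u v} hu hv => h u hu v hv } :=
      LieSubalgebra.lieSpan_le.2 fun u hu => hu
    exact this hz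
  · intro hz; exact LieSubalgebra.subset_lieSpan hz

namespace TA
variable {x : ι → A} {d : ι → Derivation k A A} {ε : A →ₐ[k] k}

/-- divergence -/
noncomputable def dv (x : ι → A) (d : ι → Derivation k A A) : Derivation k A A →ₗ[k] A where
  toFun D := ∑ i, d i (D (x i))
  map_add' D E := by simp [Finset.sum_add_distrib]
  map_smul' a D := by simp [Finset.smul_sum]

theorem dv_apply (D : Derivation k A A) : dv x d D = ∑ i, d i (D (x i)) := rfl

theorem dv_lie (T : TA p x d ε) (D E : Derivation k A A) :
    dv x d ⁅D, E⁆ = D (dv x d E) - E (dv x d D) := by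
  simp only [dv_apply, Derivation.commutator_apply, map_sub, map_sum]
  have h1 : ∀ i, d i (D (E (x i))) = D (d i (E (x i))) + ∑ j, d i (D (x j)) * d j (E (x i)) := fun i => T.dcom i D _
  have h2 : ∀ i, d i (E (D (x i))) = E (d i (D (x i))) + ∑ j, d i (E (x j)) * d j (D (x i)) := fun i => T.dcom i E _
  simp only [h1, h2, Finset.sum_sub_distrib, Finset.sum_add_distrib]
  have h3 : ∑ i, ∑ j, d i (E (x j)) * d j (D (x i)) = ∑ i, ∑ j, d i (D (x j)) * d j (E (x i)) := by
    rw [Finset.sum_comm]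
    refine Finset.sum_congr rfl fun i _ => Finset.sum_congr rfl fun j _ => mul_comm _ _
  rw [h3]; ring

theorem dv_smul (T : TA p x d ε) (a : A) (D : Derivation k A A) :
    dv x d (a • D) = D a + a * dv x d D := by
  have h1 := congrArg (fun E : Derivation k A A => E a) (T.decomp D)
  rw [der_sum] at h1
  simp only [dv_apply, Derivation.smul_apply, smul_eq_mul, Derivation.leibniz, Finset.sum_add_distrib, Finset.mul_sum]
  rw [h1]
  simp only [Derivation.smul_apply, smul_eq_mul]
  rw [add_comm]

theorem dv_d (T : TA p x d ε) (i : ι) : dv x d (d i) = 0 := by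
  rw [dv_apply]
  refine Finset.sum_eq_zero fun j _ => ?_
  rw [T.dx]; split_ifs <;> simp

theorem euler (T : TA p x d ε) (i : ι) (e : ι → ℕ) (s : Finset ι) :
    x i * d i (∏ j ∈ s, x j ^ e j) = (if i ∈ s then e i else 0) • ∏ j ∈ s, x j ^ e j := by
  induction s using Finset.induction_on with
  | empty => simp
  | insert j s hj ih =>
    rw [Finset.prod_insert hj, Derivation.leibniz, smul_eq_mul, smul_eq_mul, mul_add, mul_left_comm, ih,
      Derivation.leibniz_pow, T.dx]
    by_cases hij : i = j
    · subst hij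
      rw [if_neg hj, if_pos rfl, if_pos (Finset.mem_insert_self _ _)]
      rcases Nat.eq_zero_or_pos (e i) with h0 | h0
      · simp [h0]
      · obtain ⟨m, hm⟩ : ∃ m, e i = m + 1 := ⟨e i - 1, by omega⟩
        rw [hm]; simp; ring
    · rw [if_neg hij]
      simp [Finset.mem_insert, hij]
      split_ifs <;> ring

variable [IsAlgClosed k]

theorem dv_range (T : TA p x d ε) : Module.finrank k A ≤ Module.finrank k (LinearMap.range (dv x d)) + 1 := by
  have := T.fin
  let t : A := ∏ i, x i ^ (p - 1)
  have htop : LinearMap.range (dv x d) ⊔ Submodule.span k {t} = ⊤ := by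
    rw [eq_top_iff, ← T.mon_span, Submodule.span_le]
    rintro _ ⟨e, rfl⟩
    by_cases he : ∀ i, (e i : ℕ) = p - 1
    · refine Submodule.mem_sup_right (Submodule.mem_span_singleton.2 ⟨1, ?_⟩)
      simp [t, he]
    · push Not at he
      obtain ⟨i, hi⟩ := he
      refine Submodule.mem_sup_left ?_
      have hlt : (e i : ℕ) + 1 < p := by have := (e i).2; omega
      have hk : (((e i : ℕ) + 1 : ℕ) : k) ≠ 0 := by
        intro hz
        rw [CharP.cast_eq_zero_iff k p] at hz
        exact absurd (Nat.le_of_dvd (Nat.succ_pos _) hz) (by omega)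
      have h1 := T.euler i (fun j => (e j : ℕ)) Finset.univ
      rw [if_pos (Finset.mem_univ i)] at h1
      refine ⟨((((e i : ℕ) + 1 : ℕ) : k)⁻¹) • ((x i * ∏ j, x j ^ (e j : ℕ)) • d i), ?_⟩
      rw [map_smul, T.dv_smul, T.dv_d, mul_zero, add_zero, Derivation.leibniz, T.dx, if_pos rfl, smul_eq_mul,
        smul_eq_mul, mul_one, h1]
      have h2 : (e i : ℕ) • ∏ j, x j ^ (e j : ℕ) + ∏ j, x j ^ (e j : ℕ) = (((e i : ℕ) + 1 : ℕ) : k) • ∏ j, x j ^ (e j : ℕ) := by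
        rw [Nat.cast_smul_eq_nsmul, add_smul, one_smul]
      rw [h2, smul_smul, inv_mul_cancel₀ hk, one_smul]
  rw [← finrank_top k A, ← htop]
  refine (Submodule.finrank_add_le_finrank_add_finrank _ _).trans ?_
  have := finrank_span_le_card (R := k) ({t} : Set A)
  simp at this
  omega

end TA
end P3b


section P3c
set_option linter.unusedSectionVars false
variable {p : ℕ} [Fact p.Prime] {k : Type*} [Field k] [CharP k p] [IsAlgClosed k]
variable {A : Type*} [CommRing A] [Algebra k A]

theorem pow_bound (hp : 3 < p) (r : ℕ) : r + 3 ≤ p ^ (r + 1) := by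
  induction r with
  | zero => simp; omega
  | succ r ih => rw [pow_succ]; nlinarith

namespace TA

theorem good_S {m : ℕ} {x : Fin (m + 1) → A} {d : Fin (m + 1) → Derivation k A A} {ε : A →ₐ[k] k}
    (T : TA p x d ε) (hm : 2 ≤ m) (hp3 : 3 < p) :
    GoodData p k (derivedSub k (LieSubalgebra.lieSpan k (Derivation k A A) {D | dv x d D = 0})) := by
  have := T.fin
  have := T.wfin
  have hmem : ∀ z, z ∈ LieSubalgebra.lieSpan k (Derivation k A A) {D | dv x d D = 0} ↔ dv x d z = 0 := by
    refine lieSpan_closed (LinearMap.ker (dv x d)) ?_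
    intro u hu v hv
    rw [LinearMap.mem_ker] at *
    rw [T.dv_lie, hu, hv, map_zero, map_zero, sub_zero]
  generalize LieSubalgebra.lieSpan k (Derivation k A A) {D | dv x d D = 0} = K at hmem
  have hsub : K.toSubmodule = LinearMap.ker (dv x d) := by
    ext z; exact hmem z
  obtain ⟨a, ha⟩ := T.adim 0
  have hle := T.finrank_le
  rw [Fintype.card_fin] at hle
  have hW := T.wrank
  rw [Fintype.card_fin] at hW
  have hxd : ∀ i j, i ≠ j → x i • d j ∈ K := by
    intro i j hij
    rw [hmem, T.dv_smul, T.dv_d, T.dx, if_neg hij.symm]; simp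
  have hd : ∀ j, d j ∈ K := fun j => (hmem _).2 (T.dv_d j)
  have hlie : ∀ (E : Derivation k A A) (a : A) (F : Derivation k A A), ⁅E, a • F⁆ = E a • F + a • ⁅E, F⁆ := by
    intro E a F
    ext b
    simp only [Derivation.commutator_apply, Derivation.add_apply, Derivation.smul_apply, smul_eq_mul,
      Derivation.leibniz]
    ring
  have h3 : ∀ i j : Fin (m + 1), ∃ l, l ≠ i ∧ l ≠ j := by
    intro i j
    have : ∃ l ∈ (Finset.univ : Finset (Fin (m + 1))), l ∉ ({i, j} : Finset (Fin (m + 1))) := by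
      refine Finset.exists_mem_notMem_of_card_lt_card ?_
      rw [Finset.card_univ, Fintype.card_fin]
      exact lt_of_le_of_lt Finset.card_le_two (by omega)
    obtain ⟨l, _, hl⟩ := this
    simp only [Finset.mem_insert, Finset.mem_singleton, not_or] at hl
    exact ⟨l, hl.1, hl.2⟩
  have hdK : ∀ j, d j ∈ derivedSub k K := by
    intro j
    obtain ⟨l, hl, _⟩ := h3 j j
    have h1 := mem_derivedSub (hd l) (hxd l j hl)
    rwa [hlie, T.dx, if_pos rfl, T.dcomm, smul_zero, add_zero, one_smul] at h1
  have hxdK : ∀ i j, i ≠ j → x i • d j ∈ derivedSub k K := by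
    intro i j hij
    obtain ⟨l, hl, hl'⟩ := h3 i j
    have h1 := mem_derivedSub (hxd i l hl.symm) (hxd l j hl')
    have h2 : ⁅x i • d l, x l • d j⁆ = x i • d j := by
      refine T.dext fun r => ?_
      simp only [Derivation.commutator_apply, Derivation.smul_apply, smul_eq_mul, Derivation.leibniz, T.dx]
      by_cases h : j = r <;> by_cases h' : l = r <;> by_cases h'' : j = i <;> simp_all
    rwa [h2] at h1
  have hpm : p ^ (m + 1) = p * p ^ m := pow_succ' _ _
  have hpm' : p ^ m = p * p ^ (m - 1) := by rw [← pow_succ', Nat.sub_add_cancel (by omega)]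
  have hap : a ≤ p ^ m := by
    have : p * a ≤ p * p ^ m := by rw [ha, ← hpm]; exact hle
    exact Nat.le_of_mul_le_mul_left this (by omega)
  refine GoodData.cartan (c := m * a) (B := m * p) (d0 := m) ?_ (by omega) ?_ ?_ ?_
    (fun i => x i.succ • d i.succ - x 0 • d 0) ?_ ?_ ?_ ?_
  · intro D hD
    refine T.dext fun i => ?_
    obtain ⟨j, hj, _⟩ := h3 i i
    have h2 := congrArg (fun E : Derivation k A A => E (x j)) (hD _ (hxdK i j hj.symm))
    rw [hlie, hD _ (hdK j)] at h2
    simpa [T.dx] using h2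
  · rw [mul_assoc, ← hpm']; exact Nat.mul_le_mul_left _ hap
  · have h1 : Module.finrank k (derivedSub k K) ≤ Module.finrank k (LinearMap.ker (dv x d)) := by
      rw [← hsub]; exact Submodule.finrank_mono (derivedSub_le K)
    have h2 := LinearMap.finrank_range_add_finrank_ker (dv x d)
    have h4 := T.dv_range
    rw [hW, ← ha] at h2
    rw [← ha] at h4
    have h5 : (m + 1) * (p * a) = p * (m * a) + p * a := by ring
    have h6 : m * p + 2 ≤ p ^ m := by
      rw [hpm', mul_comm m p]
      have h7 : m + 1 ≤ p ^ (m - 1) := by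
        obtain ⟨r, hr⟩ : ∃ r, m = r + 2 := ⟨m - 2, by omega⟩
        have := pow_bound hp3 r
        rw [show m - 1 = r + 1 by omega]; omega
      have := Nat.mul_le_mul_left p h7
      rw [mul_add, mul_one] at this
      omega
    omega
  · intro h hK h0 hp l hl
    have hl' : cz p k l ≠ 0 := fun hz => hl (cz_inj (by rw [hz, map_zero]))
    have hhK := derivedSub_le K hK
    have hdiv : dv x d h = 0 := (hmem h).1 hhK
    rw [derived_eig hhK hl', hsub]
    have e1 := map_rank (dv x d) ((LieAlgebra.ad k (Derivation k A A) h).eigenspace (cz p k l))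
    have e2 := T.eigW hp h0 l
    have e3 := T.eigA hp h0 l
    have e4 : ((LieAlgebra.ad k (Derivation k A A) h).eigenspace (cz p k l)).map (dv x d) =
        Module.End.eigenspace (h : Module.End k A) (cz p k l) := by
      ext f
      rw [Submodule.mem_map, Module.End.mem_eigenspace_iff]
      constructor
      · rintro ⟨E, hE, rfl⟩
        rw [Module.End.mem_eigenspace_iff, LieAlgebra.ad_apply] at hE
        have := T.dv_lie h E
        rw [hE, hdiv, map_zero, sub_zero, map_smul] at this
        exact this.symm
      · intro hf
        have hf' : h f = cz p k l • f := hf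
        refine ⟨(cz p k l)⁻¹ • (f • h), ?_, ?_⟩
        · refine Submodule.smul_mem _ _ ?_
          rw [Module.End.mem_eigenspace_iff, LieAlgebra.ad_apply, hlie, lie_self, smul_zero, add_zero, hf',
            smul_assoc]
        · rw [map_smul, T.dv_smul, hdiv, hf', mul_zero, add_zero, smul_smul, inv_mul_cancel₀ hl', one_smul]
    rw [e4] at e1
    rw [hW, ← ha] at e2
    rw [← ha] at e3
    have hp0 : 0 < p := by omega
    have e5 := Nat.eq_of_mul_eq_mul_left hp0 e3
    have e6 : Module.finrank k ((LieAlgebra.ad k (Derivation k A A) h).eigenspace (cz p k l)) = (m + 1) * a := by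
      apply Nat.eq_of_mul_eq_mul_left hp0
      rw [e2]; ring
    rw [e5, e6] at e1
    have : (m + 1) * a = m * a + a := by ring
    omega
  · intro i
    have h1 := mem_derivedSub (hxd i.succ 0 (Fin.succ_ne_zero i)) (hxd 0 i.succ (Fin.succ_ne_zero i).symm)
    have h2 : ⁅x i.succ • d 0, x 0 • d i.succ⁆ = x i.succ • d i.succ - x 0 • d 0 := by
      rw [hlie, Derivation.smul_apply, T.dx, if_pos rfl, smul_eq_mul, mul_one, ← lie_skew, hlie, T.dcomm, T.dx, if_pos rfl,
        smul_zero, add_zero, one_smul, smul_neg, ← sub_eq_add_neg]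
    rwa [h2] at h1
  · refine li_of_dual _ (fun j => coef x d ε j.succ) ?_
    intro i j
    show ε (d j.succ ((x i.succ • d i.succ - x 0 • d 0) (x j.succ))) = _
    rw [Derivation.sub_apply, T.xd_x, T.xd_x, if_neg (Fin.succ_ne_zero j).symm, map_zero, zero_smul, sub_zero,
      Derivation.map_smul, T.dx]
    simp
  · intro i j
    exact T.diag_comm (fun l => ⟨_, by rw [Derivation.sub_apply, T.xd_x, T.xd_x, ← sub_smul]⟩)
      (fun l => ⟨_, by rw [Derivation.sub_apply, T.xd_x, T.xd_x, ← sub_smul]⟩)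
  · intro i
    exact T.diag_toral fun j => ⟨_, by rw [Derivation.sub_apply, T.xd_x, T.xd_x, ← sub_smul, ← map_sub]⟩

end TA
end P3c


section P3d
set_option linter.unusedSectionVars false
variable {p : ℕ} [Fact p.Prime] {k : Type*} [Field k] [CharP k p]
variable {ι : Type*} [Fintype ι] [DecidableEq ι] {A : Type*} [CommRing A] [Algebra k A]

theorem lie_asmul (E : Derivation k A A) (a : A) (F : Derivation k A A) : ⁅E, a • F⁆ = E a • F + a • ⁅E, F⁆ := by
  ext b
  simp only [Derivation.commutator_apply, Derivation.add_apply, Derivation.smul_apply, smul_eq_mul,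
    Derivation.leibniz]
  ring

theorem lie_ksmul (E : Derivation k A A) (a : k) (F : Derivation k A A) : ⁅E, a • F⁆ = a • ⁅E, F⁆ :=
  map_smul (LieAlgebra.ad k _ E) a F

namespace TA
variable {x : ι → A} {d : ι → Derivation k A A} {ε : A →ₐ[k] k} {σ : ι → ι} {s : ι → k}

/-- Hamiltonian map -/
noncomputable def ham (d : ι → Derivation k A A) (σ : ι → ι) (s : ι → k) : A →ₗ[k] Derivation k A A where
  toFun f := ∑ j, s j • (d j f • d (σ j))
  map_add' f g := by simp [add_smul, Finset.sum_add_distrib]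
  map_smul' c f := by simp [Finset.smul_sum, smul_comm c]

theorem ham_apply (f g : A) : ham d σ s f g = ∑ j, s j • (d j f * d (σ j) g) := by
  show (∑ j, s j • (d j f • d (σ j))) g = _
  rw [der_sum]; rfl

theorem ham_x (T : TA p x d ε) (hσ : ∀ j, σ (σ j) = j) (hs : ∀ j, s (σ j) = - s j) (f : A) (i : ι) :
    ham d σ s f (x i) = - (s i • d (σ i) f) := by
  rw [ham_apply, Finset.sum_eq_single (σ i)]
  · rw [T.dx, if_pos (hσ i), hs, mul_one, neg_smul]
  · intro j _ hj
    rw [T.dx, if_neg, mul_zero, smul_zero]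
    intro h; exact hj (by rw [← h, hσ])
  · simp

theorem ham_anti (hσ : ∀ j, σ (σ j) = j) (hs : ∀ j, s (σ j) = - s j) (f g : A) :
    ham d σ s f g = - ham d σ s g f := by
  rw [ham_apply, ham_apply, ← Finset.sum_neg_distrib]
  refine Fintype.sum_equiv ⟨σ, σ, hσ, hσ⟩ _ _ fun j => ?_
  show _ = - (s (σ j) • (d (σ j) g * d (σ (σ j)) f))
  rw [hσ, hs, neg_smul, neg_neg, mul_comm]

theorem d_ham (T : TA p x d ε) (i : ι) (f g : A) :
    d i (ham d σ s f g) = ham d σ s (d i f) g + ham d σ s f (d i g) := by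
  rw [ham_apply, ham_apply, ham_apply, map_sum, ← Finset.sum_add_distrib]
  refine Finset.sum_congr rfl fun j _ => ?_
  rw [Derivation.map_smul, Derivation.leibniz, ← smul_add, T.dcomm' i j, T.dcomm' i (σ j), smul_eq_mul, smul_eq_mul]
  congr 1
  ring

theorem ham_lie (T : TA p x d ε) (hσ : ∀ j, σ (σ j) = j) (hs : ∀ j, s (σ j) = - s j) (f g : A) :
    ⁅ham d σ s f, ham d σ s g⁆ = ham d σ s (ham d σ s f g) := by
  refine T.dext fun i => ?_
  rw [Derivation.commutator_apply, T.ham_x hσ hs, T.ham_x hσ hs, T.ham_x hσ hs, T.d_ham, map_neg, map_neg,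
    Derivation.map_smul, Derivation.map_smul, ham_anti hσ hs g]
  simp only [smul_add, smul_neg]; ring

theorem ham_ker (T : TA p x d ε) (hσ : ∀ j, σ (σ j) = j) (hs : ∀ j, s (σ j) = - s j) (hs2 : ∀ j, s j * s j = 1)
    {f : A} (hf : ham d σ s f = 0) (D : Derivation k A A) : D f = 0 := by
  have h1 : ∀ i, d i f = 0 := by
    intro i
    have h2 := T.ham_x hσ hs f (σ i)
    rw [hf, hσ, Derivation.zero_apply] at h2
    have h3 : s (σ i) * s (σ i) = 1 := hs2 _
    have h4 : d i f = s (σ i) • (s (σ i) • d i f) := by rw [smul_smul, h3, one_smul]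
    rw [h4, ← neg_eq_zero, ← smul_neg, ← h2, smul_zero]
  have h2 := congrArg (fun E : Derivation k A A => E f) (T.decomp D)
  simp only [der_sum, Derivation.smul_apply, h1, smul_zero, Finset.sum_const_zero] at h2
  exact h2

theorem ham_val (T : TA p x d ε) (i : ι) : ham d σ s (x i) = s i • d (σ i) := by
  show ∑ j, s j • (d j (x i) • d (σ j)) = _
  rw [Finset.sum_eq_single i]
  · rw [T.dx, if_pos rfl, one_smul]
  · intro j _ hj; rw [T.dx, if_neg hj, zero_smul, smul_zero]
  · simp

theorem ham_mul (f g : A) : ham d σ s (f * g) = f • ham d σ s g + g • ham d σ s f := by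
  show ∑ j, s j • (d j (f * g) • d (σ j)) = f • (∑ j, s j • (d j g • d (σ j))) + g • (∑ j, s j • (d j f • d (σ j)))
  rw [Finset.smul_sum, Finset.smul_sum, ← Finset.sum_add_distrib]
  refine Finset.sum_congr rfl fun j _ => ?_
  rw [Derivation.leibniz, add_smul, smul_add, smul_assoc, smul_assoc, smul_comm f (s j), smul_comm g (s j)]

variable [IsAlgClosed k]

theorem good_H (T : TA p x d ε) (hσ : ∀ j, σ (σ j) = j) (hs : ∀ j, s (σ j) = - s j) (hs2 : ∀ j, s j * s j = 1)
    {r : ℕ} (hr : 1 ≤ r) (hcard : Fintype.card ι = 2 * r) (hp3 : 3 < p) (u : Fin r → ι)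
    (hu : ∀ i j, u i = u j → i = j) (hu' : ∀ i j, σ (u i) ≠ u j) :
    GoodData p k (derivedSub k (LieSubalgebra.lieSpan k (Derivation k A A) (Set.range (ham d σ s)))) := by
  have := T.fin
  have := T.wfin
  have hmem : ∀ z, z ∈ LieSubalgebra.lieSpan k (Derivation k A A) (Set.range (ham d σ s)) ↔
      z ∈ LinearMap.range (ham d σ s) := by
    refine lieSpan_closed (LinearMap.range (ham d σ s)) ?_
    rintro _ ⟨f, rfl⟩ _ ⟨g, rfl⟩
    exact ⟨_, (T.ham_lie hσ hs f g).symm⟩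
  generalize LieSubalgebra.lieSpan k (Derivation k A A) (Set.range (ham d σ s)) = K at hmem
  have hsub : K.toSubmodule = LinearMap.range (ham d σ s) := by
    ext z; exact hmem z
  have hp1 : 1 < p := by omega
  have hk : ∀ n : ℕ, 0 < n → n ≤ 3 → (n : k) ≠ 0 := by
    intro n hn hn' hz
    rw [CharP.cast_eq_zero_iff k p] at hz
    exact absurd (Nat.le_of_dvd hn hz) (by omega)
  have h2k : (2 : k) ≠ 0 := by simpa using hk 2 (by norm_num) (by norm_num)
  have h3k : (3 : k) ≠ 0 := by simpa using hk 3 (by norm_num) (by norm_num)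
  have hs0 : ∀ j, s j ≠ 0 := fun j h => by simpa [h] using hs2 j
  have hne : ∀ j, σ j ≠ j := by
    intro j h
    have h1 := hs j
    rw [h, eq_neg_iff_add_eq_zero, ← two_mul] at h1
    exact (mul_ne_zero h2k (hs0 j)) h1
  have hin : ∀ f g, ham d σ s (ham d σ s f g) ∈ derivedSub k K := by
    intro f g
    rw [← T.ham_lie hσ hs]
    exact mem_derivedSub ((hmem _).2 ⟨f, rfl⟩) ((hmem _).2 ⟨g, rfl⟩)
  have hin' : ∀ (f g h : A) (c : k), c ≠ 0 → ham d σ s f g = c • h → ham d σ s h ∈ derivedSub k K := by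
    intro f g h c hc hfg
    have h1 := hin f g
    rw [hfg, map_smul] at h1
    have h2 := (derivedSub k K).smul_mem c⁻¹ h1
    rwa [smul_smul, inv_mul_cancel₀ hc, one_smul] at h2
  have hvx : ∀ j g, ham d σ s (x (σ j)) g = (- s j) • d j g := by
    intro j g; rw [T.ham_val, hσ, hs]; rfl
  have hX : ∀ j, ham d σ s (x j) ∈ derivedSub k K := by
    intro j
    refine hin' (x (σ j)) (x j ^ 2) _ (- s j * 2) (mul_ne_zero (neg_ne_zero.2 (hs0 j)) h2k) ?_
    rw [hvx, Derivation.leibniz_pow, T.dx, if_pos rfl, mul_smul, ofNat_smul_eq_nsmul k 2]; simp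
  have hX2 : ∀ j, ham d σ s (x j ^ 2) ∈ derivedSub k K := by
    intro j
    refine hin' (x (σ j)) (x j ^ 3) _ (- s j * 3) (mul_ne_zero (neg_ne_zero.2 (hs0 j)) h3k) ?_
    rw [hvx, Derivation.leibniz_pow, T.dx, if_pos rfl, mul_smul, ofNat_smul_eq_nsmul k 3]; simp
  have hv2 : ∀ j, ham d σ s (x j ^ 2) = (2 * s j) • (x j • d (σ j)) := by
    intro j
    rw [pow_two, ham_mul, T.ham_val, ← two_smul k, mul_smul, smul_comm (x j) (s j)]
  have hXY : ∀ j, ham d σ s (x j * x (σ j)) ∈ derivedSub k K := by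
    intro j
    refine hin' (x j ^ 2) (x (σ j) ^ 2) _ (2 * s j * 2) (mul_ne_zero (mul_ne_zero h2k (hs0 j)) h2k) ?_
    rw [hv2, Derivation.smul_apply, Derivation.smul_apply, Derivation.leibniz_pow, T.dx, if_pos rfl]
    simp [Algebra.smul_def, map_ofNat (algebraMap k A) 2]; ring
  obtain ⟨a, ha⟩ := T.adim (u ⟨0, hr⟩)
  have hle := T.finrank_le
  rw [hcard] at hle
  have hpm : p ^ (2 * r) = p * (p ^ r * p ^ (r - 1)) := by
    rw [← pow_add, ← pow_succ']; congr 1; omega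
  have hap : a ≤ p ^ r * p ^ (r - 1) := by
    have : p * a ≤ p * (p ^ r * p ^ (r - 1)) := by rw [ha, ← hpm]; exact hle
    exact Nat.le_of_mul_le_mul_left this (by omega)
  refine GoodData.cartan (c := a) (B := p ^ r) (d0 := r) ?_ hr hap ?_ ?_
    (fun i => x (u i) • d (u i) - x (σ (u i)) • d (σ (u i))) ?_ ?_ ?_ ?_
  · intro D hD
    have h1 : ∀ j, ⁅D, d j⁆ = 0 := by
      intro j
      have h2 := hD _ (hX (σ j))
      rw [T.ham_val, hσ, lie_ksmul] at h2
      exact (smul_eq_zero.1 h2).resolve_left (hs0 _)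
    refine T.dext fun j => ?_
    have h2 := hD _ (hX2 j)
    rw [hv2, lie_ksmul, lie_asmul, h1, smul_zero, add_zero] at h2
    have h3 := (smul_eq_zero.1 h2).resolve_left (mul_ne_zero h2k (hs0 _))
    have h4 := congrArg (fun E : Derivation k A A => E (x (σ j))) h3
    simpa [T.dx] using h4
  · have h1 : Module.finrank k (derivedSub k K) ≤ Module.finrank k (LinearMap.range (ham d σ s)) := by
      rw [← hsub]; exact Submodule.finrank_mono (derivedSub_le K)
    have h2 := LinearMap.finrank_range_add_finrank_ker (ham d σ s)
    have h3 : 0 < Module.finrank k (LinearMap.ker (ham d σ s)) := by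
      have := T.nontriv
      have h4 : (1 : A) ∈ LinearMap.ker (ham d σ s) := by
        rw [LinearMap.mem_ker]
        show ∑ j, s j • (d j 1 • d (σ j)) = 0
        simp
      have : Nontrivial (LinearMap.ker (ham d σ s)) := ⟨⟨1, h4⟩, 0, fun h => one_ne_zero (congrArg Subtype.val h)⟩
      exact Module.finrank_pos
    rw [← ha] at h2
    omega
  · intro h hK h0 hp l hl
    have hl' : cz p k l ≠ 0 := fun hz => hl (cz_inj (by rw [hz, map_zero]))
    have hhK := derivedSub_le K hK
    obtain ⟨f, rfl⟩ := (hmem h).1 hhK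
    rw [derived_eig hhK hl', hsub]
    have e1 := map_rank (ham d σ s) (Module.End.eigenspace (ham d σ s f : Module.End k A) (cz p k l))
    have e3 := T.eigA hp h0 l
    have e2 : (Module.End.eigenspace (ham d σ s f : Module.End k A) (cz p k l)) ⊓ LinearMap.ker (ham d σ s) = ⊥ := by
      rw [eq_bot_iff]
      rintro g ⟨h1, h2⟩
      have h3 := T.ham_ker hσ hs hs2 h2 (ham d σ s f)
      have h4 : ham d σ s f g = cz p k l • g := Module.End.mem_eigenspace_iff.1 h1
      rw [h3] at h4
      exact (smul_eq_zero.1 h4.symm).resolve_left hl'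
    have e4 : (Module.End.eigenspace (ham d σ s f : Module.End k A) (cz p k l)).map (ham d σ s) =
        (LieAlgebra.ad k (Derivation k A A) (ham d σ s f)).eigenspace (cz p k l) ⊓ LinearMap.range (ham d σ s) := by
      ext z
      constructor
      · rintro ⟨g, hg, rfl⟩
        have h4 : ham d σ s f g = cz p k l • g := Module.End.mem_eigenspace_iff.1 hg
        refine ⟨?_, ⟨g, rfl⟩⟩
        rw [SetLike.mem_coe, Module.End.mem_eigenspace_iff, LieAlgebra.ad_apply, T.ham_lie hσ hs, h4, map_smul]
      · rintro ⟨h1, ⟨g, rfl⟩⟩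
        rw [SetLike.mem_coe, Module.End.mem_eigenspace_iff, LieAlgebra.ad_apply, T.ham_lie hσ hs, ← map_smul] at h1
        have h2 : ham d σ s (ham d σ s f g - cz p k l • g) = 0 := by rw [map_sub, h1, sub_self]
        have h3 := T.ham_ker hσ hs hs2 h2 (ham d σ s f)
        rw [map_sub, sub_eq_zero, Derivation.map_smul] at h3
        refine ⟨(cz p k l)⁻¹ • ham d σ s f g, ?_, ?_⟩
        · refine Submodule.smul_mem _ _ ?_
          exact Module.End.mem_eigenspace_iff.2 h3
        · rw [map_smul, h1, map_smul, smul_smul, inv_mul_cancel₀ hl', one_smul]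
    rw [e2, e4, finrank_bot, add_zero] at e1
    rw [e1]
    rw [← ha] at e3
    exact Nat.eq_of_mul_eq_mul_left (by omega) e3
  · intro i
    have h1 := (derivedSub k K).smul_mem (- s (u i)) (hXY (u i))
    rw [ham_mul, T.ham_val, T.ham_val, hσ, hs] at h1
    have h2 : - s (u i) • (x (u i) • -s (u i) • d (u i) + x (σ (u i)) • s (u i) • d (σ (u i))) =
        x (u i) • d (u i) - x (σ (u i)) • d (σ (u i)) := by
      rw [smul_comm (x (u i)), smul_comm (x (σ (u i))), smul_add, smul_smul, smul_smul, neg_mul_neg, neg_mul, hs2,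
        one_smul, neg_smul, one_smul, ← sub_eq_add_neg]
    rwa [h2] at h1
  · refine li_of_dual _ (fun j => coef x d ε (u j)) ?_
    intro i j
    show ε (d (u j) ((x (u i) • d (u i) - x (σ (u i)) • d (σ (u i))) (x (u j)))) = _
    rw [Derivation.sub_apply, T.xd_x, T.xd_x, if_neg (hu' i j), map_zero, zero_smul, sub_zero,
      Derivation.map_smul, T.dx]
    by_cases h : i = j
    · subst h; simp
    · rw [if_neg h, if_neg fun h' => h (hu _ _ h')]; simp
  · intro i j
    exact T.diag_comm (fun l => ⟨_, by rw [Derivation.sub_apply, T.xd_x, T.xd_x, ← sub_smul]⟩)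
      (fun l => ⟨_, by rw [Derivation.sub_apply, T.xd_x, T.xd_x, ← sub_smul]⟩)
  · intro i
    exact T.diag_toral fun j => ⟨_, by rw [Derivation.sub_apply, T.xd_x, T.xd_x, ← sub_smul, ← map_sub]⟩

end TA
end P3d


section P3e
set_option linter.unusedSectionVars false
variable {p : ℕ} [Fact p.Prime] {k : Type*} [Field k] [CharP k p]
variable {ι : Type*} [Fintype ι] [DecidableEq ι] {A : Type*} [CommRing A] [Algebra k A]

namespace TA
variable {x : Option ι → A} {d : Option ι → Derivation k A A} {ε : A →ₐ[k] k} {σ : ι → ι} {s : ι → k}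

/-- contact frame -/
noncomputable def Yf (x : Option ι → A) (d : Option ι → Derivation k A A) (σ : ι → ι) (s : ι → k) (j : ι) :
    Derivation k A A := d (some j) + (s j • x (some (σ j))) • d none

/-- Poisson part -/
noncomputable def poi (x : Option ι → A) (d : Option ι → Derivation k A A) (σ : ι → ι) (s : ι → k) (f g : A) : A :=
  ∑ j, s j • (Yf x d σ s j f * Yf x d σ s (σ j) g)

/-- contact map -/
noncomputable def con (x : Option ι → A) (d : Option ι → Derivation k A A) (σ : ι → ι) (s : ι → k) :
    A →ₗ[k] Derivation k A A where
  toFun f := (2 * f) • d none + ∑ j, s j • (Yf x d σ s j f • Yf x d σ s (σ j))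
  map_add' f g := by simp [add_smul, mul_add, Finset.sum_add_distrib]; abel
  map_smul' c f := by simp [Finset.smul_sum, smul_comm c]

/-- contact bracket -/
noncomputable def cbr (x : Option ι → A) (d : Option ι → Derivation k A A) (σ : ι → ι) (s : ι → k) (f g : A) : A :=
  con x d σ s f g - 2 * d none f * g

theorem con_apply (f g : A) : con x d σ s f g = 2 * f * d none g + poi x d σ s f g := by
  show ((2 * f) • d none + ∑ j, s j • (Yf x d σ s j f • Yf x d σ s (σ j))) g = _
  rw [Derivation.add_apply, der_sum]; rfl

theorem poi_anti (hσ : ∀ j, σ (σ j) = j) (hs : ∀ j, s (σ j) = - s j) (f g : A) :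
    poi x d σ s f g = - poi x d σ s g f := by
  rw [poi, poi, ← Finset.sum_neg_distrib]
  refine Fintype.sum_equiv ⟨σ, σ, hσ, hσ⟩ _ _ fun j => ?_
  show _ = - (s (σ j) • (Yf x d σ s (σ j) g * Yf x d σ s (σ (σ j)) f))
  rw [hσ, hs, neg_smul, neg_neg, mul_comm]

theorem Y_x (T : TA p x d ε) (i j : ι) : Yf x d σ s i (x (some j)) = if i = j then 1 else 0 := by
  rw [Yf, Derivation.add_apply, Derivation.smul_apply, T.dx, T.dx]; simp

theorem Y_n (T : TA p x d ε) (i : ι) : Yf x d σ s i (x none) = s i • x (some (σ i)) := by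
  rw [Yf, Derivation.add_apply, Derivation.smul_apply, T.dx, T.dx]; simp

theorem Y_Z (T : TA p x d ε) (i : ι) (f : A) : Yf x d σ s i (d none f) = d none (Yf x d σ s i f) := by
  rw [Yf, Derivation.add_apply, Derivation.smul_apply, Derivation.add_apply, Derivation.smul_apply, map_add,
    smul_eq_mul, smul_eq_mul, Derivation.leibniz, Derivation.map_smul, T.dx, T.dcomm' none (some i)]
  simp

theorem Y_Y (T : TA p x d ε) (hσ : ∀ j, σ (σ j) = j) (hs : ∀ j, s (σ j) = - s j) (i j : ι) (f : A) :
    Yf x d σ s i (Yf x d σ s j f) = Yf x d σ s j (Yf x d σ s i f) + if j = σ i then (-2 * s i) • d none f else 0 := by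
  have h : ⁅Yf x d σ s i, Yf x d σ s j⁆ = if j = σ i then (-2 * s i) • d none else 0 := by
    refine T.dext fun l => ?_
    rw [Derivation.commutator_apply]
    rcases l with _ | l
    · rw [T.Y_n, T.Y_n, Derivation.map_smul, Derivation.map_smul, T.Y_x, T.Y_x]
      by_cases hji : j = σ i
      · subst hji
        rw [if_pos (hσ i).symm, if_pos rfl, if_pos rfl, Derivation.smul_apply, T.dx, if_pos rfl, hs, ← sub_smul]
        congr 1; ring
      · rw [if_neg hji, if_neg hji, if_neg fun h => hji (by rw [h, hσ])]; simp
    · rw [T.Y_x, T.Y_x]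
      split_ifs <;> simp [T.dx]
  have h1 := congrArg (fun E : Derivation k A A => E f) h
  rw [Derivation.commutator_apply, sub_eq_iff_eq_add'] at h1
  rw [h1]
  congr 1
  split_ifs <;> rfl

theorem con_x (T : TA p x d ε) (hσ : ∀ j, σ (σ j) = j) (hs : ∀ j, s (σ j) = - s j) (f : A) (i : ι) :
    con x d σ s f (x (some i)) = - (s i • Yf x d σ s (σ i) f) := by
  rw [con_apply, poi, Finset.sum_eq_single (σ i), T.dx, if_neg (by simp), mul_zero, zero_add]
  · rw [T.Y_x, if_pos (hσ i), hs, mul_one, neg_smul]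
  · intro j _ hj
    rw [T.Y_x, if_neg, mul_zero, smul_zero]
    intro h; exact hj (by rw [← h, hσ])
  · simp

/-- contact form -/
noncomputable def om (x : Option ι → A) (σ : ι → ι) (s : ι → k) (E : Derivation k A A) : A :=
  E (x none) + ∑ j, s j • (x (some j) * E (x (some (σ j))))

theorem om_con (T : TA p x d ε) (hσ : ∀ j, σ (σ j) = j) (hs : ∀ j, s (σ j) = - s j) (hs2 : ∀ j, s j * s j = 1)
    (f : A) : om x σ s (con x d σ s f) = 2 * f := by
  rw [om, con_apply, poi, T.dx, if_pos rfl, mul_one, add_assoc, ← Finset.sum_add_distrib]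
  rw [Finset.sum_eq_zero, add_zero]
  intro j _
  rw [T.con_x hσ hs, T.Y_n, hσ, hs]
  simp only [Algebra.smul_def, map_neg]
  ring

theorem om_ext (T : TA p x d ε) {E F : Derivation k A A} (h : ∀ i, E (x (some i)) = F (x (some i)))
    (h' : om x σ s E = om x σ s F) : E = F := by
  refine T.dext fun i => ?_
  rcases i with _ | i
  · simp only [om, h] at h'
    exact add_right_cancel h'
  · exact h i

theorem om_lie (hσ : ∀ j, σ (σ j) = j) (hs : ∀ j, s (σ j) = - s j) (E F : Derivation k A A) :
    om x σ s ⁅E, F⁆ = E (om x σ s F) - F (om x σ s E) - 2 * ∑ j, s j • (E (x (some j)) * F (x (some (σ j)))) := by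
  have h1 : ∑ j, s j • (F (x (some j)) * E (x (some (σ j)))) = - ∑ j, s j • (E (x (some j)) * F (x (some (σ j)))) := by
    rw [← Finset.sum_neg_distrib]
    refine Fintype.sum_equiv ⟨σ, σ, hσ, hσ⟩ _ _ fun j => ?_
    show _ = - (s (σ j) • (E (x (some (σ j))) * F (x (some (σ (σ j))))))
    rw [hσ, hs, neg_smul, neg_neg, mul_comm]
  have h2 : ∀ j, s j • (x (some j) * ⁅E, F⁆ (x (some (σ j)))) =
      E (s j • (x (some j) * F (x (some (σ j))))) - F (s j • (x (some j) * E (x (some (σ j)))))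
      - s j • (E (x (some j)) * F (x (some (σ j)))) + s j • (F (x (some j)) * E (x (some (σ j)))) := by
    intro j
    rw [Derivation.map_smul, Derivation.map_smul, ← smul_sub, ← smul_sub, ← smul_add, Derivation.commutator_apply,
      Derivation.leibniz, Derivation.leibniz]
    congr 1
    simp only [smul_eq_mul]; ring
  rw [om, om, om, map_add, map_add, map_sum, map_sum, Finset.sum_congr rfl fun j _ => h2 j, Finset.sum_add_distrib,
    Finset.sum_sub_distrib, Finset.sum_sub_distrib, h1, Derivation.commutator_apply]
  ring

theorem Y_cbr (T : TA p x d ε) (hσ : ∀ j, σ (σ j) = j) (hs : ∀ j, s (σ j) = - s j) (hs2 : ∀ j, s j * s j = 1)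
    (i : ι) (f g : A) : Yf x d σ s i (cbr x d σ s f g) =
      con x d σ s f (Yf x d σ s i g) - con x d σ s g (Yf x d σ s i f) := by
  have h1 : Yf x d σ s i (poi x d σ s f g) = poi x d σ s (Yf x d σ s i f) g + poi x d σ s f (Yf x d σ s i g)
      + (2 * d none f * Yf x d σ s i g - 2 * Yf x d σ s i f * d none g) := by
    have e1 : 2 * d none f * Yf x d σ s i g = ∑ j, if j = σ i then 2 * d none f * Yf x d σ s i g else 0 := by simp
    have e2 : 2 * Yf x d σ s i f * d none g = ∑ j, if j = i then 2 * Yf x d σ s i f * d none g else 0 := by simp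
    rw [e1, e2, poi, poi, poi, map_sum, ← Finset.sum_add_distrib, ← Finset.sum_sub_distrib, ← Finset.sum_add_distrib]
    refine Finset.sum_congr rfl fun j _ => ?_
    rw [Derivation.map_smul, Derivation.leibniz, T.Y_Y hσ hs i j, T.Y_Y hσ hs i (σ j)]
    have h3 : algebraMap k A (s i) * algebraMap k A (s i) = 1 := by rw [← map_mul, hs2, map_one]
    have hij : σ j = σ i ↔ j = i := ⟨fun h => by rw [← hσ j, h, hσ], fun h => by rw [h]⟩
    have ha : s j • (Yf x d σ s (σ j) g * if j = σ i then (-2 * s i) • d none f else 0) =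
        if j = σ i then 2 * d none f * Yf x d σ s i g else 0 := by
      split_ifs with h
      · subst h
        rw [hσ, hs]
        simp only [Algebra.smul_def, map_neg, map_mul, map_ofNat]
        linear_combination (2 * d none f * Yf x d σ s i g) * h3
      · simp
    have hb : s j • (Yf x d σ s j f * if σ j = σ i then (-2 * s i) • d none g else 0) =
        - if j = i then 2 * Yf x d σ s i f * d none g else 0 := by
      simp only [hij]
      split_ifs with h
      · subst h
        simp only [Algebra.smul_def, map_neg, map_mul, map_ofNat]
        linear_combination (-2 * d none g * Yf x d σ s j f) * h3
      · simp
    rw [sub_eq_add_neg, ← ha, ← hb]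
    simp only [smul_eq_mul, ← smul_add]
    congr 1
    ring
  rw [cbr, con_apply, con_apply, con_apply, map_sub, map_add, h1]
  simp only [Derivation.leibniz, smul_eq_mul, T.Y_Z]
  have h2 : Yf x d σ s i (2 : A) = 0 := by
    exact_mod_cast Derivation.map_natCast (Yf x d σ s i) 2
  rw [h2, poi_anti hσ hs g]
  ring

theorem con_lie (T : TA p x d ε) (hσ : ∀ j, σ (σ j) = j) (hs : ∀ j, s (σ j) = - s j) (hs2 : ∀ j, s j * s j = 1)
    (f g : A) : ⁅con x d σ s f, con x d σ s g⁆ = con x d σ s (cbr x d σ s f g) := by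
  refine T.om_ext (σ := σ) (s := s) (fun i => ?_) ?_
  · rw [Derivation.commutator_apply, T.con_x hσ hs, T.con_x hσ hs, T.con_x hσ hs, T.Y_cbr hσ hs hs2, map_neg, map_neg,
      Derivation.map_smul, Derivation.map_smul]
    simp only [smul_sub]; ring
  · rw [om_lie hσ hs, T.om_con hσ hs hs2, T.om_con hσ hs hs2, T.om_con hσ hs hs2]
    have h1 : ∑ j, s j • (con x d σ s f (x (some j)) * con x d σ s g (x (some (σ j)))) = poi x d σ s f g := by
      rw [poi_anti hσ hs, poi, ← Finset.sum_neg_distrib]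
      refine Finset.sum_congr rfl fun j _ => ?_
      have h3 : algebraMap k A (s j) * algebraMap k A (s j) = 1 := by rw [← map_mul, hs2, map_one]
      rw [T.con_x hσ hs, T.con_x hσ hs, hσ, hs]
      simp only [Algebra.smul_def, map_neg]
      linear_combination (-(algebraMap k A (s j)) * Yf x d σ s (σ j) f * Yf x d σ s j g) * h3
    have h2 : ∀ D : Derivation k A A, D (2 : A) = 0 := by
      intro D
      exact_mod_cast Derivation.map_natCast D 2
    rw [h1, cbr, Derivation.leibniz, Derivation.leibniz, h2, h2, con_apply g, poi_anti hσ hs g, con_apply f]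
    simp only [smul_eq_mul]
    ring

end TA
end P3e


section P3f
set_option linter.unusedSectionVars false
variable {p : ℕ} [Fact p.Prime] {k : Type*} [Field k] [CharP k p]
variable {ι : Type*} [Fintype ι] [DecidableEq ι] {A : Type*} [CommRing A] [Algebra k A]

namespace TA
variable {x : Option ι → A} {d : Option ι → Derivation k A A} {ε : A →ₐ[k] k} {σ : ι → ι} {s : ι → k}
variable [IsAlgClosed k]

theorem con_n (T : TA p x d ε) (f : A) (hσ : ∀ j, σ (σ j) = j) (hs : ∀ j, s (σ j) = - s j) (hs2 : ∀ j, s j * s j = 1) :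
    con x d σ s f (x none) = 2 * f - ∑ j, x (some j) * Yf x d σ s j f := by
  rw [con_apply, poi, T.dx, if_pos rfl, mul_one, sub_eq_add_neg, ← Finset.sum_neg_distrib]
  congr 1
  refine Finset.sum_congr rfl fun j _ => ?_
  have h3 : algebraMap k A (s j) * algebraMap k A (s j) = 1 := by rw [← map_mul, hs2, map_one]
  rw [T.Y_n, hσ, hs]
  simp only [Algebra.smul_def, map_neg]
  linear_combination (- x (some j) * Yf x d σ s j f) * h3

theorem good_K (T : TA p x d ε) (hσ : ∀ j, σ (σ j) = j) (hs : ∀ j, s (σ j) = - s j) (hs2 : ∀ j, s j * s j = 1)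
    {r : ℕ} (hcard : Fintype.card ι = 2 * r) (hp3 : 3 < p) (u : Fin r → ι)
    (hu : ∀ i j, u i = u j → i = j) (hu' : ∀ i j, σ (u i) ≠ u j) :
    GoodData p k (derivedSub k (LieSubalgebra.lieSpan k (Derivation k A A) (Set.range (con x d σ s)))) := by
  have := T.fin
  have := T.wfin
  have hmem : ∀ z, z ∈ LieSubalgebra.lieSpan k (Derivation k A A) (Set.range (con x d σ s)) ↔
      z ∈ LinearMap.range (con x d σ s) := by
    refine lieSpan_closed (LinearMap.range (con x d σ s)) ?_
    rintro _ ⟨f, rfl⟩ _ ⟨g, rfl⟩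
    exact ⟨_, (T.con_lie hσ hs hs2 f g).symm⟩
  generalize LieSubalgebra.lieSpan k (Derivation k A A) (Set.range (con x d σ s)) = K at hmem
  have hsub : K.toSubmodule = LinearMap.range (con x d σ s) := by
    ext z; exact hmem z
  have hp1 : 1 < p := by omega
  have h2k : (2 : k) ≠ 0 := by
    intro hz
    have hz' : ((2 : ℕ) : k) = 0 := by exact_mod_cast hz
    rw [CharP.cast_eq_zero_iff k p] at hz'
    exact absurd (Nat.le_of_dvd (by norm_num) hz') (by omega)
  have h2A : ∀ a : A, 2 * a = 0 → a = 0 := by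
    intro a h
    have h1 : (2 : k) • a = 0 := by rw [Algebra.smul_def, map_ofNat, h]
    exact (smul_eq_zero.1 h1).resolve_left h2k
  have hs0 : ∀ j, s j ≠ 0 := fun j h => by simpa [h] using hs2 j
  have hne : ∀ j, σ j ≠ j := by
    intro j h
    have h1 := hs j
    rw [h, eq_neg_iff_add_eq_zero, ← two_mul] at h1
    exact (mul_ne_zero h2k (hs0 j)) h1
  have hinj : Function.Injective (con x d σ s) := by
    rw [← LinearMap.ker_eq_bot, LinearMap.ker_eq_bot']
    intro f hf
    have h1 := T.om_con hσ hs hs2 f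
    rw [hf] at h1
    refine h2A f ?_
    rw [← h1, om]; simp
  have hin : ∀ f g, con x d σ s (cbr x d σ s f g) ∈ derivedSub k K := by
    intro f g
    rw [← T.con_lie hσ hs hs2]
    exact mem_derivedSub ((hmem _).2 ⟨f, rfl⟩) ((hmem _).2 ⟨g, rfl⟩)
  have hZ : ∀ g, con x d σ s (d none g) ∈ derivedSub k K := by
    intro g
    have h1 := (derivedSub k K).smul_mem 2⁻¹ (hin 1 g)
    have h2 : cbr x d σ s 1 g = (2 : k) • d none g := by
      rw [cbr, con_apply, poi]
      simp [Algebra.smul_def, map_ofNat (algebraMap k A) 2]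
    rwa [h2, map_smul, smul_smul, inv_mul_cancel₀ h2k, one_smul] at h1
  have hZ' : ∀ f, d none f = 0 → con x d σ s f ∈ derivedSub k K := by
    intro f hf
    have h1 := hZ (x none * f)
    rwa [Derivation.leibniz, hf, smul_zero, zero_add, T.dx, if_pos rfl, smul_eq_mul, mul_one] at h1
  have hd0 : ∀ j, d none (x (some j)) = 0 := fun j => by rw [T.dx, if_neg (by simp)]
  have hX : ∀ j, con x d σ s (x (some j)) ∈ derivedSub k K := fun j => hZ' _ (hd0 j)
  have hX2 : ∀ j, con x d σ s (x (some j) ^ 2) ∈ derivedSub k K := fun j => hZ' _ (by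
    rw [Derivation.leibniz_pow, hd0]; simp)
  have hXY : ∀ j, con x d σ s (x (some j) * x (some (σ j))) ∈ derivedSub k K := fun j => hZ' _ (by
    rw [Derivation.leibniz, hd0, hd0]; simp)
  have hN : con x d σ s (x none) ∈ derivedSub k K := by
    have h1 := (derivedSub k K).smul_mem 2⁻¹ (hZ (x none ^ 2))
    have h2 : d none (x none ^ 2) = (2 : k) • x none := by
      rw [Derivation.leibniz_pow, T.dx, if_pos rfl]
      simp [Algebra.smul_def, map_ofNat (algebraMap k A) 2]
    rwa [h2, map_smul, smul_smul, inv_mul_cancel₀ h2k, one_smul] at h1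
  have hZZ : (2 : k) • d none = con x d σ s 1 := by
    refine Derivation.ext fun g => ?_
    rw [con_apply, poi]
    simp [Algebra.smul_def, map_ofNat (algebraMap k A) 2]
  have v1 : ∀ j, con x d σ s (x (some j)) = x (some j) • d none + s j • d (some (σ j)) := by
    intro j
    refine T.dext fun i => ?_
    rcases i with _ | i
    · rw [T.con_n _ hσ hs hs2]
      simp [T.Y_x, T.dx]; ring
    · rw [T.con_x hσ hs, T.Y_x]
      by_cases h : σ j = i
      · subst h
        simp [hσ, hs, T.dx]
      · have h' : σ i ≠ j := fun h' => h (by rw [← h', hσ])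
        simp [h, h', T.dx]
  have v2 : ∀ j, con x d σ s (x (some j) ^ 2) = (2 * s j) • (x (some j) • d (some (σ j))) := by
    intro j
    refine T.dext fun i => ?_
    rcases i with _ | i
    · rw [T.con_n _ hσ hs hs2]
      simp [T.Y_x, T.dx, Derivation.leibniz_pow]; ring
    · rw [T.con_x hσ hs, Derivation.leibniz_pow, T.Y_x]
      by_cases h : σ j = i
      · subst h
        simp [hσ, hs, T.dx, Algebra.smul_def, map_ofNat (algebraMap k A) 2]; ring
      · have h' : σ i ≠ j := fun h' => h (by rw [← h', hσ])
        simp [h, h', T.dx]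
  have v3 : ∀ j, con x d σ s (x (some j) * x (some (σ j))) =
      (- s j) • (x (some j) • d (some j) - x (some (σ j)) • d (some (σ j))) := by
    intro j
    refine T.dext fun i => ?_
    rcases i with _ | i
    · rw [T.con_n _ hσ hs hs2]
      simp [T.Y_x, T.dx, Derivation.leibniz, mul_add, Finset.sum_add_distrib]; ring
    · rw [T.con_x hσ hs, Derivation.leibniz, T.Y_x, T.Y_x]
      by_cases h : σ j = i
      · subst h
        simp [hσ, hs, T.dx, hne, (hne _).symm]
      · have h' : σ i ≠ j := fun h' => h (by rw [← h', hσ])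
        by_cases h2 : j = i
        · subst h2
          simp [T.dx, hne, (hne _).symm]
        · have h3 : σ i ≠ σ j := fun h' => h2 (by rw [← hσ j, ← h', hσ])
          simp [h, h', h2, h3, T.dx]
  have v4 : ∀ i, con x d σ s (x none) (x (some i)) = x (some i) := by
    intro i
    rw [T.con_x hσ hs, T.Y_n, hσ, hs, smul_smul, mul_neg, hs2]; simp
  have v5 : con x d σ s (x none) (x none) = 2 * x none := by
    have h1 : ∑ j, x (some j) * Yf x d σ s j (x none) = 0 := by
      have h2 : ∑ j, x (some j) * Yf x d σ s j (x none) = - ∑ j, x (some j) * Yf x d σ s j (x none) := by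
        rw [← Finset.sum_neg_distrib]
        refine Fintype.sum_equiv ⟨σ, σ, hσ, hσ⟩ _ _ fun j => ?_
        show _ = - (x (some (σ j)) * Yf x d σ s (σ j) (x none))
        rw [T.Y_n, T.Y_n, hσ, hs]
        simp [Algebra.smul_def]; ring
      rw [eq_neg_iff_add_eq_zero, ← two_mul] at h2
      exact h2A _ h2
    rw [T.con_n _ hσ hs hs2, h1, sub_zero]
  have hcard' : Fintype.card (Option ι) = 2 * r + 1 := by rw [Fintype.card_option, hcard]
  obtain ⟨a, ha⟩ := T.adim none
  have hle := T.finrank_le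
  rw [hcard'] at hle
  have hpm : p ^ (2 * r + 1) = p * (p ^ r * p ^ (r + 1 - 1)) := by
    rw [← pow_add, ← pow_succ']; congr 1; omega
  have hap : a ≤ p ^ r * p ^ (r + 1 - 1) := by
    have : p * a ≤ p * (p ^ r * p ^ (r + 1 - 1)) := by rw [ha, ← hpm]; exact hle
    exact Nat.le_of_mul_le_mul_left this (by omega)
  let H : Fin (r + 1) → Derivation k A A := Fin.cases (con x d σ s (x none))
    (fun i => x (some (u i)) • d (some (u i)) - x (some (σ (u i))) • d (some (σ (u i))))
  have H0 : H 0 = con x d σ s (x none) := rfl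
  have HS : ∀ i, H (Fin.succ i) = x (some (u i)) • d (some (u i)) - x (some (σ (u i))) • d (some (σ (u i))) :=
    fun i => rfl
  have hdiag : ∀ i j, ∃ c : ZMod p, H i (x j) = cz p k c • x j := by
    intro i j
    refine Fin.cases ?_ (fun i => ?_) i
    · rw [H0]
      rcases j with _ | j
      · exact ⟨2, by rw [v5, map_ofNat, ofNat_smul_eq_nsmul, nsmul_eq_mul]; rfl⟩
      · exact ⟨1, by rw [v4]; simp⟩
    · exact ⟨_, by rw [HS, Derivation.sub_apply, T.xd_x, T.xd_x, ← sub_smul, ← map_sub]⟩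
  refine GoodData.cartan (c := a) (B := p ^ r) (d0 := r + 1) ?_ (by omega) hap ?_ ?_ H ?_ ?_ ?_ ?_
  · intro D hD
    have h0 : ⁅D, d none⁆ = 0 := by
      have h2 := hD _ (hZ' 1 (by simp))
      rw [← hZZ, lie_ksmul] at h2
      exact (smul_eq_zero.1 h2).resolve_left h2k
    have h1 : ∀ j, ⁅D, d (some (σ j))⁆ = - (s j • (D (x (some j)) • d none)) := by
      intro j
      have h2 := hD _ (hX j)
      rw [v1, lie_add, lie_ksmul, lie_asmul, h0, smul_zero, add_zero] at h2
      rw [eq_neg_iff_add_eq_zero]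
      have h3 := congrArg (fun E => s j • E) h2
      simp only [smul_add, smul_smul, hs2, one_smul, smul_zero] at h3
      rw [add_comm]; exact h3
    have h2 : ∀ j, D (x (some j)) = 0 := by
      intro j
      have h2 := hD _ (hX2 j)
      rw [v2, lie_ksmul, lie_asmul, h1] at h2
      have h3 := (smul_eq_zero.1 h2).resolve_left (mul_ne_zero h2k (hs0 _))
      have h4 := congrArg (fun E : Derivation k A A => E (x (some (σ j)))) h3
      simpa [T.dx] using h4
    have h3 : ∀ j, ⁅D, d j⁆ = 0 := by
      intro j
      rcases j with _ | j
      · exact h0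
      · have := h1 (σ j)
        rw [hσ, h2] at this
        simpa using this
    have h4 : ∀ j, d j (D (x none)) = 0 := by
      intro j
      have h5 := congrArg (fun E : Derivation k A A => E (x none)) (h3 j)
      simp only [Derivation.commutator_apply, Derivation.zero_apply] at h5
      rw [T.dx] at h5
      rw [sub_eq_zero] at h5
      rw [← h5]
      split_ifs <;> simp
    refine T.dext fun j => ?_
    rcases j with _ | j
    · have h5 := congrArg (fun E : Derivation k A A => E (x none)) (hD _ hN)
      simp only [Derivation.commutator_apply, Derivation.zero_apply] at h5
      have h6 := congrArg (fun E : Derivation k A A => E (D (x none))) (T.decomp (con x d σ s (x none)))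
      simp only [der_sum, Derivation.smul_apply, h4, smul_zero, Finset.sum_const_zero] at h6
      have h7 : D (2 : A) = 0 := by exact_mod_cast Derivation.map_natCast D 2
      rw [h6, v5, sub_zero, Derivation.leibniz, h7, smul_zero, add_zero, smul_eq_mul] at h5
      exact h2A _ h5
    · exact h2 j
  · have h1 : Module.finrank k (derivedSub k K) ≤ Module.finrank k (LinearMap.range (con x d σ s)) := by
      rw [← hsub]; exact Submodule.finrank_mono (derivedSub_le K)
    have h2 := LinearMap.finrank_range_le (con x d σ s)
    rw [← ha] at h2
    have h3 : p ^ r + 1 ≤ p ^ (r + 1) := by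
      have : 0 < p ^ r := Nat.pos_of_ne_zero (by positivity)
      rw [pow_succ]; nlinarith
    omega
  · intro h hK h0 hp l hl
    have hl' : cz p k l ≠ 0 := fun hz => hl (cz_inj (by rw [hz, map_zero]))
    have hhK := derivedSub_le K hK
    obtain ⟨f, rfl⟩ := (hmem h).1 hhK
    rw [derived_eig hhK hl', hsub]
    let θ : Module.End k A :=
      { toFun := fun g => cbr x d σ s f g
        map_add' := fun g g' => by simp [cbr]; ring
        map_smul' := fun c g => by simp [cbr, smul_sub] }
    have hθ : ∀ g, con x d σ s (θ g) = LieAlgebra.ad k _ (con x d σ s f) (con x d σ s g) := fun g =>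
      (T.con_lie hσ hs hs2 f g).symm
    have hθm : ∀ (m : ℕ) g, con x d σ s ((θ ^ m) g) = ((LieAlgebra.ad k _ (con x d σ s f)) ^ m) (con x d σ s g) := by
      intro m
      induction m with
      | zero => intro g; rfl
      | succ m ih =>
        intro g
        rw [pow_succ, pow_succ, Module.End.mul_apply, Module.End.mul_apply, ih, hθ]
    have hθp : θ ^ p = θ := by
      ext g
      apply hinj
      rw [hθm, ad_toral hp, hθ]
    have e3 := T.lemU' hp h0 θ (by
      intro a m
      show cbr x d σ s f (a * m) = con x d σ s f a * m + a * cbr x d σ s f m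
      rw [cbr, cbr, Derivation.leibniz]
      simp only [smul_eq_mul]; ring) hθp (by
      intro E
      refine ⟨E, fun a m => ?_⟩
      show E (a * m) = E a * m + a * E m
      rw [Derivation.leibniz, smul_eq_mul, smul_eq_mul]; ring) l
    have e1 := map_rank (con x d σ s) (θ.eigenspace (cz p k l))
    have e2 : (θ.eigenspace (cz p k l)) ⊓ LinearMap.ker (con x d σ s) = ⊥ := by
      rw [LinearMap.ker_eq_bot.2 hinj, inf_bot_eq]
    have e4 : (θ.eigenspace (cz p k l)).map (con x d σ s) =
        (LieAlgebra.ad k (Derivation k A A) (con x d σ s f)).eigenspace (cz p k l) ⊓ LinearMap.range (con x d σ s) := by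
      ext z
      constructor
      · rintro ⟨g, hg, rfl⟩
        refine ⟨?_, ⟨g, rfl⟩⟩
        rw [SetLike.mem_coe, Module.End.mem_eigenspace_iff, ← hθ, Module.End.mem_eigenspace_iff.1 hg, map_smul]
      · rintro ⟨h1, ⟨g, rfl⟩⟩
        rw [SetLike.mem_coe, Module.End.mem_eigenspace_iff, ← hθ, ← map_smul] at h1
        exact ⟨g, Module.End.mem_eigenspace_iff.2 (hinj h1), rfl⟩
    rw [e2, e4, finrank_bot, add_zero] at e1
    rw [e1]
    rw [← ha] at e3
    exact Nat.eq_of_mul_eq_mul_left (by omega) e3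
  · intro i
    refine Fin.cases hN (fun i => ?_) i
    have h1 := (derivedSub k K).smul_mem (- s (u i)) (hXY (u i))
    rw [v3, smul_smul, neg_mul_neg, hs2, one_smul] at h1
    exact h1
  · refine li_of_dual _ (Fin.cases ((2 : k)⁻¹ • coef x d ε none)
      (fun j => coef x d ε (some (u j)) - (2 : k)⁻¹ • coef x d ε none)) ?_
    have c0 : coef x d ε none (H 0) = 2 := by
      show ε (d none (H 0 (x none))) = _
      rw [H0, v5, Derivation.leibniz, T.dx, if_pos rfl]
      have h7 : d none (2 : A) = 0 := by exact_mod_cast Derivation.map_natCast (d none) 2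
      rw [h7]; simp [map_ofNat ε 2]
    have c1 : ∀ i, coef x d ε (some i) (H 0) = 1 := by
      intro i
      show ε (d (some i) (H 0 (x (some i)))) = _
      rw [H0, v4, T.dx, if_pos rfl, map_one]
    have c2 : ∀ i, coef x d ε none (H (Fin.succ i)) = 0 := by
      intro i
      show ε (d none (H (Fin.succ i) (x none))) = _
      rw [HS, Derivation.sub_apply, T.xd_x, T.xd_x]; simp
    have c3 : ∀ i j, coef x d ε (some (u j)) (H (Fin.succ i)) = if i = j then 1 else 0 := by
      intro i j
      show ε (d (some (u j)) (H (Fin.succ i) (x (some (u j))))) = _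
      rw [HS, Derivation.sub_apply, T.xd_x, T.xd_x,
        if_neg (fun h => hu' i j (Option.some.inj h) : ¬ (some (σ (u i)) = some (u j))), map_zero, zero_smul, sub_zero,
        Derivation.map_smul, T.dx]
      by_cases h : i = j
      · subst h; simp
      · rw [if_neg h, if_neg fun h' => h (hu _ _ (by simpa using h'))]; simp
    intro i j
    refine Fin.cases ?_ (fun i => ?_) i <;> refine Fin.cases ?_ (fun j => ?_) j
    · simp [c0, h2k]
    · simp [c0, c1, h2k, (Fin.succ_ne_zero j).symm]
    · simp [c2]
    · simp [c2, c3]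
  · intro i j
    exact T.diag_comm (fun l => (hdiag i l).imp' _ fun _ h => h) (fun l => (hdiag j l).imp' _ fun _ h => h)
  · intro i
    exact T.diag_toral (hdiag i)

end TA
end P3f


section P3g
set_option synthInstance.maxHeartbeats 1000000
set_option maxHeartbeats 1600000
set_option linter.unusedSectionVars false
variable {p : ℕ} [Fact p.Prime] {k : Type*} [Field k] [CharP k p]

theorem TA.reindex {ι κ : Type*} [Fintype ι] [DecidableEq ι] [Fintype κ] [DecidableEq κ] {A : Type*} [CommRing A]
    [Algebra k A] {x : ι → A} {d : ι → Derivation k A A} {ε : A →ₐ[k] k} (T : TA p x d ε) (e : κ ≃ ι) :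
    TA p (x ∘ e) (d ∘ e) ε where
  dx i j := by simp [T.dx]
  xp i := T.xp _
  gen := by rw [e.surjective.range_comp]; exact T.gen
  eps i := T.eps _

theorem TA.con_eq {ι : Type*} [Fintype ι] [DecidableEq ι] {A : Type*} [CommRing A] [Algebra k A] [IsAlgClosed k]
    {x : Option ι → A} {d : Option ι → Derivation k A A} {ε : A →ₐ[k] k} {σ : ι → ι} {s : ι → k}
    (hp3 : 3 < p) (T : TA p x d ε) (hσ : ∀ j, σ (σ j) = j) (hs : ∀ j, s (σ j) = - s j) (hs2 : ∀ j, s j * s j = 1) (f : A) :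
    TA.con x d σ s f = (∑ j, (x (some j) * d none f - s j • d (some (σ j)) f) • d (some j)) +
      (2 * f - ∑ j, x (some j) * d (some j) f) • d none := by
  refine T.dext fun i => ?_
  rw [Derivation.add_apply, der_sum]
  rcases i with _ | i
  · rw [T.con_n f hσ hs hs2]
    have h1 : ∑ j, x (some j) * (s j • x (some (σ j)) * d none f) = - ∑ j, x (some j) * (s j • x (some (σ j)) * d none f) := by
      rw [← Finset.sum_neg_distrib]
      refine Fintype.sum_equiv ⟨σ, σ, hσ, hσ⟩ _ _ fun j => ?_
      show _ = - (x (some (σ j)) * (s (σ j) • x (some (σ (σ j))) * d none f))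
      rw [hσ, hs]
      simp [Algebra.smul_def]; ring
    have h2 : ∑ j, x (some j) * TA.Yf x d σ s j f = ∑ j, x (some j) * d (some j) f +
        ∑ j, x (some j) * (s j • x (some (σ j)) * d none f) := by
      rw [← Finset.sum_add_distrib]
      refine Finset.sum_congr rfl fun j _ => ?_
      rw [TA.Yf, Derivation.add_apply, Derivation.smul_apply, mul_add, smul_eq_mul]
    have h3 : ∑ j, x (some j) * (s j • x (some (σ j)) * d none f) = 0 := by
      have h2k : (2 : k) ≠ 0 := by
        intro hz
        have hz' : ((2 : ℕ) : k) = 0 := by exact_mod_cast hz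
        rw [CharP.cast_eq_zero_iff k p] at hz'
        exact absurd (Nat.le_of_dvd (by norm_num) hz') (by omega)
      rw [eq_neg_iff_add_eq_zero, ← two_smul k] at h1
      exact (smul_eq_zero.1 h1).resolve_left h2k
    rw [h2, h3]
    simp [T.dx]
  · have h3 : algebraMap k A (s i) * algebraMap k A (s i) = 1 := by rw [← map_mul, hs2, map_one]
    rw [T.con_x hσ hs, Finset.sum_eq_single i]
    · simp [T.dx, TA.Yf, hσ, hs, Algebra.smul_def]
      linear_combination (x (some i) * d none f) * h3
    · intro j _ hj
      simp [T.dx, hj]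
    · simp

/-- sign -/
def sg (k : Type*) [Field k] (r : ℕ) : Fin r ⊕ Fin r → k := Sum.elim (fun _ => 1) (fun _ => -1)

/-- index -/
def eH (r : ℕ) : Fin r ⊕ Fin r ≃ Fin (2 * r) :=
  finSumFinEquiv.trans (finCongr (two_mul r).symm)

theorem eH_l (r : ℕ) (i : Fin r) : eH r (Sum.inl i) = ⟨i.1, by have := i.isLt; omega⟩ := by
  apply Fin.ext; simp [eH]

theorem eH_r (r : ℕ) (i : Fin r) : eH r (Sum.inr i) = ⟨i.1 + r, by have := i.isLt; omega⟩ := by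
  apply Fin.ext; simp [eH, add_comm]

/-- index -/
def eK (r : ℕ) : Option (Fin r ⊕ Fin r) ≃ Fin (2 * r + 1) :=
  (Equiv.optionCongr (eH r)).trans finSuccEquivLast.symm

theorem eK_n (r : ℕ) : eK r none = Fin.last (2 * r) := by simp [eK]

theorem eK_s (r : ℕ) (i : Fin r ⊕ Fin r) : eK r (some i) = Fin.castSucc (eH r i) := by simp [eK]

variable [IsAlgClosed k]

section
variable {A : Type*} [CommRing A] [Algebra k A]

theorem ham_eq {r : ℕ} (d : Fin (2 * r) → Derivation k A A) (f : A) :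
    ∑ i : Fin r, (d ⟨i.1, by have := i.isLt; omega⟩ f • d ⟨i.1 + r, by have := i.isLt; omega⟩
      - d ⟨i.1 + r, by have := i.isLt; omega⟩ f • d ⟨i.1, by have := i.isLt; omega⟩) =
    TA.ham (d ∘ eH r) Sum.swap (sg k r) f := by
  show _ = ∑ j : Fin r ⊕ Fin r, sg k r j • (d (eH r j) f • d (eH r (Sum.swap j)))
  rw [Fintype.sum_sum_type, Finset.sum_sub_distrib, sub_eq_add_neg, ← Finset.sum_neg_distrib]
  congr 1
  · refine Finset.sum_congr rfl fun i _ => ?_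
    simp [sg, eH_l, eH_r]
  · refine Finset.sum_congr rfl fun i _ => ?_
    simp [sg, eH_l, eH_r]

theorem con_eq' (hp3 : 3 < p) {r : ℕ} {x : Fin (2 * r + 1) → A} {d : Fin (2 * r + 1) → Derivation k A A}
    {ε : A →ₐ[k] k} (T : TA p x d ε) (f : A) :
    (∑ i : Fin r,
    ((x ⟨i.1, by have := i.isLt; omega⟩ *
        d (Fin.last (2 * r)) f
      - d ⟨i.1 + r, by have := i.isLt; omega⟩ f) •
        d ⟨i.1, by have := i.isLt; omega⟩
    + (x ⟨i.1 + r, by have := i.isLt; omega⟩ *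
        d (Fin.last (2 * r)) f
      + d ⟨i.1, by have := i.isLt; omega⟩ f) •
        d ⟨i.1 + r, by have := i.isLt; omega⟩))
  + ((2 : A) * f
      - ∑ i : Fin (2 * r), x ⟨i.1, by have := i.isLt; omega⟩ *
          d ⟨i.1, by have := i.isLt; omega⟩ f) •
      d (Fin.last (2 * r)) = TA.con (x ∘ eK r) (d ∘ eK r) Sum.swap (sg k r) f := by
  have hsg : ∀ (j : Fin r ⊕ Fin r), sg k r (Sum.swap j) = - sg k r j := by
    rintro (j | j) <;> simp [sg]
  have hsg2 : ∀ (j : Fin r ⊕ Fin r), sg k r j * sg k r j = 1 := by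
    rintro (j | j) <;> simp [sg]
  rw [(T.reindex (eK r)).con_eq hp3 (fun j => Sum.swap_swap j) hsg hsg2, Finset.sum_add_distrib, Fintype.sum_sum_type]
  have e3 : ∀ g : Fin (2 * r) → A, ∑ i, g i = ∑ i, g (eH r i) := fun g =>
    (Equiv.sum_comp (eH r) g).symm
  rw [e3]
  have e4 : ∀ j : Fin r ⊕ Fin r, eK r (some j) = ⟨(eH r j).1, by have := (eH r j).isLt; omega⟩ := by
    intro i; rw [eK_s]; rfl
  simp only [Function.comp, e4, eK_n]
  congr 1
  congr 1
  · refine Finset.sum_congr rfl fun i _ => ?_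
    simp [sg, eH_l, eH_r]
  · refine Finset.sum_congr rfl fun i _ => ?_
    simp [sg, eH_l, eH_r]
end

theorem good_cartan (hp3 : 3 < p) {L : Type*} [LieRing L] [LieAlgebra k L] [FiniteDimensional k L] (h : IsCartanTypeSimple p k L) :
    GoodData p k L := by
  have hsw : ∀ (r : ℕ) (j : Fin r ⊕ Fin r), Sum.swap (Sum.swap j) = j := fun r j => Sum.swap_swap j
  have hsg : ∀ (r : ℕ) (j : Fin r ⊕ Fin r), sg k r (Sum.swap j) = - sg k r j := by
    rintro r (j | j) <;> simp [sg]
  have hsg2 : ∀ (r : ℕ) (j : Fin r ⊕ Fin r), sg k r j * sg k r j = 1 := by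
    rintro r (j | j) <;> simp [sg]
  have hcd : ∀ r : ℕ, Fintype.card (Fin r ⊕ Fin r) = 2 * r := by intro r; simp; omega
  rcases h with ⟨n, hn, ⟨e⟩⟩ | ⟨n, hn, ⟨e⟩⟩ | ⟨r, hr, ⟨e⟩⟩ | ⟨r, hr, ⟨e⟩⟩
  · obtain ⟨ε, T⟩ := trunc_TA (p := p) (k := k) n
    exact GoodData.of_equiv (e.trans LieSubalgebra.topEquiv.symm) (T.good_W n hn (Equiv.refl _))
  · obtain ⟨ε, T⟩ := trunc_TA (p := p) (k := k) n
    obtain ⟨m, rfl⟩ : ∃ m, n = m + 1 := ⟨n - 1, by omega⟩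
    exact GoodData.of_equiv e (T.good_S (by omega) hp3)
  · obtain ⟨ε, T⟩ := trunc_TA (p := p) (k := k) (2 * r)
    refine GoodData.of_equiv e ?_
    have T' := T.reindex (eH r)
    have h1 : DH p k r = TA.ham (truncPD p k (2 * r) ∘ eH r) Sum.swap (sg k r) := by
      funext f
      exact ham_eq (truncPD p k (2 * r)) f
    have h2 := T'.good_H (σ := Sum.swap) (s := sg k r) (hsw r) (hsg r) (hsg2 r) hr (hcd r) hp3 Sum.inl
      (fun i j h => Sum.inl.inj h) (fun i j => by simp)
    rw [← h1] at h2
    exact h2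
  · obtain ⟨ε, T⟩ := trunc_TA (p := p) (k := k) (2 * r + 1)
    refine GoodData.of_equiv e ?_
    have T' := T.reindex (eK r)
    have h1 : DK p k r = TA.con (truncX p k (2 * r + 1) ∘ eK r) (truncPD p k (2 * r + 1) ∘ eK r) Sum.swap (sg k r) := by
      funext f
      exact con_eq' hp3 T f
    have h2 := T'.good_K (σ := Sum.swap) (s := sg k r) (hsw r) (hsg r) (hsg2 r) (hcd r) hp3 Sum.inl
      (fun i j h => Sum.inl.inj h) (fun i j => by simp)
    rw [← h1] at h2
    exact h2

end P3g


section P4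
set_option linter.unusedSectionVars false
instance fact5 : Fact (Nat.Prime 5) := ⟨by norm_num⟩

variable {k : Type*} [Field k] [CharP k 5] [IsAlgClosed k] {A : Type*} [CommRing A] [Algebra k A]
variable {x : Fin 2 → A} {d : Fin 2 → Derivation k A A} {ε : A →ₐ[k] k}

/-- the space of the Melikian algebra -/
abbrev MS (k A : Type*) [Field k] [CommRing A] [Algebra k A] :=
  Derivation k A A × A × Derivation k A A

/-- the Melikian bracket -/
noncomputable def mbr (x : Fin 2 → A) (d : Fin 2 → Derivation k A A) (u v : MS k A) : MS k A :=
  (⁅u.1, v.1⁆ + u.2.1 • v.2.2 - v.2.1 • u.2.2,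
   u.1 v.2.1 - v.1 u.2.1 - (2 : A) * TA.dv x d u.1 * v.2.1 + (2 : A) * TA.dv x d v.1 * u.2.1
     + (u.2.2 (x 0) * v.2.2 (x 1) - u.2.2 (x 1) * v.2.2 (x 0)),
   ⁅u.1, v.2.2⁆ + ((2 : A) * TA.dv x d u.1) • v.2.2 - ⁅v.1, u.2.2⁆ - ((2 : A) * TA.dv x d v.1) • u.2.2
     + ((2 : A) * (v.2.1 * d 1 u.2.1 - u.2.1 * d 1 v.2.1)) • d 0
     + ((2 : A) * (u.2.1 * d 0 v.2.1 - v.2.1 * d 0 u.2.1)) • d 1)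

theorem mext {u v : MS k A} (h1 : ∀ a, u.1 a = v.1 a) (h2 : u.2.1 = v.2.1) (h3 : ∀ a, u.2.2 a = v.2.2 a) : u = v :=
  Prod.ext (Derivation.ext h1) (Prod.ext h2 (Derivation.ext h3))

theorem br1 (u v : MS k A) (a : A) : (mbr x d u v).1 a =
    u.1 (v.1 a) - v.1 (u.1 a) + u.2.1 * v.2.2 a - v.2.1 * u.2.2 a := by
  simp [mbr, Derivation.commutator_apply]

theorem br2 (u v : MS k A) : (mbr x d u v).2.1 =
   u.1 v.2.1 - v.1 u.2.1 - (2 : A) * TA.dv x d u.1 * v.2.1 + (2 : A) * TA.dv x d v.1 * u.2.1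
     + (u.2.2 (x 0) * v.2.2 (x 1) - u.2.2 (x 1) * v.2.2 (x 0)) := rfl

theorem br3 (u v : MS k A) (a : A) : (mbr x d u v).2.2 a =
    u.1 (v.2.2 a) - v.2.2 (u.1 a) + 2 * TA.dv x d u.1 * v.2.2 a - (v.1 (u.2.2 a) - u.2.2 (v.1 a))
     - 2 * TA.dv x d v.1 * u.2.2 a + 2 * (v.2.1 * d 1 u.2.1 - u.2.1 * d 1 v.2.1) * d 0 a
     + 2 * (u.2.1 * d 0 v.2.1 - v.2.1 * d 0 u.2.1) * d 1 a := by
  simp [mbr, Derivation.commutator_apply]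

/-- the adjoint action -/
noncomputable def mB (x : Fin 2 → A) (d : Fin 2 → Derivation k A A) : MS k A →ₗ[k] Module.End k (MS k A) :=
  LinearMap.mk₂ k (mbr x d)
    (fun u u' v => by
      refine mext (fun a => ?_) ?_ (fun a => ?_)
      · simp only [br1, Prod.fst_add, Prod.snd_add, Derivation.add_apply, map_add]; ring
      · simp only [br2, Prod.fst_add, Prod.snd_add, Derivation.add_apply, map_add]; ring
      · simp only [br3, Prod.fst_add, Prod.snd_add, Derivation.add_apply, map_add]; ring)
    (fun c u v => by
      refine mext (fun a => ?_) ?_ (fun a => ?_)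
      · simp only [br1, Prod.smul_fst, Prod.smul_snd, Derivation.smul_apply, map_smul, Derivation.map_smul]
        simp only [Algebra.smul_def]; ring
      · simp only [br2, Prod.smul_fst, Prod.smul_snd, Derivation.smul_apply, map_smul, Derivation.map_smul]
        simp only [Algebra.smul_def]; ring
      · simp only [br3, Prod.smul_fst, Prod.smul_snd, Derivation.smul_apply, map_smul, Derivation.map_smul]
        simp only [Algebra.smul_def]; ring)
    (fun u v v' => by
      refine mext (fun a => ?_) ?_ (fun a => ?_)
      · simp only [br1, Prod.fst_add, Prod.snd_add, Derivation.add_apply, map_add]; ring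
      · simp only [br2, Prod.fst_add, Prod.snd_add, Derivation.add_apply, map_add]; ring
      · simp only [br3, Prod.fst_add, Prod.snd_add, Derivation.add_apply, map_add]; ring)
    (fun c u v => by
      refine mext (fun a => ?_) ?_ (fun a => ?_)
      · simp only [br1, Prod.smul_fst, Prod.smul_snd, Derivation.smul_apply, map_smul, Derivation.map_smul]
        simp only [Algebra.smul_def]; ring
      · simp only [br2, Prod.smul_fst, Prod.smul_snd, Derivation.smul_apply, map_smul, Derivation.map_smul]
        simp only [Algebra.smul_def]; ring
      · simp only [br3, Prod.smul_fst, Prod.smul_snd, Derivation.smul_apply, map_smul, Derivation.map_smul]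
        simp only [Algebra.smul_def]; ring)

theorem mB_apply (u v : MS k A) : mB x d u v = mbr x d u v := rfl

/-- abstract properties of the bracket coming from the Lie algebra -/
structure MH (x : Fin 2 → A) (d : Fin 2 → Derivation k A A) : Prop where
  jac : ∀ u v, mB x d (mB x d u v) = mB x d u * mB x d v - mB x d v * mB x d u
  anti : ∀ u v, mB x d u v = - mB x d v u
  simple : ∀ I : Submodule k (MS k A), (∀ u, ∀ v ∈ I, mB x d u v ∈ I) → I = ⊥ ∨ I = ⊤
  faith : ∀ u, mB x d u = 0 → u = 0

/-- the filtration -/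
noncomputable def Psi (x : Fin 2 → A) (ε : A →ₐ[k] k) (n : ℕ) : Submodule k (MS k A) where
  carrier := {u | (∀ i, u.1 (x i) ∈ RingHom.ker ε ^ ((n + 2) / 3)) ∧ u.2.1 ∈ RingHom.ker ε ^ ((n + 1) / 3) ∧
    ∀ i, u.2.2 (x i) ∈ RingHom.ker ε ^ (n / 3)}
  add_mem' := fun {u v} hu hv => ⟨fun i => Ideal.add_mem _ (hu.1 i) (hv.1 i), Ideal.add_mem _ hu.2.1 hv.2.1,
    fun i => Ideal.add_mem _ (hu.2.2 i) (hv.2.2 i)⟩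
  zero_mem' := ⟨fun i => Ideal.zero_mem _, Ideal.zero_mem _, fun i => Ideal.zero_mem _⟩
  smul_mem' := fun c u hu => ⟨fun i => Submodule.smul_of_tower_mem _ c (hu.1 i), Submodule.smul_of_tower_mem _ c hu.2.1,
    fun i => Submodule.smul_of_tower_mem _ c (hu.2.2 i)⟩

theorem mem_Psi {n : ℕ} {u : MS k A} : u ∈ Psi x ε n ↔ (∀ i, u.1 (x i) ∈ RingHom.ker ε ^ ((n + 2) / 3)) ∧
    u.2.1 ∈ RingHom.ker ε ^ ((n + 1) / 3) ∧ ∀ i, u.2.2 (x i) ∈ RingHom.ker ε ^ (n / 3) := Iff.rfl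

theorem ile {I : Ideal A} {m n : ℕ} (h : m ≤ n) {a : A} (ha : a ∈ I ^ n) : a ∈ I ^ m := Ideal.pow_le_pow_right h ha

theorem imul {I : Ideal A} {m n s : ℕ} (h : s ≤ m + n) {a b : A} (ha : a ∈ I ^ m) (hb : b ∈ I ^ n) : a * b ∈ I ^ s :=
  ile h (by rw [pow_add]; exact Ideal.mul_mem_mul ha hb)

theorem Psi_anti {m n : ℕ} (h : m ≤ n) : Psi x ε n ≤ Psi (k := k) x ε m := fun u hu =>
  ⟨fun i => ile (by omega) (hu.1 i), ile (by omega) hu.2.1, fun i => ile (by omega) (hu.2.2 i)⟩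

theorem Psi_zero : Psi x ε 0 = (⊤ : Submodule k (MS k A)) := by
  rw [eq_top_iff]; intro u _
  simp [mem_Psi]

theorem der_pow (I : Ideal A) (D : Derivation k A A) (n : ℕ) {a : A} (ha : a ∈ I ^ n) : D a ∈ I ^ (n - 1) := by
  induction n generalizing a with
  | zero => simp
  | succ n ih =>
    rw [pow_succ'] at ha
    induction ha using Submodule.mul_induction_on' with
    | mem_mul_mem b hb c hc =>
      rw [Derivation.leibniz, smul_eq_mul, smul_eq_mul]
      refine Ideal.add_mem _ ?_ ?_
      · exact imul (m := 1) (n := n - 1) (by omega) (by simpa using hb) (ih hc)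
      · exact Ideal.mul_mem_right _ _ (by simpa using hc)
    | add b _ c _ hb hc => rw [map_add]; exact Ideal.add_mem _ hb hc

theorem TA.der_ap (T : TA 5 x d ε) (E : Derivation k A A) (a : A) : E a = E (x 0) * d 0 a + E (x 1) * d 1 a := by
  conv_lhs => rw [T.decomp E]
  rw [der_sum, Fin.sum_univ_two]; rfl

theorem TA.dv2 (E : Derivation k A A) : TA.dv x d E = d 0 (E (x 0)) + d 1 (E (x 1)) := by
  rw [TA.dv_apply, Fin.sum_univ_two]

theorem TA.der_fil (T : TA 5 x d ε) {I : Ideal A} {s t r : ℕ} {E : Derivation k A A} (hE : ∀ i, E (x i) ∈ I ^ s) {a : A}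
    (ha : a ∈ I ^ t) (h : r + 1 ≤ s + t ∨ (t = 0 ∧ r ≤ s)) : E a ∈ I ^ r := by
  rw [T.der_ap]
  exact Ideal.add_mem _ (imul (by omega) (hE 0) (der_pow I (d 0) t ha)) (imul (by omega) (hE 1) (der_pow I (d 1) t ha))

theorem TA.dv_fil {I : Ideal A} {s r : ℕ} {E : Derivation k A A} (hE : ∀ i, E (x i) ∈ I ^ s)
    (h : r ≤ s - 1) : TA.dv x d E ∈ I ^ r := by
  rw [TA.dv2]
  exact Ideal.add_mem _ (ile h (der_pow I (d 0) s (hE 0))) (ile h (der_pow I (d 1) s (hE 1)))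

theorem TA.mbr_fil (T : TA 5 x d ε) {a b n : ℕ} (hn : n + 3 ≤ a + b ∨ n = 0) {u v : MS k A} (hu : u ∈ Psi x ε a) (hv : v ∈ Psi x ε b) :
    mbr x d u v ∈ Psi x ε n := by
  rcases hn with hn | rfl
  swap
  · rw [Psi_zero]; trivial
  obtain ⟨u1, u2, u3⟩ := hu
  obtain ⟨v1, v2, v3⟩ := hv
  have hdu := TA.dv_fil (d := d) (r := (a + 2) / 3 - 1) u1 le_rfl
  have hdv := TA.dv_fil (d := d) (r := (b + 2) / 3 - 1) v1 le_rfl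
  refine ⟨fun i => ?_, ?_, fun i => ?_⟩
  · rw [br1]
    exact Ideal.sub_mem _ (Ideal.add_mem _ (Ideal.sub_mem _ (T.der_fil u1 (v1 i) (by omega)) (T.der_fil v1 (u1 i) (by omega)))
      (imul (by omega) u2 (v3 i))) (imul (by omega) v2 (u3 i))
  · rw [br2]
    refine Ideal.add_mem _ (Ideal.add_mem _ (Ideal.sub_mem _ (Ideal.sub_mem _ (T.der_fil u1 v2 (by omega)) (T.der_fil v1 u2 (by omega))) ?_) ?_)
      (Ideal.sub_mem _ (imul (by omega) (u3 0) (v3 1)) (imul (by omega) (u3 1) (v3 0)))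
    · exact imul (by omega) (Ideal.mul_mem_left _ _ hdu) v2
    · exact imul (by omega) (Ideal.mul_mem_left _ _ hdv) u2
  · rw [br3]
    refine Ideal.add_mem _ (Ideal.add_mem _ (Ideal.sub_mem _ (Ideal.sub_mem _ (Ideal.add_mem _ (Ideal.sub_mem _ (T.der_fil u1 (v3 i) ?_)
      (T.der_fil v3 (u1 i) ?_)) ?_) (Ideal.sub_mem _ (T.der_fil v1 (u3 i) ?_) (T.der_fil u3 (v1 i) ?_))) ?_) ?_) ?_
    · omega
    · omega
    · exact imul (by omega) (Ideal.mul_mem_left _ _ hdu) (v3 i)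
    · omega
    · omega
    · exact imul (by omega) (Ideal.mul_mem_left _ _ hdv) (u3 i)
    · refine Ideal.mul_mem_right _ _ (Ideal.mul_mem_left _ _ (Ideal.sub_mem _ ?_ ?_))
      · exact imul (by omega) v2 (der_pow _ (d 1) _ u2)
      · exact imul (by omega) u2 (der_pow _ (d 1) _ v2)
    · refine Ideal.mul_mem_right _ _ (Ideal.mul_mem_left _ _ (Ideal.sub_mem _ ?_ ?_))
      · exact imul (by omega) u2 (der_pow _ (d 0) _ v2)
      · exact imul (by omega) v2 (der_pow _ (d 0) _ u2)

theorem TA.Psi_bot (T : TA 5 x d ε) : ∃ N : ℕ, Psi x ε N = (⊥ : Submodule k (MS k A)) := by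
  obtain ⟨n, hn⟩ := T.nilp
  refine ⟨3 * n, ?_⟩
  rw [eq_bot_iff]
  rintro u ⟨h1, h2, h3⟩
  have e0 : ∀ m, n ≤ m → ∀ a : A, a ∈ RingHom.ker ε ^ m → a = 0 := by
    intro m hm a ha
    have := ile hm ha
    rw [hn] at this; exact this
  have e1 : u.1 = 0 := T.dext fun i => e0 _ (by omega) _ (h1 i)
  have e3 : u.2.2 = 0 := T.dext fun i => e0 _ (by omega) _ (h3 i)
  exact Prod.ext e1 (Prod.ext (e0 _ (by omega) _ h2) e3)

/-- operators of filtration degree at least `t` -/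
def Rz (x : Fin 2 → A) (ε : A →ₐ[k] k) (t : ℤ) (P : Module.End k (MS k A)) : Prop :=
  ∀ n m : ℕ, (m : ℤ) ≤ n + t → ∀ v ∈ Psi x ε n, P v ∈ Psi x ε m

theorem Rz.add {t : ℤ} {P Q : Module.End k (MS k A)} (hP : Rz x ε t P) (hQ : Rz x ε t Q) : Rz x ε t (P + Q) :=
  fun n m h v hv => Submodule.add_mem _ (hP n m h v hv) (hQ n m h v hv)

theorem Rz.smul {t : ℤ} {P : Module.End k (MS k A)} (hP : Rz x ε t P) (c : k) : Rz x ε t (c • P) :=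
  fun n m h v hv => Submodule.smul_mem _ c (hP n m h v hv)

theorem Rz.neg {t : ℤ} {P : Module.End k (MS k A)} (hP : Rz x ε t P) : Rz x ε t (-P) :=
  fun n m h v hv => Submodule.neg_mem _ (hP n m h v hv)

theorem Rz.sub {t : ℤ} {P Q : Module.End k (MS k A)} (hP : Rz x ε t P) (hQ : Rz x ε t Q) : Rz x ε t (P - Q) := by
  rw [sub_eq_add_neg]; exact hP.add hQ.neg

theorem Rz.mono {s t : ℤ} {P : Module.End k (MS k A)} (hP : Rz x ε t P) (h : s ≤ t) : Rz x ε s P :=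
  fun n m hm v hv => hP n m (by omega) v hv

theorem Rz.mul {s t r : ℤ} {P Q : Module.End k (MS k A)} (hP : Rz x ε s P) (hQ : Rz x ε t Q) (h : r ≤ s + t) : Rz x ε r (P * Q) := by
  intro n m hm v hv
  rw [Module.End.mul_apply]
  rcases le_or_gt 0 ((n : ℤ) + t) with h0 | h0
  · exact hP (n + t).toNat m (by omega) _ (hQ n _ (by omega) v hv)
  · exact hP 0 m (by omega) _ (by rw [Psi_zero]; trivial)

theorem Rz.one : Rz x ε 0 (1 : Module.End k (MS k A)) := fun n m h v hv => Psi_anti (by omega) hv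

theorem Rz.zero (t : ℤ) : Rz x ε t (0 : Module.End k (MS k A)) := fun n m h v hv => Submodule.zero_mem _

theorem TA.Rz_mB (T : TA 5 x d ε) {a : ℕ} {u : MS k A} (hu : u ∈ Psi x ε a) : Rz x ε (a - 3) (mB x d u) := by
  intro n m h v hv
  exact T.mbr_fil (by omega) hu hv

end P4


section P4b
set_option linter.unusedSectionVars false
variable {k : Type*} [Field k] [CharP k 5] [IsAlgClosed k] {A : Type*} [CommRing A] [Algebra k A]
variable {x : Fin 2 → A} {d : Fin 2 → Derivation k A A} {ε : A →ₐ[k] k}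

theorem TA.zero_of (T : TA 5 x d ε) {v : MS k A} (h : ∀ n, v ∈ Psi x ε n → v ∈ Psi x ε (n + 1)) : v = 0 := by
  obtain ⟨N, hN⟩ := T.Psi_bot
  have : ∀ n, v ∈ Psi x ε n := by
    intro n
    induction n with
    | zero => rw [Psi_zero]; trivial
    | succ n ih => exact h n ih
  have := this N
  rw [hN] at this; exact this

theorem TA.Rz_inj (T : TA 5 x d ε) {R : Module.End k (MS k A)} (hR : Rz x ε 1 R) {v : MS k A} (h : v + R v = 0) : v = 0 := by
  refine T.zero_of fun n hn => ?_
  rw [eq_neg_of_add_eq_zero_left h]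
  exact Submodule.neg_mem _ (hR n (n + 1) (by push_cast; omega) v hn)

theorem Rz.pow {s : ℤ} {Y : Module.End k (MS k A)} (hY : Rz x ε s Y) (n : ℕ) : Rz x ε (n * s) (Y ^ n) := by
  induction n with
  | zero => simpa using Rz.one
  | succ n ih => rw [pow_succ]; exact ih.mul hY (by push_cast; linarith)

theorem TA.Rz_nil (T : TA 5 x d ε) {R : Module.End k (MS k A)} (hR : Rz x ε 1 R) : IsNilpotent R := by
  obtain ⟨N, hN⟩ := T.Psi_bot
  refine ⟨N, LinearMap.ext fun v => ?_⟩
  have := hR.pow N 0 N (by push_cast; omega) v (by rw [Psi_zero]; trivial)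
  rw [hN] at this; exact this

theorem Rz.pow_sub {s : ℤ} {X Y : Module.End k (MS k A)} (hY : Rz x ε s Y) (hR : Rz x ε (s + 1) (X - Y)) (n : ℕ) :
    Rz x ε (n * s + 1) (X ^ n - Y ^ n) := by
  have hX : Rz x ε s X := by
    have := (hR.mono (s := s) (by omega)).add hY
    simpa using this
  induction n with
  | zero => simpa using Rz.zero _
  | succ n ih =>
    have : X ^ (n + 1) - Y ^ (n + 1) = (X ^ n - Y ^ n) * X + Y ^ n * (X - Y) := by
      rw [pow_succ, pow_succ, sub_mul, mul_sub]; abel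
    rw [this]
    exact (ih.mul hX (by push_cast; linarith)).add ((hY.pow n).mul hR (by push_cast; linarith))

theorem Rz.Pj {s : ℤ} (hs : s ≤ -1) {X Y : Module.End k (MS k A)} (hY : Rz x ε s Y) (hR : Rz x ε (s + 1) (X - Y)) (a : k) :
    Rz x ε (4 * s + 1) (Pj 5 X a + Y ^ 4) := by
  have h1 : Rz x ε (s + 1) ((X - a • (1 : Module.End k (MS k A))) - Y) := by
    have := hR.sub ((Rz.one.smul a).mono (s := s + 1) (by omega))
    have e : (X - a • (1 : Module.End k (MS k A))) - Y = X - Y - a • 1 := by abel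
    rw [e]; exact this
  have h2 := hY.pow_sub h1 4
  have e : _root_.Pj 5 X a + Y ^ 4 = 1 - ((X - a • (1 : Module.End k (MS k A))) ^ 4 - Y ^ 4) := by
    rw [_root_.Pj]; abel
  rw [e]
  exact (Rz.one.mono (by omega)).sub (by simpa using h2)

theorem rank_Pj {M : Type*} [AddCommGroup M] [Module k M] [FiniteDimensional k M] {X : Module.End k M} (hX : X ^ 5 = X) (l : ZMod 5)
    (V : Submodule k M) (h : ∀ v ∈ V, Pj 5 X (cz 5 k l) v = 0 → v = 0) :
    Module.finrank k V ≤ Module.finrank k (X.eigenspace (cz 5 k l)) := by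
  have h1 := map_rank (Pj 5 X (cz 5 k l)) V
  have h2 : (V ⊓ LinearMap.ker (Pj 5 X (cz 5 k l)) : Submodule k M) = ⊥ := by
    rw [eq_bot_iff]; rintro v ⟨hv, hv'⟩; exact h v hv hv'
  rw [h2, finrank_bot, add_zero] at h1
  rw [← h1]
  refine Submodule.finrank_mono ?_
  rintro _ ⟨v, _, rfl⟩
  rw [Module.End.mem_eigenspace_iff]; exact Pj_mem hX l v

theorem TA.symb (T : TA 5 x d ε) [FiniteDimensional k (MS k A)] {s : ℤ} (hs : s ≤ -1) {X Y Q : Module.End k (MS k A)} (hX : X ^ 5 = X)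
    (hY : Rz x ε s Y) (hR : Rz x ε (s + 1) (X - Y)) (hQ : Rz x ε (-4 * s) Q) (V : Submodule k (MS k A))
    (hV : ∀ v ∈ V, Q ((Y ^ 4) v) = - v) (l : ZMod 5) :
    Module.finrank k V ≤ Module.finrank k (X.eigenspace (cz 5 k l)) := by
  refine rank_Pj hX l V fun v hv h0 => ?_
  refine T.Rz_inj (hQ.mul (Rz.Pj hs hY hR (cz 5 k l)) (r := 1) (by linarith)) ?_
  rw [Module.End.mul_apply, LinearMap.add_apply, h0, zero_add, hV v hv, add_neg_cancel]

theorem TA.all25 (T : TA 5 x d ε) [FiniteDimensional k (MS k A)] (h125 : Module.finrank k (MS k A) = 125)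
    {X : Module.End k (MS k A)} (hX : X ^ 5 = X)
    (h : ∀ l : ZMod 5, 25 ≤ Module.finrank k (X.eigenspace (cz 5 k l))) (l : ZMod 5) :
    Module.finrank k (X.eigenspace (cz 5 k l)) = 25 := by
  have h1 := sum_eig hX
  rw [h125] at h1
  have h2 : ∑ l : ZMod 5, 25 = ∑ l : ZMod 5, Module.finrank k (X.eigenspace (cz 5 k l)) := by
    rw [h1]; simp
  exact ((Finset.sum_eq_sum_iff_of_le fun l _ => h l).1 h2 l (Finset.mem_univ l)).symm

theorem TA.pow4 (T : TA 5 x d ε) (i : Fin 2) : ε (d i (d i (d i (d i (x i ^ 4))))) = -1 := by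
  have h5 : (5 : k) = 0 := by exact_mod_cast CharP.cast_eq_zero k 5
  have h : ∀ n : ℕ, d i (x i ^ (n + 1)) = ((n + 1 : ℕ) : k) • x i ^ n := by
    intro n
    rw [Derivation.leibniz_pow, T.dx, if_pos rfl, Nat.cast_smul_eq_nsmul]; simp
  simp only [h 3, h 2, h 1, h 0, Derivation.map_smul]
  simp only [map_smul, pow_zero, map_one, smul_eq_mul, mul_one]
  push_cast
  linear_combination 5 * h5

theorem TA.finA (T : TA 5 x d ε) : Module.finrank k A = 25 := by
  have := T.fin
  have hle := T.finrank_le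
  have h0 : ∀ j : Fin 2, ((x j • d j : Derivation k A A) : Module.End k A) ^ 5 = (x j • d j : Derivation k A A) :=
    fun j => T.diag_toral fun i => ⟨_, T.xd_x j i⟩
  have h1 := T.eigA (h0 0) (T.xd_ne 0) 0
  have hli : LinearIndependent k (fun j : Fin 5 => x 1 ^ (j : ℕ)) := by
    refine Module.End.eigenvectors_linearIndependent' ((x 1 • d 1 : Derivation k A A) : Module.End k A)
      (fun j : Fin 5 => ((j : ℕ) : k)) ?_ _ ?_
    · intro i j hij
      have := (CharP.natCast_eq_natCast k 5).1 hij
      exact Fin.ext (Nat.ModEq.eq_of_lt_of_lt this i.2 j.2)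
    · intro j
      refine ⟨?_, ?_⟩
      · rw [Module.End.mem_eigenspace_iff]
        show (x 1 • d 1 : Derivation k A A) (x 1 ^ (j : ℕ)) = _
        rw [Derivation.leibniz_pow]
        simp [T.dx]
        rcases Nat.eq_zero_or_pos (j : ℕ) with h | h
        · rw [h]; simp
        · rw [← pow_succ, Nat.sub_add_cancel h, Nat.cast_smul_eq_nsmul, nsmul_eq_mul]
      · intro h
        have h4 : x 1 ^ 4 = 0 := by
          have : x 1 ^ 4 = x 1 ^ (j : ℕ) * x 1 ^ (4 - (j : ℕ)) := by rw [← pow_add]; congr 1; omega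
          rw [this, h, zero_mul]
        have := T.pow4 1
        rw [h4] at this
        simp at this
  have h2 : 5 ≤ Module.finrank k (Module.End.eigenspace ((x 0 • d 0 : Derivation k A A) : Module.End k A) (cz 5 k 0)) := by
    have hs : Submodule.span k (Set.range fun j : Fin 5 => x 1 ^ (j : ℕ)) ≤
        Module.End.eigenspace ((x 0 • d 0 : Derivation k A A) : Module.End k A) (cz 5 k 0) := by
      rw [Submodule.span_le]
      rintro _ ⟨j, rfl⟩
      rw [SetLike.mem_coe, Module.End.mem_eigenspace_iff]
      show (x 0 • d 0 : Derivation k A A) (x 1 ^ (j : ℕ)) = _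
      rw [Derivation.leibniz_pow]
      simp [T.dx]
    have := Submodule.finrank_mono hs
    rw [finrank_span_eq_card hli] at this
    simpa using this
  simp at hle
  omega

theorem TA.finMS (T : TA 5 x d ε) : FiniteDimensional k (MS k A) := by
  have := T.fin
  have := T.wfin
  infer_instance

theorem TA.rankMS (T : TA 5 x d ε) : Module.finrank k (MS k A) = 125 := by
  have := T.fin
  have := T.wfin
  rw [Module.finrank_prod, Module.finrank_prod, T.wrank, T.finA]; rfl

end P4b


section P4c
set_option linter.unusedSectionVars false
variable {k : Type*} [Field k] [CharP k 5] [IsAlgClosed k] {A : Type*} [CommRing A] [Algebra k A]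
variable {x : Fin 2 → A} {d : Fin 2 → Derivation k A A} {ε : A →ₐ[k] k}

/-- the operators `1 + ad` -/
noncomputable def SS (x : Fin 2 → A) (d : Fin 2 → Derivation k A A) : Submodule k (Module.End k (MS k A)) :=
  1 ⊔ LinearMap.range (mB x d)

theorem SS_ind {P : Module.End k (MS k A) → Prop} (h1 : P 1) (hB : ∀ u, P (mB x d u)) (ha : ∀ a b, P a → P b → P (a + b))
    (hs : ∀ (c : k) a, P a → P (c • a)) {f : Module.End k (MS k A)} (hf : f ∈ SS x d) : P f := by
  obtain ⟨a, ha', b, ⟨u, rfl⟩, rfl⟩ := Submodule.mem_sup.1 hf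
  obtain ⟨c, rfl⟩ := Submodule.mem_one.1 ha'
  refine ha _ _ ?_ (hB u)
  rw [Algebra.algebraMap_eq_smul_one]; exact hs c _ h1

theorem SSn_comm (H : MH x d) (y : MS k A) (n : ℕ) {f : Module.End k (MS k A)} (hf : f ∈ SS x d ^ n) :
    f * mB x d y - mB x d y * f ∈ SS x d ^ n := by
  induction n generalizing f with
  | zero =>
    obtain ⟨c, rfl⟩ := Submodule.mem_one.1 (by simpa using hf)
    rw [Algebra.commutes, sub_self]; exact Submodule.zero_mem _
  | succ n ih =>
    rw [pow_succ] at hf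
    induction hf using Submodule.mul_induction_on' with
    | mem_mul_mem a ha b hb =>
      have e : a * b * mB x d y - mB x d y * (a * b) = a * (b * mB x d y - mB x d y * b) + (a * mB x d y - mB x d y * a) * b := by
        simp only [mul_sub, sub_mul, mul_assoc]; abel
      have hb2 : b * mB x d y - mB x d y * b ∈ SS x d := by
        refine SS_ind (P := fun b => b * mB x d y - mB x d y * b ∈ SS x d) ?_ ?_ ?_ ?_ hb
        · simp
        · intro u
          show _ ∈ SS x d
          rw [← H.jac]
          exact Submodule.mem_sup_right ⟨_, rfl⟩
        · intro a b ha hb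
          have : (a + b) * mB x d y - mB x d y * (a + b) = (a * mB x d y - mB x d y * a) + (b * mB x d y - mB x d y * b) := by noncomm_ring
          show _ ∈ SS x d
          rw [this]; exact Submodule.add_mem _ ha hb
        · intro c a ha
          have : (c • a) * mB x d y - mB x d y * (c • a) = c • (a * mB x d y - mB x d y * a) := by
            rw [smul_mul_assoc, mul_smul_comm, smul_sub]
          show _ ∈ SS x d
          rw [this]; exact Submodule.smul_mem _ _ ha
      rw [e, pow_succ]
      exact Submodule.add_mem _ (Submodule.mul_mem_mul ha hb2) (Submodule.mul_mem_mul (ih ha) hb)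
    | add a _ b _ ha hb =>
      have : (a + b) * mB x d y - mB x d y * (a + b) = (a * mB x d y - mB x d y * a) + (b * mB x d y - mB x d y * b) := by noncomm_ring
      rw [this]; exact Submodule.add_mem _ ha hb

theorem TA.SSn_Rz (T : TA 5 x d ε) (n : ℕ) {f : Module.End k (MS k A)} (hf : f ∈ SS x d ^ n) : Rz x ε (-3 * n) f := by
  induction n generalizing f with
  | zero =>
    obtain ⟨c, rfl⟩ := Submodule.mem_one.1 (by simpa using hf)
    rw [Algebra.algebraMap_eq_smul_one]; simpa using (Rz.one.smul c)
  | succ n ih =>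
    rw [pow_succ] at hf
    induction hf using Submodule.mul_induction_on' with
    | mem_mul_mem a ha b hb =>
      refine (ih ha).mul (t := -3) ?_ (by push_cast; linarith)
      refine SS_ind (P := Rz x ε (-3)) (Rz.one.mono (by norm_num)) ?_ (fun a b => Rz.add) (fun c a h => h.smul c) hb
      intro u
      exact (T.Rz_mB (a := 0) (by rw [Psi_zero]; trivial)).mono (by norm_num)
    | add a _ b _ ha hb => exact ha.add hb

theorem TA.SS_trace (T : TA 5 x d ε) (H : MH x d) (n : ℕ) (hn : n ≤ 8) {f : Module.End k (MS k A)} (hf : f ∈ SS x d ^ n) :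
    LinearMap.trace k (MS k A) f = 0 := by
  have := T.finMS
  induction n generalizing f with
  | zero =>
    obtain ⟨c, rfl⟩ := Submodule.mem_one.1 (by simpa using hf)
    rw [Algebra.algebraMap_eq_smul_one, map_smul, LinearMap.trace_one, T.rankMS]
    have : ((125 : ℕ) : k) = 0 := (CharP.cast_eq_zero_iff k 5 125).2 (by norm_num)
    rw [this, smul_zero]
  | succ n ih =>
    have hn' : n ≤ 7 := by omega
    let J : Submodule k (MS k A) :=
      { carrier := {u | ∀ g ∈ SS x d ^ n, LinearMap.trace k (MS k A) (mB x d u * g) = 0}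
        add_mem' := by
          intro u v hu hv g hg
          rw [map_add, add_mul, map_add, hu g hg, hv g hg, add_zero]
        zero_mem' := by intro g hg; rw [map_zero, zero_mul, map_zero]
        smul_mem' := by
          intro c u hu g hg
          rw [map_smul, smul_mul_assoc, map_smul, hu g hg, smul_zero] }
    have hJ : J = ⊤ := by
      refine (H.simple J ?_).resolve_left ?_
      · intro y u hu g hg
        have h1 := hu _ (SSn_comm H y n hg)
        have h2 : LinearMap.trace k (MS k A) (mB x d y * (mB x d u * g)) = LinearMap.trace k (MS k A) ((mB x d u * g) * mB x d y) :=
          LinearMap.trace_mul_comm _ _ _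
        rw [H.jac, sub_mul, map_sub, mul_assoc, h2, ← map_sub]
        rw [← h1]; congr 1; simp only [mul_sub, mul_assoc]
      · intro hb
        have hτ : ((0, 0, (x 0 ^ 4 * x 1 ^ 4) • d 0) : MS k A) ∈ J := by
          intro g hg
          have hm : ((0, 0, (x 0 ^ 4 * x 1 ^ 4) • d 0) : MS k A) ∈ Psi x ε 26 := by
            refine ⟨fun i => ?_, ?_, fun i => ?_⟩
            · exact Ideal.zero_mem _
            · exact Ideal.zero_mem _
            · refine Ideal.mul_mem_right _ _ (imul (m := 4) (n := 4) (by norm_num) ?_ ?_)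
              · exact Ideal.pow_mem_pow (T.eps 0) 4
              · exact Ideal.pow_mem_pow (T.eps 1) 4
          have h1 := (T.Rz_mB hm).mul (T.SSn_Rz n hg) (r := 1) (by push_cast; omega)
          exact (LinearMap.isNilpotent_trace_of_isNilpotent (T.Rz_nil h1)).eq_zero
        rw [hb, Submodule.mem_bot] at hτ
        have h3 : x 0 ^ 4 * x 1 ^ 4 = 0 := by
          have := congrArg (fun u : MS k A => u.2.2 (x 0)) hτ
          simpa [T.dx] using this
        have h4 : ∀ a : A, d 0 (a * x 1 ^ 4) = d 0 a * x 1 ^ 4 := by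
          intro a
          rw [Derivation.leibniz, Derivation.leibniz_pow, T.dx]; simp [mul_comm]
        have h5 : ∀ a b : A, d 1 a = 0 → d 1 (a * b) = a * d 1 b := by
          intro a b h
          rw [Derivation.leibniz, h]; simp
        have h6 : d 1 (d 0 (d 0 (d 0 (d 0 (x 0 ^ 4))))) = 0 := by
          simp only [T.dcomm' 1 0]
          rw [Derivation.leibniz_pow, T.dx]; simp
        have h7 := T.pow4 0
        have h8 := T.pow4 1
        have h9 : ε (d 1 (d 1 (d 1 (d 1 (d 0 (d 0 (d 0 (d 0 (x 0 ^ 4 * x 1 ^ 4))))))))) = 1 := by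
          rw [h4, h4, h4, h4, h5 _ _ h6, h5 _ _ h6, h5 _ _ h6, h5 _ _ h6, map_mul, h7, h8]; norm_num
        rw [h3] at h9
        simp at h9
    rw [pow_succ'] at hf
    induction hf using Submodule.mul_induction_on' with
    | mem_mul_mem b hb a ha =>
      refine SS_ind (P := fun b => LinearMap.trace k (MS k A) (b * a) = 0) ?_ ?_ ?_ ?_ hb
      · rw [one_mul]; exact ih (by omega) ha
      · intro u
        have : u ∈ J := by rw [hJ]; trivial
        exact this a ha
      · intro b c hb hc
        show LinearMap.trace k (MS k A) ((b + c) * a) = 0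
        rw [add_mul, map_add, hb, hc, add_zero]
      · intro c b hb
        show LinearMap.trace k (MS k A) ((c • b) * a) = 0
        rw [smul_mul_assoc, map_smul, hb, smul_zero]
    | add a _ b _ ha hb => rw [map_add, ha, hb, add_zero]

theorem Pj_SS (u : MS k A) (a : k) : Pj 5 (mB x d u) a ∈ SS x d ^ 4 := by
  have h1 : (1 : Module.End k (MS k A)) ∈ SS x d := Submodule.mem_sup_left (Submodule.one_le.1 le_rfl)
  have h2 : mB x d u - a • 1 ∈ SS x d :=
    Submodule.sub_mem _ (Submodule.mem_sup_right ⟨u, rfl⟩) (Submodule.smul_mem _ _ h1)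
  refine Submodule.sub_mem _ ?_ ?_
  · have := Submodule.pow_mem_pow _ h1 4
    rwa [one_pow] at this
  · exact Submodule.pow_mem_pow _ h2 4

theorem TA.joint5 (T : TA 5 x d ε) (H : MH x d) {u v : MS k A} (hu : mB x d u ^ 5 = mB x d u) (hv : mB x d v ^ 5 = mB x d v)
    (hc : Commute (mB x d u) (mB x d v)) (i j : ZMod 5) :
    5 ∣ Module.finrank k ((mB x d u).eigenspace (cz 5 k i) ⊓ (mB x d v).eigenspace (cz 5 k j) : Submodule k (MS k A)) := by
  have := T.finMS
  rw [← CharP.cast_eq_zero_iff k 5]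
  have hp : LinearMap.IsProj ((mB x d u).eigenspace (cz 5 k i) ⊓ (mB x d v).eigenspace (cz 5 k j) : Submodule k (MS k A))
      (Pj 5 (mB x d u) (cz 5 k i) * Pj 5 (mB x d v) (cz 5 k j)) := by
    have hcc : Commute (mB x d v) (Pj 5 (mB x d u) (cz 5 k i)) := by
      refine (Commute.one_right _).sub_right (Commute.pow_right (hc.symm.sub_right ?_) _)
      exact (Commute.one_right _).smul_right _
    refine ⟨fun w => ⟨?_, ?_⟩, ?_⟩
    · rw [SetLike.mem_coe, Module.End.mem_eigenspace_iff]; exact Pj_mem hu i _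
    · rw [SetLike.mem_coe, Module.End.mem_eigenspace_iff, Module.End.mul_apply, ← Module.End.mul_apply (mB x d v), hcc.eq, Module.End.mul_apply,
        Pj_mem hv j, map_smul]
    · rintro w ⟨h1, h2⟩
      rw [SetLike.mem_coe, Module.End.mem_eigenspace_iff] at h1 h2
      rw [Module.End.mul_apply, Pj_eig j j h2, if_pos rfl, Pj_eig i i h1, if_pos rfl]
  rw [← hp.trace]
  exact T.SS_trace H 8 le_rfl (by
    rw [show 8 = 4 + 4 from rfl, pow_add]; exact Submodule.mul_mem_mul (Pj_SS u _) (Pj_SS v _))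

theorem TA.single5 (T : TA 5 x d ε) (H : MH x d) {u : MS k A} (hu : mB x d u ^ 5 = mB x d u) (i : ZMod 5) :
    5 ∣ Module.finrank k ((mB x d u).eigenspace (cz 5 k i)) := by
  have := T.joint5 H hu hu (Commute.refl _) i i
  rwa [inf_idem] at this

end P4c


section P4d
set_option linter.unusedSectionVars false
variable {k : Type*} [Field k] [CharP k 5] [IsAlgClosed k] {A : Type*} [CommRing A] [Algebra k A]
variable {x : Fin 2 → A} {d : Fin 2 → Derivation k A A} {ε : A →ₐ[k] k}

/-- the derivation slot -/
def eD (E : Derivation k A A) : MS k A := (E, 0, 0)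
/-- the tilde slot -/
def eG (E : Derivation k A A) : MS k A := (0, 0, E)
/-- the function slot -/
def eF (k : Type*) {A : Type*} [Field k] [CommRing A] [Algebra k A] (f : A) : MS k A := (0, f, 0)

theorem mB_leib (E : Derivation k A A) (a : A) (m : MS k A) :
    mB x d (eD E) (a • m) = E a • m + a • mB x d (eD E) m := by
  simp only [mB_apply]
  refine mext (fun b => ?_) ?_ (fun b => ?_)
  · simp [br1, eD]; ring
  · simp [br2, eD]; ring
  · simp [br3, eD]; ring

theorem TA.gens (T : TA 5 x d ε) (m : MS k A) : m = m.1 (x 0) • eD (d 0) + m.1 (x 1) • eD (d 1) + m.2.1 • eF k 1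
    + m.2.2 (x 0) • eG (d 0) + m.2.2 (x 1) • eG (d 1) := by
  refine mext (fun b => ?_) ?_ (fun b => ?_)
  · rw [T.der_ap m.1]; simp [eD, eF, eG]
  · simp [eD, eF, eG]
  · rw [T.der_ap m.2.2]; simp [eD, eF, eG]

theorem TA.ext_gen (T : TA 5 x d ε) {f g : Module.End k (MS k A)} (h : ∀ (a : A) m, f m = g m → f (a • m) = g (a • m))
    (h1 : ∀ i, f (eD (d i)) = g (eD (d i))) (h2 : f (eF k 1) = g (eF k 1)) (h3 : ∀ i, f (eG (d i)) = g (eG (d i))) : f = g := by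
  refine LinearMap.ext fun m => ?_
  rw [T.gens m]
  simp only [map_add]
  rw [h _ _ (h1 0), h _ _ (h1 1), h _ _ h2, h _ _ (h3 0), h _ _ (h3 1)]

theorem TA.toral_of (T : TA 5 x d ε) {D : Derivation k A A} (hD : (D : Module.End k A) ^ 5 = D) {θ : Module.End k (MS k A)}
    (hθ : ∀ (a : A) (m : MS k A), θ (a • m) = D a • m + a • θ m)
    (h1 : ∀ i, (θ ^ 5) (eD (d i)) = θ (eD (d i))) (h2 : (θ ^ 5) (eF k 1) = θ (eF k 1)) (h3 : ∀ i, (θ ^ 5) (eG (d i)) = θ (eG (d i))) : θ ^ 5 = θ := by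
  refine T.ext_gen (fun a m h => ?_) h1 h2 h3
  have h5 := pleib (p := 5) (LinearMap.lsmul A (MS k A) |>.restrictScalars₁₂ k k) (D : Module.End k A) θ θ (fun a m => hθ a m) a m
  have h6 : (θ ^ 5) (a • m) = ((D : Module.End k A) ^ 5) a • m + a • (θ ^ 5) m := h5
  rw [h6, hD, h, hθ]; rfl

theorem TA.eig25 (T : TA 5 x d ε) {D : Derivation k A A} (hD : (D : Module.End k A) ^ 5 = D) (h0 : D ≠ 0) {θ : Module.End k (MS k A)}
    (hθ : ∀ (a : A) (m : MS k A), θ (a • m) = D a • m + a • θ m) (hp : θ ^ 5 = θ) (l : ZMod 5) :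
    Module.finrank k (θ.eigenspace (cz 5 k l)) = 25 := by
  have := T.finMS
  have h := T.lemU' hD h0 θ hθ hp (fun E => ⟨mB x d (eD E), fun a m => mB_leib E a m⟩) l
  rw [T.rankMS] at h; omega

/-- constant coefficient derivation -/
noncomputable def cd (d : Fin 2 → Derivation k A A) (a : Fin 2 → k) : Derivation k A A := a 0 • d 0 + a 1 • d 1

theorem TA.cd_x (T : TA 5 x d ε) (a : Fin 2 → k) (i : Fin 2) : cd d a (x i) = algebraMap k A (a i) := by
  fin_cases i <;> simp [cd, T.dx, Algebra.algebraMap_eq_smul_one]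

theorem TA.dv_cd (T : TA 5 x d ε) (a : Fin 2 → k) : TA.dv x d (cd d a) = 0 := by
  rw [TA.dv2, T.cd_x, T.cd_x]; simp

theorem TA.ker_pow1 {a : A} : a ∈ RingHom.ker ε ^ 1 ↔ ε a = 0 := by rw [pow_one]; exact Iff.rfl

/-- a dual linear coordinate -/
theorem TA.dual (T : TA 5 x d ε) {a : Fin 2 → k} (ha : a ≠ 0) : ∃ c : A, cd d a c = 1 ∧ ε c = 0 ∧ ∃ i, ∃ r : k, c = r • x i := by
  have : ∃ i, a i ≠ 0 := by
    by_contra h; push Not at h; exact ha (funext h)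
  obtain ⟨i, hi⟩ := this
  refine ⟨(a i)⁻¹ • x i, ?_, ?_, i, _, rfl⟩
  · rw [Derivation.map_smul, T.cd_x, Algebra.smul_def, ← map_mul, inv_mul_cancel₀ hi, map_one]
  · rw [map_smul, T.eps, smul_zero]

theorem TA.const_eps (T : TA 5 x d ε) (a : Fin 2 → k) : (fun i => ε (cd d a (x i))) = a := by
  funext i; rw [T.cd_x]; simp

theorem TA.typeA (T : TA 5 x d ε) {u : MS k A} (hu : mB x d u ^ 5 = mB x d u) (h1 : u ∉ Psi x ε 1) (l : ZMod 5) :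
    Module.finrank k ((mB x d u).eigenspace (cz 5 k l)) = 25 := by
  have := T.finMS
  let a : Fin 2 → k := fun i => ε (u.1 (x i))
  have ha : a ≠ 0 := by
    intro h
    refine h1 ⟨fun i => ?_, by simp, by simp⟩
    exact TA.ker_pow1.2 (congrFun h i)
  obtain ⟨c, hc1, hc0, i0, r0, hc⟩ := T.dual ha
  have hsub : u - eD (cd d a) ∈ Psi x ε 1 := by
    refine ⟨fun i => ?_, by simp, by simp⟩
    refine TA.ker_pow1.2 ?_
    show ε ((u.1 - cd d a) (x i)) = 0
    rw [Derivation.sub_apply, map_sub, T.cd_x]; simp [a]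
  let Y := mB x d (eD (cd d a))
  have hYl : ∀ (b : A) (m : MS k A), Y (b • m) = cd d a b • m + b • Y m := fun b m => mB_leib _ b m
  have hY : Rz x ε (-3) Y := (T.Rz_mB (a := 0) (by rw [Psi_zero]; trivial)).mono (by norm_num)
  have hR : Rz x ε (-3 + 1) (mB x d u - Y) := by
    have := T.Rz_mB hsub
    rw [map_sub] at this
    exact this.mono (by norm_num)
  let sm : A → Module.End k (MS k A) := fun b => (LinearMap.lsmul A (MS k A) b).restrictScalars k
  have hsm : ∀ b m, sm b m = b • m := fun b m => rfl
  have hQ : Rz x ε (-4 * -3) (sm (c ^ 4)) := by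
    have hc4 : c ^ 4 ∈ RingHom.ker ε ^ 4 := Ideal.pow_mem_pow hc0 4
    intro n m h v hv
    refine ⟨fun i => imul (by omega) hc4 (hv.1 i), imul (by omega) hc4 hv.2.1, fun i => imul (by omega) hc4 (hv.2.2 i)⟩
  let D : Derivation k A A := c • cd d a
  have hDc : D c = c := by show c • cd d a c = c; rw [hc1]; simp
  have hDx : ∀ i, D (x i) = a i • c := by
    intro i; show c • cd d a (x i) = _; rw [T.cd_x, smul_eq_mul, mul_comm, Algebra.smul_def]
  have hD : (D : Module.End k A) ^ 5 = D := by
    have : derPow 5 D = D := by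
      refine T.dext fun i => ?_
      have h1 : (derPow 5 D : Derivation k A A) (x i) = ((D : Module.End k A) ^ 5) (x i) := by rw [← derPow_coe]; rfl
      rw [h1]
      show D (D (D (D (D (x i))))) = _
      simp only [hDx, Derivation.map_smul, hDc]
    rw [← derPow_coe, this]
  have hD0 : D ≠ 0 := by
    intro h
    have h2 := hDc
    rw [h, Derivation.zero_apply] at h2
    rw [← h2] at hc1
    have := T.nontriv
    simp at hc1
  let θ : Module.End k (MS k A) := sm c * Y
  have hθa : ∀ m, θ m = c • Y m := fun m => rfl
  have hθ : ∀ (b : A) (m : MS k A), θ (b • m) = D b • m + b • θ m := by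
    intro b m
    rw [hθa, hθa, hYl, smul_add, smul_smul, smul_smul, smul_smul, mul_comm b c]; rfl
  have hk : ∀ m, Y m = 0 → (θ ^ 5) m = θ m := by
    intro m hm
    have h0 : θ m = 0 := by rw [hθa, hm, smul_zero]
    rw [pow_succ, Module.End.mul_apply, h0, map_zero]
  have hdd : ∀ i, ⁅cd d a, d i⁆ = 0 := by
    intro i
    refine T.dext fun j => ?_
    rw [Derivation.commutator_apply, T.cd_x, T.dx]; split_ifs <;> simp
  have hθp : θ ^ 5 = θ := by
    refine T.toral_of hD hθ (fun i => hk _ ?_) (hk _ ?_) (fun i => hk _ ?_)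
    · show mbr x d _ _ = 0
      simp [mbr, eD, hdd]
    · show mbr x d _ _ = 0
      simp [mbr, eD, eF, T.dv_cd]
    · show mbr x d _ _ = 0
      simp [mbr, eD, eG, hdd, T.dv_cd]
  refine T.all25 T.rankMS hu (fun l => ?_) l
  rw [← T.eig25 hD hD0 hθ hθp 4]
  refine T.symb (by norm_num) hu hY hR hQ _ (fun v hv => ?_) l
  rw [Module.End.mem_eigenspace_iff] at hv
  have h5 : (5 : k) = 0 := by exact_mod_cast CharP.cast_eq_zero k 5
  have hcz : cz 5 k 4 = -1 := by
    rw [show (4 : ZMod 5) = -1 from rfl, map_neg, map_one]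
  rw [hcz] at hv
  have e : ∀ (n : ℕ) (w : MS k A), Y (c ^ n • w) = ((n : A) * c ^ (n - 1)) • w + c ^ n • Y w := by
    intro n w
    rw [hYl, Derivation.leibniz_pow, hc1, nsmul_eq_mul, smul_eq_mul, mul_one]
  have key : ∀ n : ℕ, c ^ n • (Y ^ n) v = ((-1) ^ n * (Nat.factorial n : k)) • v := by
    intro n
    induction n with
    | zero => simp
    | succ n ih =>
      have h1 := congrArg θ ih
      rw [hθa, e, smul_add, smul_smul, smul_smul, map_smul, hv] at h1
      have h2 : (c * ((n : A) * c ^ (n - 1))) • (Y ^ n) v = (n : k) • (c ^ n • (Y ^ n) v) := by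
        rw [← algebraMap_smul A (n : k), smul_smul, map_natCast]
        congr 1
        cases n with
        | zero => simp
        | succ n => simp [pow_succ]; ring
      rw [h2, ih] at h1
      rw [pow_succ' Y, Module.End.mul_apply, pow_succ' c]
      rw [eq_sub_of_add_eq' h1, smul_smul, smul_smul, ← sub_smul]
      congr 1
      rw [Nat.factorial_succ, pow_succ]; push_cast; ring
  rw [hsm, key 4]
  have : ((-1) ^ 4 * (Nat.factorial 4 : k)) = -1 := by
    rw [show Nat.factorial 4 = 24 from rfl]; push_cast; linear_combination 5 * h5
  rw [this, neg_smul, one_smul]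

end P4d


section P4e
set_option linter.unusedSectionVars false
variable {k : Type*} [Field k] [CharP k 5] [IsAlgClosed k] {A : Type*} [CommRing A] [Algebra k A]
variable {x : Fin 2 → A} {d : Fin 2 → Derivation k A A} {ε : A →ₐ[k] k}

theorem four_eq : (4 : k) = -1 := by
  have h5 : (5 : k) = 0 := by exact_mod_cast CharP.cast_eq_zero k 5
  linear_combination h5

theorem cz4 : cz 5 k 4 = -1 := by
  rw [show (4 : ZMod 5) = -1 from rfl, map_neg, map_one]

/-- Euler operator -/
noncomputable def eu (x : Fin 2 → A) (d : Fin 2 → Derivation k A A) (i : Fin 2) : Module.End k A :=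
  ((x i • d i : Derivation k A A) : Module.End k A)

theorem eu_apply (i : Fin 2) (a : A) : eu x d i a = x i * d i a := rfl

/-- operators preserving powers of the maximal ideal -/
def Fz (ε : A →ₐ[k] k) (P : Module.End k A) : Prop := ∀ n, ∀ a ∈ RingHom.ker ε ^ n, P a ∈ RingHom.ker ε ^ n

theorem TA.Fz_eu (T : TA 5 x d ε) (i : Fin 2) : Fz ε (eu x d i) := by
  intro n a ha
  rw [eu_apply]
  refine imul (m := 1) (by omega) (TA.ker_pow1.2 (T.eps i)) (der_pow _ (d i) n ha)

theorem Fz.sub {P Q : Module.End k A} (hP : Fz ε P) (hQ : Fz ε Q) : Fz ε (P - Q) :=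
  fun n a ha => Ideal.sub_mem _ (hP n a ha) (hQ n a ha)

theorem Fz.smul1 (c : k) : Fz ε (c • (1 : Module.End k A)) :=
  fun n _ ha => Submodule.smul_of_tower_mem _ c ha

theorem Fz.pow {P : Module.End k A} (hP : Fz ε P) (j : ℕ) : Fz ε (P ^ j) := by
  induction j with
  | zero => exact fun n a ha => ha
  | succ j ih => intro n a ha; rw [pow_succ, Module.End.mul_apply]; exact ih n _ (hP n a ha)

theorem Fz.Pj {P : Module.End k A} (hP : Fz ε P) (c : k) : Fz ε (Pj 5 P c) :=
  Fz.sub (fun n a ha => ha) ((hP.sub (Fz.smul1 c)).pow _)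

theorem TA.eu_mon (T : TA 5 x d ε) (e : Fin 2 → Fin 5) (i : Fin 2) :
    eu x d i (x 0 ^ (e 0 : ℕ) * x 1 ^ (e 1 : ℕ)) = cz 5 k ((e i : ℕ) : ZMod 5) • (x 0 ^ (e 0 : ℕ) * x 1 ^ (e 1 : ℕ)) := by
  have h : ∀ n : ℕ, ∀ j : Fin 2, x i * d i (x j ^ n) = (if i = j then (n : A) else 0) * x j ^ n := by
    intro n j
    rw [Derivation.leibniz_pow, T.dx]
    split_ifs with h
    · subst h
      cases n with
      | zero => simp
      | succ n => simp [pow_succ]; ring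
    · simp
  rw [eu_apply, Derivation.leibniz, map_natCast, Nat.cast_smul_eq_nsmul, nsmul_eq_mul, smul_eq_mul, smul_eq_mul, mul_add]
  rw [show ∀ a b c e f : A, a * (b * c) + a * (e * f) = b * (a * c) + e * (a * f) from fun a b c e f => by ring, h, h]
  fin_cases i
  · simp; ring
  · simp; ring

theorem TA.rank1 (T : TA 5 x d ε) (l l' : ZMod 5) :
    Module.finrank k (LinearMap.range (Pj 5 (eu x d 0) (cz 5 k l) * Pj 5 (eu x d 1) (cz 5 k l'))) ≤ 1 := by
  have := T.fin
  have h : LinearMap.range (Pj 5 (eu x d 0) (cz 5 k l) * Pj 5 (eu x d 1) (cz 5 k l')) ≤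
      Submodule.span k {x 0 ^ l.val * x 1 ^ l'.val} := by
    rw [LinearMap.range_eq_map, ← T.mon_span, Submodule.map_span, Submodule.span_le]
    rintro _ ⟨_, ⟨e, rfl⟩, rfl⟩
    rw [SetLike.mem_coe]
    simp only [Fin.prod_univ_two]
    rw [Module.End.mul_apply, Pj_eig l' _ (T.eu_mon e 1)]
    split_ifs with h1
    · rw [Pj_eig l _ (T.eu_mon e 0)]
      split_ifs with h0
      · refine Submodule.subset_span ?_
        rw [← h0, ← h1, ZMod.val_natCast_of_lt (e 0).2, ZMod.val_natCast_of_lt (e 1).2]; rfl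
      · exact Submodule.zero_mem _
    · rw [map_zero]; exact Submodule.zero_mem _
  exact (Submodule.finrank_mono h).trans (by simpa using finrank_span_le_card (R := k) ({x 0 ^ l.val * x 1 ^ l'.val} : Set A))

/-- shifted Euler operator -/
noncomputable def su (x : Fin 2 → A) (d : Fin 2 → Derivation k A A) (i : Fin 2) : Module.End k A :=
  eu x d i - cz 5 k 4 • 1

theorem su_apply (i : Fin 2) (a : A) : su x d i a = x i * d i a + a := by
  rw [su, LinearMap.sub_apply, LinearMap.smul_apply, cz4, eu_apply]; simp

/-- section of the divergence -/
noncomputable def secE (x : Fin 2 → A) (d : Fin 2 → Derivation k A A) : A →ₗ[k] Derivation k A A where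
  toFun g := (x 0 * ((su x d 0) ^ 3) g) • d 0 + (x 1 * ((su x d 1) ^ 3) (Pj 5 (eu x d 0) (cz 5 k 4) g)) • d 1
  map_add' g h := by simp only [map_add, mul_add, add_smul]; abel
  map_smul' c g := by
    simp only [map_smul, mul_smul_comm, smul_assoc, RingHom.id_apply, smul_add]

theorem TA.secE_x0 (T : TA 5 x d ε) (g : A) : secE x d g (x 0) = x 0 * ((su x d 0) ^ 3) g := by
  simp [secE, T.dx]

theorem TA.secE_x1 (T : TA 5 x d ε) (g : A) : secE x d g (x 1) = x 1 * ((su x d 1) ^ 3) (Pj 5 (eu x d 0) (cz 5 k 4) g) := by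
  simp [secE, T.dx]

theorem su4 (i : Fin 2) (g : A) : su x d i ((su x d i ^ 3) g) = g - Pj 5 (eu x d i) (cz 5 k 4) g := by
  rw [← Module.End.mul_apply, ← pow_succ', Pj, su]; simp

theorem eu4 (i : Fin 2) (g : A) : (eu x d i ^ 3) (eu x d i g) = g - Pj 5 (eu x d i) (cz 5 k 0) g := by
  rw [← Module.End.mul_apply, ← pow_succ, Pj]; simp

theorem TA.dv_secE (T : TA 5 x d ε) (g : A) : TA.dv x d (secE x d g) =
    g - (Pj 5 (eu x d 1) (cz 5 k 4)) (Pj 5 (eu x d 0) (cz 5 k 4) g) := by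
  have h : ∀ i a, d i (x i * a) = su x d i a := by
    intro i a; rw [su_apply, Derivation.leibniz, T.dx]; simp
  rw [TA.dv2, T.secE_x0, T.secE_x1, h, h, su4, su4]; ring

/-- Hamiltonian field -/
noncomputable def hm (d : Fin 2 → Derivation k A A) (g : A) : Derivation k A A := - d 1 g • d 0 + d 0 g • d 1

/-- recovers the Hamiltonian -/
noncomputable def lam (x : Fin 2 → A) (d : Fin 2 → Derivation k A A) : Derivation k A A →ₗ[k] A where
  toFun F := (eu x d 0 ^ 3) (x 0 * F (x 1)) - Pj 5 (eu x d 0) (cz 5 k 0) ((eu x d 1 ^ 3) (x 1 * F (x 0)))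
  map_add' F G := by simp only [Derivation.add_apply, mul_add, map_add]; abel
  map_smul' c F := by simp only [Derivation.smul_apply, mul_smul_comm, map_smul, RingHom.id_apply, smul_sub]

theorem TA.lam_hm (T : TA 5 x d ε) (g : A) : lam x d (hm d g) = g - Pj 5 (eu x d 0) (cz 5 k 0) (Pj 5 (eu x d 1) (cz 5 k 0) g) := by
  have h1 : x 0 * hm d g (x 1) = eu x d 0 g := by simp [hm, T.dx, eu_apply]
  have h0 : x 1 * hm d g (x 0) = - eu x d 1 g := by simp [hm, T.dx, eu_apply]
  show (eu x d 0 ^ 3) (x 0 * hm d g (x 1)) - Pj 5 (eu x d 0) (cz 5 k 0) ((eu x d 1 ^ 3) (x 1 * hm d g (x 0))) = _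
  rw [h1, h0, eu4, map_neg, eu4, map_neg, map_sub]; ring

theorem TA.F1_pow4 (T : TA 5 x d ε) (E : Derivation k A A) :
    ((mB x d (eF k 1)) ^ 4) (eG E) = - eD (hm d (TA.dv x d E)) := by
  have h1 : ∀ E, mB x d (eF k 1) (eG E) = eD E := by
    intro E; refine mext (fun b => ?_) ?_ (fun b => ?_) <;> simp [mB_apply, br1, br2, br3, eD, eG, eF]
  have h2 : ∀ E, mB x d (eF k 1) (eD E) = eF k (2 * TA.dv x d E) := by
    intro E; refine mext (fun b => ?_) ?_ (fun b => ?_) <;> simp [mB_apply, br1, br2, br3, eD, eF]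
  have h3 : ∀ g : A, mB x d (eF k 1) (eF k (2 * g)) = - eG (hm d g) := by
    have h4 : (4 : A) = - 1 := by
      have := congrArg (algebraMap k A) (four_eq (k := k))
      rwa [map_ofNat, map_neg, map_one] at this
    intro g
    refine mext (fun b => ?_) ?_ (fun b => ?_)
    · simp [mB_apply, br1, eG, eF]
    · simp [mB_apply, br2, eG, eF]
    · have : ∀ i, d i 2 = 0 := fun i => by exact_mod_cast Derivation.map_natCast (d i) 2
      simp [mB_apply, br3, eG, eF, hm, this]
      linear_combination (d 0 g * d 1 b - d 1 g * d 0 b) * h4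
  show mB x d (eF k 1) (mB x d (eF k 1) (mB x d (eF k 1) (mB x d (eF k 1) (eG E)))) = _
  rw [h1, h2, h3, map_neg, h1]

theorem rank_cap {M : Type*} [AddCommGroup M] [Module k M] [FiniteDimensional k M] {n : ℕ} (f g : Module.End k M) (hf : Module.finrank k (LinearMap.range f) ≤ 1)
    (hg : Module.finrank k (LinearMap.range g) ≤ 1) (hn : Module.finrank k M = n + 2) :
    n ≤ Module.finrank k (LinearMap.ker f ⊓ LinearMap.ker g : Submodule k M) := by
  have h1 := LinearMap.finrank_range_add_finrank_ker f
  have h2 := map_rank g (LinearMap.ker f)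
  have h3 := Submodule.finrank_mono (LinearMap.map_le_range (f := g) (p := LinearMap.ker f))
  omega

theorem TA.typeB (T : TA 5 x d ε) (H : MH x d) {u : MS k A} (hu : mB x d u ^ 5 = mB x d u) (h1 : u ∈ Psi x ε 1) (h2 : u ∉ Psi x ε 2) (l : ZMod 5) :
    Module.finrank k ((mB x d u).eigenspace (cz 5 k l)) = 25 := by
  have := T.finMS
  have := T.fin
  let c : k := ε u.2.1
  have hc : c ≠ 0 := by
    intro h
    exact h2 ⟨h1.1, TA.ker_pow1.2 h, by simp⟩
  have hF : eF k (1 : A) ∈ Psi x ε 1 := ⟨fun i => Ideal.zero_mem _, by simp, by simp⟩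
  have hsub : u - c • eF k 1 ∈ Psi x ε 2 := by
    refine ⟨fun i => ?_, ?_, by simp⟩
    · simpa [eF] using h1.1 i
    · refine TA.ker_pow1.2 ?_
      simp [eF, c]
  have hY : Rz x ε (-2) (mB x d (c • eF k 1)) := (T.Rz_mB (Submodule.smul_mem _ c hF)).mono (by norm_num)
  have hR : Rz x ε (-2 + 1) (mB x d u - mB x d (c • eF k 1)) := by
    have := T.Rz_mB hsub
    rw [map_sub] at this
    exact this.mono (by norm_num)
  let Q : Module.End k (MS k A) :=
    ((c ^ 4)⁻¹) • ((LinearMap.inr k (Derivation k A A) (A × Derivation k A A)) ∘ₗ (LinearMap.inr k A (Derivation k A A)) ∘ₗ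
      secE x d ∘ₗ lam x d ∘ₗ LinearMap.fst k (Derivation k A A) (A × Derivation k A A))
  have hQa : ∀ m, Q m = (c ^ 4)⁻¹ • eG (secE x d (lam x d m.1)) := fun m => rfl
  have hQ : Rz x ε (-4 * -2) Q := by
    intro n m h v hv
    rw [hQa]
    refine Submodule.smul_mem _ _ ⟨fun i => Ideal.zero_mem _, Ideal.zero_mem _, fun i => ?_⟩
    have hx : ∀ i, x i ∈ RingHom.ker ε ^ 1 := fun i => TA.ker_pow1.2 (T.eps i)
    have hs : ∀ i, Fz ε (su x d i) := fun i => (T.Fz_eu i).sub (Fz.smul1 _)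
    have hl : lam x d v.1 ∈ RingHom.ker ε ^ ((n + 2) / 3 + 1) := by
      refine Ideal.sub_mem _ ?_ ?_
      · exact (T.Fz_eu 0).pow 3 _ _ (imul (by omega) (hx 0) (hv.1 1))
      · exact (T.Fz_eu 0).Pj _ _ _ ((T.Fz_eu 1).pow 3 _ _ (imul (by omega) (hx 1) (hv.1 0)))
    show secE x d (lam x d v.1) (x i) ∈ _
    fin_cases i
    · show secE x d (lam x d v.1) (x 0) ∈ _
      rw [T.secE_x0]; exact imul (by omega) (hx 0) ((hs 0).pow 3 _ _ hl)
    · show secE x d (lam x d v.1) (x 1) ∈ _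
      rw [T.secE_x1]; exact imul (by omega) (hx 1) ((hs 1).pow 3 _ _ ((T.Fz_eu 0).Pj _ _ _ hl))
  have hcomm : Pj 5 (eu x d 0) (cz 5 k 4) * Pj 5 (eu x d 1) (cz 5 k 4) = Pj 5 (eu x d 1) (cz 5 k 4) * Pj 5 (eu x d 0) (cz 5 k 4) := by
    have h : Commute (eu x d 0) (eu x d 1) := by
      refine LinearMap.ext fun a => ?_
      have h01 := T.dcomm' 0 1 a
      simp only [Module.End.mul_apply, eu_apply, Derivation.leibniz, T.dx, h01, smul_eq_mul]
      simp; ring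
    have h' : Commute (eu x d 0 - cz 5 k 4 • 1) (eu x d 1 - cz 5 k 4 • 1) :=
      ((h.sub_right ((Commute.one_right _).smul_right _)).sub_left ((Commute.one_left _).smul_left _))
    exact (((Commute.one_left (1 : Module.End k A)).sub_right (Commute.one_left _)).sub_left
      ((Commute.one_right _).sub_right (h'.pow_pow 4 4))).eq
  let f := Pj 5 (eu x d 0) (cz 5 k 4) * Pj 5 (eu x d 1) (cz 5 k 4)
  let g := Pj 5 (eu x d 0) (cz 5 k 0) * Pj 5 (eu x d 1) (cz 5 k 0)
  have hcap := rank_cap (n := 23) f g (T.rank1 4 4) (T.rank1 0 0) T.finA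
  let W := (LinearMap.ker f ⊓ LinearMap.ker g : Submodule k A)
  let jj : A →ₗ[k] MS k A := (LinearMap.inr k (Derivation k A A) (A × Derivation k A A)) ∘ₗ (LinearMap.inr k A (Derivation k A A)) ∘ₗ secE x d
  have hjj : ∀ a, jj a = eG (secE x d a) := fun a => rfl
  have hW1 : ∀ a ∈ W, TA.dv x d (secE x d a) = a := by
    rintro a ⟨ha, _⟩
    have : f a = 0 := ha
    rw [T.dv_secE, ← Module.End.mul_apply, ← hcomm]
    show a - f a = a
    rw [this, sub_zero]
  have hW2 : ∀ a ∈ W, lam x d (hm d a) = a := by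
    rintro a ⟨_, ha⟩
    have : g a = 0 := ha
    rw [T.lam_hm, ← Module.End.mul_apply]
    show a - g a = a
    rw [this, sub_zero]
  have hV := map_rank jj W
  have hV0 : (W ⊓ LinearMap.ker jj : Submodule k A) = ⊥ := by
    rw [eq_bot_iff]; rintro a ⟨ha, ha'⟩
    rw [SetLike.mem_coe, LinearMap.mem_ker, hjj] at ha'
    have : secE x d a = 0 := congrArg (fun m : MS k A => m.2.2) ha'
    have h3 := hW1 a ha
    rw [this, map_zero] at h3
    exact h3.symm
  rw [hV0, finrank_bot, add_zero] at hV
  refine T.all25 T.rankMS hu (fun l => ?_) l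
  have hle := T.symb (by norm_num) hu hY hR hQ (W.map jj) (by
    rintro _ ⟨a, ha, rfl⟩
    have e1 : (mB x d (c • eF k 1) ^ 4) (jj a) = c ^ 4 • - eD (hm d a) := by
      rw [map_smul, smul_pow, LinearMap.smul_apply, hjj, T.F1_pow4, hW1 a ha]
    rw [e1, hjj, map_smul, map_neg, hQa]
    show c ^ 4 • -((c ^ 4)⁻¹ • eG (secE x d (lam x d (hm d a)))) = _
    rw [hW2 a ha, smul_neg, smul_smul, mul_inv_cancel₀ (pow_ne_zero 4 hc), one_smul]) l
  have h5 := T.single5 H hu l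
  rw [hV] at hle
  have h6 := hcap.trans hle
  omega

end P4e


section P4f
set_option linter.unusedSectionVars false
variable {k : Type*} [Field k] [CharP k 5] [IsAlgClosed k] {A : Type*} [CommRing A] [Algebra k A]
variable {x : Fin 2 → A} {d : Fin 2 → Derivation k A A} {ε : A →ₐ[k] k}

theorem add_toral {M : Type*} [AddCommGroup M] [Module k M] {f : Module.End k M} (hf : f ^ 5 = f) {c : k} (hc : c ^ 5 = c) :
    (f + c • (1 : Module.End k M)) ^ 5 = f + c • 1 := by
  obtain ⟨l, hl⟩ := cz_of_fixed (p := 5) hc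
  have := sub_pow_toral hf (-l)
  rw [map_neg, hl, neg_smul, sub_neg_eq_add] at this
  exact this

theorem add_pow5 {M : Type*} [AddCommGroup M] [Module k M] (f : Module.End k M) (c : k) :
    (f + c • (1 : Module.End k M)) ^ 5 = f ^ 5 + c ^ 5 • 1 := by
  have hc : Commute f (c • (1 : Module.End k M)) := (Commute.one_right f).smul_right _
  obtain ⟨r, hr⟩ := hc.exists_add_pow_prime_eq (Fact.out : Nat.Prime 5)
  have h2 : ((5 : ℕ) : Module.End k M) = 0 := by
    ext v
    rw [Module.End.natCast_apply, ← Nat.cast_smul_eq_nsmul k, CharP.cast_eq_zero, zero_smul]; rfl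
  rw [hr, h2, smul_pow, one_pow]; simp

/-- linear forms -/
noncomputable def lf (x : Fin 2 → A) (b : Fin 2 → k) : A := b 0 • x 0 + b 1 • x 1

theorem TA.d_lf (T : TA 5 x d ε) (b : Fin 2 → k) (i : Fin 2) : d i (lf x b) = algebraMap k A (b i) := by
  fin_cases i <;> simp [lf, T.dx, Algebra.algebraMap_eq_smul_one]

theorem TA.lf_mem2 (T : TA 5 x d ε) {b : Fin 2 → k} (h : lf x b ∈ RingHom.ker ε ^ 2) : lf x b = 0 := by
  have : ∀ i, b i = 0 := by
    intro i
    have h1 := der_pow _ (d i) 2 h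
    rw [T.d_lf] at h1
    simpa using TA.ker_pow1.1 h1
  simp [lf, this]

theorem TA.eps_lf (T : TA 5 x d ε) (b : Fin 2 → k) : lf x b ∈ RingHom.ker ε ^ 1 := TA.ker_pow1.2 (by simp [lf, T.eps])

/-- the linear part of a vector field -/
noncomputable def lin (x : Fin 2 → A) (d : Fin 2 → Derivation k A A) (ε : A →ₐ[k] k) (E : Derivation k A A) : Derivation k A A :=
  lf x (fun j => ε (d j (E (x 0)))) • d 0 + lf x (fun j => ε (d j (E (x 1)))) • d 1

theorem TA.lin_x (T : TA 5 x d ε) (E : Derivation k A A) (i : Fin 2) : lin x d ε E (x i) = lf x (fun j => ε (d j (E (x i)))) := by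
  fin_cases i <;> simp [lin, T.dx]

theorem TA.lin_lf (T : TA 5 x d ε) (E : Derivation k A A) (b : Fin 2 → k) : ∃ b' : Fin 2 → k, lin x d ε E (lf x b) = lf x b' := by
  refine ⟨fun j => b 0 * ε (d j (E (x 0))) + b 1 * ε (d j (E (x 1))), ?_⟩
  rw [lf, map_add, Derivation.map_smul, Derivation.map_smul, T.lin_x, T.lin_x]
  simp only [lf, smul_add, add_smul, smul_smul]; abel

theorem TA.lin_dv (T : TA 5 x d ε) (E : Derivation k A A) : ∃ τ : k, TA.dv x d (lin x d ε E) = algebraMap k A τ := by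
  rw [TA.dv2, T.lin_x, T.lin_x, T.d_lf, T.d_lf, ← map_add]; exact ⟨_, rfl⟩

theorem TA.lin_sub (T : TA 5 x d ε) {u : MS k A} (hu : u ∈ Psi x ε 3) : u - eD (lin x d ε u.1) ∈ Psi x ε 4 := by
  refine ⟨fun i => ?_, ?_, fun i => ?_⟩
  · have h := T.second (u.1 (x i))
    have h0 : ε (u.1 (x i)) = 0 := TA.ker_pow1.1 (hu.1 i)
    rw [h0, map_zero, sub_zero, Fin.sum_univ_two] at h
    show (u.1 - lin x d ε u.1) (x i) ∈ _
    rw [Derivation.sub_apply, T.lin_x]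
    exact h
  · simpa [eD] using hu.2.1
  · simpa [eD] using hu.2.2 i

theorem TA.lin_mem (T : TA 5 x d ε) (E : Derivation k A A) : eD (lin x d ε E) ∈ Psi x ε 3 := by
  refine ⟨fun i => ?_, Ideal.zero_mem _, fun i => Ideal.zero_mem _⟩
  show lin x d ε E (x i) ∈ _
  rw [T.lin_x]; exact T.eps_lf _

theorem TA.Y_F (T : TA 5 x d ε) {z : Derivation k A A} {τ : k} (hτ : TA.dv x d z = algebraMap k A τ) (f : A) :
    mB x d (eD z) (eF k f) = eF k (((z : Module.End k A) + (-2 * τ) • (1 : Module.End k A)) f) := by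
  refine mext (fun b => ?_) ?_ (fun b => ?_)
  · simp [mB_apply, br1, eD, eF]
  · simp [mB_apply, br2, eD, eF, hτ, Algebra.smul_def, map_ofNat]
    ring
  · simp [mB_apply, br3, eD, eF]

theorem TA.Y_D {z : Derivation k A A} (E : Derivation k A A) : mB x d (eD z) (eD E) = eD (⁅z, E⁆) := by
  refine mext (fun b => ?_) ?_ (fun b => ?_)
  · simp [mB_apply, br1, eD, Derivation.commutator_apply]
  · simp [mB_apply, br2, eD]
  · simp [mB_apply, br3, eD]

theorem TA.Y_G {z : Derivation k A A} {τ : k} (hτ : TA.dv x d z = algebraMap k A τ) (E : Derivation k A A) :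
    mB x d (eD z) (eG E) = eG ((LieAlgebra.ad k (Derivation k A A) z + (2 * τ) • (1 : Module.End k (Derivation k A A))) E) := by
  refine mext (fun b => ?_) ?_ (fun b => ?_)
  · simp [mB_apply, br1, eD, eG]
  · simp [mB_apply, br2, eD, eG]
  · simp [mB_apply, br3, eD, eG, hτ, Derivation.commutator_apply, Algebra.smul_def, map_ofNat]
    ring

theorem it_pow {M N : Type*} [AddCommGroup M] [Module k M] [AddCommGroup N] [Module k N] {f : Module.End k M} {g : Module.End k N}
    {j : M → N} (h : ∀ m, g (j m) = j (f m)) (n : ℕ) (m : M) : (g ^ n) (j m) = j ((f ^ n) m) := by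
  induction n with
  | zero => rfl
  | succ n ih => rw [pow_succ', Module.End.mul_apply, ih, h, pow_succ', Module.End.mul_apply]

theorem TA.typeD_data (T : TA 5 x d ε) {u : MS k A} (hu : mB x d u ^ 5 = mB x d u) (h3 : u ∈ Psi x ε 3) :
    ((lin x d ε u.1 : Derivation k A A) : Module.End k A) ^ 5 = (lin x d ε u.1 : Derivation k A A) ∧
    mB x d (eD (lin x d ε u.1)) ^ 5 = mB x d (eD (lin x d ε u.1)) ∧
    Rz x ε 1 (mB x d u - mB x d (eD (lin x d ε u.1))) ∧ Rz x ε 0 (mB x d (eD (lin x d ε u.1))) := by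
  let z := lin x d ε u.1
  let Y := mB x d (eD z)
  have hY : Rz x ε 0 Y := (T.Rz_mB (T.lin_mem u.1)).mono (by norm_num)
  have hR : Rz x ε 1 (mB x d u - Y) := by
    have := T.Rz_mB (T.lin_sub h3)
    rw [map_sub] at this
    exact this.mono (by norm_num)
  have h5 : Rz x ε 1 (Y ^ 5 - Y) := by
    have h := (hR.sub ((hY.pow_sub (by simpa using hR) 5).mono (s := 1) (by norm_num)))
    have e : mB x d u - Y - (mB x d u ^ 5 - Y ^ 5) = Y ^ 5 - Y := by rw [hu]; abel
    rwa [e] at h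
  obtain ⟨τ, hτ⟩ := T.lin_dv u.1
  let S : Module.End k A := ((z : Module.End k A) + (-2 * τ) • (1 : Module.End k A))
  have hS : ∀ n f, (Y ^ n) (eF k f) = eF k ((S ^ n) f) := it_pow (T.Y_F hτ)
  have hYS : ∀ f, (Y ^ 5 - Y) (eF k f) = eF k ((S ^ 5) f - S f) := by
    intro f
    have h1 := hS 5 f
    have h2 := hS 1 f
    rw [pow_one, pow_one] at h2
    rw [LinearMap.sub_apply, h1, h2]
    simp [eF]
  have hS5 : S ^ 5 = (z : Module.End k A) ^ 5 + (-2 * τ) ^ 5 • 1 := add_pow5 _ _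
  have hSd : ∀ f, (S ^ 5) f - S f = ((z : Module.End k A) ^ 5) f - z f + ((-2 * τ) ^ 5 - (-2 * τ)) • f := by
    intro f
    rw [hS5]
    show ((z : Module.End k A) ^ 5) f + (-2 * τ) ^ 5 • f - (z f + (-2 * τ) • f) = _
    rw [sub_smul]; abel
  have hz1 : ((z : Module.End k A) ^ 5) 1 = 0 := by
    rw [pow_succ, Module.End.mul_apply]
    show ((z : Module.End k A) ^ 4) (z 1) = 0
    rw [Derivation.map_one_eq_zero, map_zero]
  have hτ5 : (-2 * τ) ^ 5 = -2 * τ := by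
    have h := (h5 1 2 (by norm_num) (eF k 1) ⟨fun i => Ideal.zero_mem _, by simp, by simp⟩).2.1
    rw [hYS, hSd, hz1] at h
    have h' := TA.ker_pow1.1 h
    simp [eF] at h'
    linear_combination h'
  have hzl : ∀ (n : ℕ) (b : Fin 2 → k), ∃ b' : Fin 2 → k, ((z : Module.End k A) ^ n) (lf x b) = lf x b' := by
    intro n b
    induction n with
    | zero => exact ⟨b, rfl⟩
    | succ n ih =>
      obtain ⟨b', hb'⟩ := ih
      rw [pow_succ', Module.End.mul_apply, hb']; exact T.lin_lf u.1 b'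
  have hz5 : (z : Module.End k A) ^ 5 = z := by
    have : derPow 5 z = z := by
      refine T.dext fun i => ?_
      have h1 : (derPow 5 z : Derivation k A A) (x i) = ((z : Module.End k A) ^ 5) (x i) := by rw [← derPow_coe]; rfl
      rw [h1]
      have hx : x i = lf x (fun j => if j = i then (1:k) else 0) := by
        fin_cases i <;> simp [lf]
      obtain ⟨b5, hb5⟩ := hzl 5 (fun j => if j = i then (1:k) else 0)
      obtain ⟨b1, hb1⟩ := T.lin_lf u.1 (fun j => if j = i then (1:k) else 0)
      have h := (h5 4 5 (by norm_num) (eF k (x i)) ⟨fun i => Ideal.zero_mem _, TA.ker_pow1.2 (T.eps i), fun i => Ideal.zero_mem _⟩).2.1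
      rw [hYS, hSd, hτ5, sub_self, zero_smul, add_zero] at h
      have h' : ((z : Module.End k A) ^ 5) (x i) - z (x i) ∈ RingHom.ker ε ^ 2 := h
      rw [hx, hb5] at h' ⊢
      have hb1' : z (lf x fun j => if j = i then (1:k) else 0) = lf x b1 := hb1
      rw [hb1'] at h' ⊢
      have e : lf x b5 - lf x b1 = lf x (b5 - b1) := by
        simp only [lf, Pi.sub_apply, sub_smul]; abel
      rw [e] at h'
      have h0 := T.lf_mem2 h'
      rw [← e, sub_eq_zero] at h0
      exact h0
    rw [← derPow_coe, this]
  refine ⟨hz5, ?_, hR, hY⟩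
  have h25 : (2 * τ) ^ 5 = 2 * τ := by linear_combination -hτ5
  have hG : ∀ n E, (Y ^ n) (eG E) = eG (((LieAlgebra.ad k (Derivation k A A) z + (2 * τ) • (1 : Module.End k (Derivation k A A))) ^ n) E) :=
    it_pow (TA.Y_G hτ)
  have hDD : ∀ n E, (Y ^ n) (eD E) = eD (((LieAlgebra.ad k (Derivation k A A) z) ^ n) E) := it_pow (fun E => TA.Y_D E)
  refine T.toral_of (D := z) hz5 (fun a m => mB_leib z a m) (fun i => ?_) ?_ (fun i => ?_)
  · have := hDD 5 (d i)
    rw [ad_toral hz5] at this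
    rw [this]; exact (TA.Y_D _).symm
  · have := hS 5 1
    rw [add_toral hz5 hτ5] at this
    rw [this]; exact (T.Y_F hτ _).symm
  · have := hG 5 (d i)
    rw [add_toral (ad_toral hz5) h25] at this
    rw [this]; exact (TA.Y_G hτ _).symm

theorem TA.lin_ne (T : TA 5 x d ε) (H : MH x d) {u : MS k A} (hu : mB x d u ^ 5 = mB x d u) (h3 : u ∈ Psi x ε 3) (h0 : u ≠ 0) :
    lin x d ε u.1 ≠ 0 := by
  intro hz
  obtain ⟨_, _, hR, _⟩ := T.typeD_data hu h3
  have he : eD (lin x d ε u.1) = 0 := by rw [hz]; rfl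
  rw [he, map_zero, sub_zero] at hR
  refine h0 (H.faith u (LinearMap.ext fun v => ?_))
  refine T.Rz_inj (R := - mB x d u ^ 4) ((hR.pow 4).neg.mono (by norm_num)) ?_
  rw [LinearMap.neg_apply, ← Module.End.mul_apply, ← pow_succ, hu, add_neg_cancel]

theorem Rz.Pj0 {X Y : Module.End k (MS k A)} (hY : Rz x ε 0 Y) (hR : Rz x ε 1 (X - Y)) (a : k) :
    Rz x ε 1 (_root_.Pj 5 X a - _root_.Pj 5 Y a) := by
  have h1 : Rz x ε (0 + 1) ((X - a • (1 : Module.End k (MS k A))) - (Y - a • (1 : Module.End k (MS k A)))) := by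
    simpa using hR
  have h := ((hY.sub (Rz.one.smul a)).pow_sub h1 4).neg
  have e : _root_.Pj 5 X a - _root_.Pj 5 Y a = -((X - a • (1 : Module.End k (MS k A))) ^ 4 - (Y - a • (1 : Module.End k (MS k A))) ^ 4) := by
    rw [_root_.Pj, _root_.Pj]; abel
  rw [e]; exact h.mono (by norm_num)

theorem TA.typeD (T : TA 5 x d ε) (H : MH x d) {u : MS k A} (hu : mB x d u ^ 5 = mB x d u) (h3 : u ∈ Psi x ε 3) (h0 : u ≠ 0) (l : ZMod 5) :
    Module.finrank k ((mB x d u).eigenspace (cz 5 k l)) = 25 := by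
  have := T.finMS
  obtain ⟨hz, hY5, hR, hY⟩ := T.typeD_data hu h3
  have hz0 := T.lin_ne H hu h3 h0
  refine T.all25 T.rankMS hu (fun l => ?_) l
  rw [← T.eig25 hz hz0 (fun a m => mB_leib _ a m) hY5 l]
  refine rank_Pj hu l _ fun v hv hv0 => ?_
  rw [Module.End.mem_eigenspace_iff] at hv
  refine T.Rz_inj (Rz.Pj0 hY hR (cz 5 k l)) ?_
  rw [LinearMap.sub_apply, hv0, Pj_eig l l hv, if_pos rfl]; abel

end P4f


section P4g
set_option linter.unusedSectionVars false
variable {k : Type*} [Field k] [CharP k 5] [IsAlgClosed k] {A : Type*} [CommRing A] [Algebra k A]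
variable {x : Fin 2 → A} {d : Fin 2 → Derivation k A A} {ε : A →ₐ[k] k}

theorem two_count {M : Type*} [AddCommGroup M] [Module k M] [FiniteDimensional k M] {X Z : Module.End k M} (hX : X ^ 5 = X) (hZ : Z ^ 5 = Z)
    (hc : Commute X Z) : ∃ (n : ℕ) (α β : Fin n → ZMod 5), n = Module.finrank k M ∧
    (∀ i j, Module.finrank k (X.eigenspace (cz 5 k i) ⊓ Z.eigenspace (cz 5 k j) : Submodule k M) =
      (Finset.univ.filter fun t => α t = i ∧ β t = j).card) ∧
    (∀ i, Module.finrank k (X.eigenspace (cz 5 k i)) = (Finset.univ.filter fun t => α t = i).card) ∧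
    (∀ r i, Module.finrank k ((Z + cz 5 k r • X).eigenspace (cz 5 k i)) = (Finset.univ.filter fun t => β t + r * α t = i).card) := by
  classical
  obtain ⟨n, b, e, he⟩ := simDiag (fun i : Bool => if i then X else Z) (by
    intro i; cases i
    · exact ssop_toral (p := 5) hZ
    · exact ssop_toral (p := 5) hX) (by
    intro i j; cases i <;> cases j
    · exact Commute.refl _
    · exact hc.symm
    · exact hc
    · exact Commute.refl _)
  have hXb : ∀ t, X (b t) = e t true • b t := fun t => he t true
  have hZb : ∀ t, Z (b t) = e t false • b t := fun t => he t false
  have fix : ∀ (f : Module.End k M), f ^ 5 = f → ∀ c t, f (b t) = c • b t → ∃ l, cz 5 k l = c := by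
    intro f hf c t h
    apply cz_of_fixed
    have h1 : ∀ m : ℕ, (f ^ m) (b t) = c ^ m • b t := by
      intro m
      induction m with
      | zero => simp
      | succ m ih => rw [pow_succ', Module.End.mul_apply, ih, map_smul, h, smul_smul, pow_succ]
    have h2 := h1 5
    rw [hf, h, ← sub_eq_zero, ← sub_smul] at h2
    have := (smul_eq_zero.1 h2).resolve_right (b.ne_zero t)
    exact (sub_eq_zero.1 this).symm
  choose α hα using fun t => fix X hX _ t (hXb t)
  choose β hβ using fun t => fix Z hZ _ t (hZb t)
  refine ⟨n, α, β, ?_, ?_, ?_, ?_⟩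
  · rw [Module.finrank_eq_card_basis b, Fintype.card_fin]
  · intro i j
    refine finrank_joint b _ e he (fun t : Bool => if t then cz 5 k i else cz 5 k j) _ ?_ _ ?_
    · intro v
      rw [Bool.forall_bool, Submodule.mem_inf, Module.End.mem_eigenspace_iff, Module.End.mem_eigenspace_iff]
      exact and_comm
    · intro t
      rw [Bool.forall_bool, Finset.mem_filter, ← hα, ← hβ]
      simp only [Finset.mem_univ, true_and, if_true, if_false, Bool.false_eq_true, cz_inj.eq_iff]
      exact and_comm
  · intro i
    refine finrank_joint b (fun _ : Unit => X) (fun t _ => e t true) (fun t _ => hXb t) (fun _ => cz 5 k i) _ ?_ _ ?_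
    · intro v; rw [Module.End.mem_eigenspace_iff]; simp
    · intro t; rw [Finset.mem_filter, ← hα]; simp [cz_inj.eq_iff]
  · intro r i
    refine finrank_joint b (fun _ : Unit => Z + cz 5 k r • X) (fun t _ => e t false + cz 5 k r * e t true) (fun t _ => ?_) (fun _ => cz 5 k i) _ ?_ _ ?_
    · rw [LinearMap.add_apply, LinearMap.smul_apply, hXb, hZb, smul_smul, add_smul]
    · intro v; rw [Module.End.mem_eigenspace_iff]; simp
    · intro t; rw [Finset.mem_filter, ← hα, ← hβ, ← map_mul, ← map_add]; simp only [Finset.mem_univ, true_and, cz_inj.eq_iff, forall_const]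

/-- lines count -/
theorem lines25 {n : ℕ} (hn : n = 125) (α β : Fin n → ZMod 5)
    (h : ∀ r i, (Finset.univ.filter fun t => β t + r * α t = i).card = 25) (i j : ZMod 5) :
    (Finset.univ.filter fun t => α t = i).card = 5 * (Finset.univ.filter fun t => α t = i ∧ β t = j).card := by
  classical
  have h1 : ∑ r : ZMod 5, (Finset.univ.filter fun t => β t + r * α t = j + r * i).card = 125 := by
    simp [h]
  have h2 : ∑ r : ZMod 5, (Finset.univ.filter fun t => β t + r * α t = j + r * i).card =
      ∑ t : Fin n, (Finset.univ.filter fun r : ZMod 5 => β t + r * α t = j + r * i).card := by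
    simp only [Finset.card_filter]; exact Finset.sum_comm
  have h3 : ∀ a b a' b' : ZMod 5, (Finset.univ.filter fun r : ZMod 5 => b + r * a = b' + r * a').card + (if a = a' then 1 else 0) =
      1 + 5 * (if a = a' ∧ b = b' then 1 else 0) := by decide
  have h4 := Finset.sum_congr rfl fun (t : Fin n) (_ : t ∈ Finset.univ) => h3 (α t) (β t) i j
  rw [Finset.sum_add_distrib, ← h2, h1, Finset.sum_add_distrib, ← Finset.mul_sum, ← Finset.card_filter, ← Finset.card_filter] at h4
  simp [hn] at h4
  exact h4

theorem TA.G_D (T : TA 5 x d ε) (a e : Fin 2 → k) (f : A) :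
    mB x d (eG (cd d a)) (eD (f • cd d e)) = eG (cd d a f • cd d e - (2 * cd d e f) • cd d a) := by
  have hdv : TA.dv x d (f • cd d e) = cd d e f := by
    rw [TA.dv2, T.der_ap (cd d e) f]
    simp [T.cd_x, mul_comm]
  have hcomm : ∀ b, cd d e (cd d a b) = cd d a (cd d e b) := by
    intro b
    simp only [cd, Derivation.add_apply, Derivation.smul_apply, map_add, Derivation.map_smul, smul_add, smul_smul, T.dcomm' 1 0]
    simp only [mul_comm (e _) (a _)]; abel
  refine mext (fun b => ?_) ?_ (fun b => ?_)
  · simp [mB_apply, br1, eD, eG]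
  · simp [mB_apply, br2, eD, eG]
  · simp [mB_apply, br3, eD, eG, hdv, hcomm]
    ring

theorem TA.G_G (T : TA 5 x d ε) (a : Fin 2 → k) (E : Derivation k A A) :
    mB x d (eG (cd d a)) (eG E) = eF k (a 0 • E (x 1) - a 1 • E (x 0)) := by
  refine mext (fun b => ?_) ?_ (fun b => ?_)
  · simp [mB_apply, br1, eF, eG]
  · simp [mB_apply, br2, eF, eG, T.cd_x, Algebra.smul_def]
  · simp [mB_apply, br3, eF, eG]

theorem G_F (a : Fin 2 → k) (g : A) :
    mB x d (eG (cd d a)) (eF k g) = eD (-g • cd d a) := by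
  refine mext (fun b => ?_) ?_ (fun b => ?_)
  · simp [mB_apply, br1, eF, eG, eD]
  · simp [mB_apply, br2, eF, eG, eD]
  · simp [mB_apply, br3, eF, eG, eD]

theorem TA.G_pow4 (T : TA 5 x d ε) (a e : Fin 2 → k) (h : a 0 * e 1 - a 1 * e 0 = 1) (f : A) :
    ((mB x d (eG (cd d a))) ^ 4) (eD (f • cd d e)) = cd d a (cd d a f) • eG (cd d a) := by
  show mB x d (eG (cd d a)) (mB x d (eG (cd d a)) (mB x d (eG (cd d a)) (mB x d (eG (cd d a)) (eD (f • cd d e))))) = _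
  have h1 : a 0 • (cd d a f • cd d e - (2 * cd d e f) • cd d a) (x 1) - a 1 • (cd d a f • cd d e - (2 * cd d e f) • cd d a) (x 0) = cd d a f := by
    have h' : algebraMap k A (a 0) * algebraMap k A (e 1) - algebraMap k A (a 1) * algebraMap k A (e 0) = 1 := by
      rw [← map_mul, ← map_mul, ← map_sub, h, map_one]
    simp only [Derivation.sub_apply, Derivation.smul_apply, T.cd_x, Algebra.smul_def, smul_eq_mul]
    linear_combination cd d a f * h'
  rw [T.G_D, T.G_G, h1, G_F, T.G_D]
  refine mext (fun b => ?_) ?_ (fun b => ?_)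
  · simp [eG]
  · simp [eG]
  · simp [eG]; ring

end P4g


section P4h
set_option linter.unusedSectionVars false
variable {k : Type*} [Field k] [CharP k 5] [IsAlgClosed k] {A : Type*} [CommRing A] [Algebra k A]
variable {x : Fin 2 → A} {d : Fin 2 → Derivation k A A} {ε : A →ₐ[k] k}

/-- data of a leading term of degree minus one -/
structure CD (x : Fin 2 → A) (d : Fin 2 → Derivation k A A) (ε : A →ₐ[k] k) (u : MS k A) (a : Fin 2 → k) : Prop where
  ne : a ≠ 0
  Y : Rz x ε (-1) (mB x d (eG (cd d a)))
  R : Rz x ε (-1 + 1) (mB x d u - mB x d (eG (cd d a)))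
  sub : u - eG (cd d a) ∈ Psi x ε 3
  mem : eG (cd d a) ∈ Psi x ε 2
  nmem : ∀ (g : A) (m : ℕ), g ∉ RingHom.ker ε ^ (m + 1) → g • eG (cd d a) ∉ Psi x ε (3 * m + 3)
  wit : ∀ (g : A) (m : ℕ), g ∈ RingHom.ker ε ^ m → cd d a g = 0 →
    ∃ w ∈ Psi x ε (3 * m + 6), ((mB x d (eG (cd d a))) ^ 4) w = (2 : k) • (g • eG (cd d a))

theorem comm_pow5 {M : Type*} [AddCommGroup M] [Module k M] {f g : Module.End k M} (hc : Commute f g) :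
    (f + g) ^ 5 = f ^ 5 + g ^ 5 := by
  obtain ⟨q, hq⟩ := hc.exists_add_pow_prime_eq (Fact.out : Nat.Prime 5)
  have h5 : ((5 : ℕ) : Module.End k M) = 0 := by
    refine LinearMap.ext fun v => ?_
    rw [Module.End.natCast_apply, ← Nat.cast_smul_eq_nsmul k, CharP.cast_eq_zero, zero_smul]; rfl
  rw [hq, h5]; simp

theorem two_ne : (2 : k) ≠ 0 := by
  have h4 := four_eq (k := k)
  intro h
  have : (1 : k) = 0 := by linear_combination -2 * h + h4
  exact one_ne_zero this

theorem TA.cdata (T : TA 5 x d ε) {u : MS k A} (h2 : u ∈ Psi x ε 2) (h3 : u ∉ Psi x ε 3) :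
    CD x d ε u (fun i => ε (u.2.2 (x i))) := by
  set a : Fin 2 → k := fun i => ε (u.2.2 (x i)) with ha
  have hne : a ≠ 0 := by
    intro h
    exact h3 ⟨h2.1, h2.2.1, fun i => TA.ker_pow1.2 (congrFun h i)⟩
  have hex : ∃ i, a i ≠ 0 := by
    by_contra h; push Not at h; exact hne (funext h)
  have hmem : eG (cd d a) ∈ Psi x ε 2 := ⟨fun i => Ideal.zero_mem _, Ideal.zero_mem _, by simp⟩
  have hsub : u - eG (cd d a) ∈ Psi x ε 3 := by
    refine ⟨fun i => ?_, ?_, fun i => ?_⟩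
    · simpa [eG] using h2.1 i
    · simpa [eG] using h2.2.1
    · refine TA.ker_pow1.2 ?_
      show ε ((u.2.2 - cd d a) (x i)) = 0
      rw [Derivation.sub_apply, T.cd_x]; simp [ha]
  refine ⟨hne, (T.Rz_mB hmem).mono (by norm_num), ?_, hsub, hmem, ?_, ?_⟩
  · have := T.Rz_mB hsub
    rw [map_sub] at this
    exact this.mono (by norm_num)
  · intro g m hg hcon
    obtain ⟨i, hi⟩ := hex
    have h := hcon.2.2 i
    rw [show (3 * m + 3) / 3 = m + 1 by omega] at h
    have h' : g * cd d a (x i) ∈ RingHom.ker ε ^ (m + 1) := h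
    rw [T.cd_x] at h'
    refine hg ?_
    have e : g = g * algebraMap k A (a i) * algebraMap k A (a i)⁻¹ := by
      rw [mul_assoc, ← map_mul, mul_inv_cancel₀ hi, map_one, mul_one]
    rw [e]; exact Ideal.mul_mem_right _ _ h'
  · intro g m hg hg0
    have he : ∃ e : Fin 2 → k, a 0 * e 1 - a 1 * e 0 = 1 := by
      by_cases h0 : a 0 = 0
      · have h1 : a 1 ≠ 0 := fun h1 => hne (funext fun i => by fin_cases i <;> simp [h0, h1])
        exact ⟨![-(a 1)⁻¹, 0], by simp [h1]⟩
      · exact ⟨![0, (a 0)⁻¹], by simp [h0]⟩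
    obtain ⟨e, he⟩ := he
    obtain ⟨c, hc1, hc2, -⟩ := T.dual hne
    refine ⟨eD ((c ^ 2 * g) • cd d e), ⟨fun i => ?_, Ideal.zero_mem _, fun i => Ideal.zero_mem _⟩, ?_⟩
    · rw [show (3 * m + 6 + 2) / 3 = m + 2 by omega]
      exact Ideal.mul_mem_right _ _ (imul (m := 2) (by omega) (Ideal.pow_mem_pow hc2 2) hg)
    · rw [T.G_pow4 a e he]
      have : cd d a (cd d a (c ^ 2 * g)) = 2 * g := by
        have h2' : cd d a (2 : A) = 0 := by exact_mod_cast Derivation.map_natCast (cd d a) 2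
        rw [Derivation.leibniz, hg0, Derivation.leibniz_pow, hc1]
        simp only [smul_zero, zero_add, smul_eq_mul, Derivation.leibniz, hg0, nsmul_eq_mul, pow_one, hc1, mul_one]
        simp [hc1, h2', hg0]; ring
      rw [this, show (2 : A) * g = (2 : k) • g by rw [Algebra.smul_def, map_ofNat], smul_assoc]

theorem CD.pos {u : MS k A} {a : Fin 2 → k} (C : CD x d ε u a) (hu : mB x d u ^ 5 = mB x d u) [FiniteDimensional k (MS k A)] (l : ZMod 5) :
    0 < Module.finrank k ((mB x d u).eigenspace (cz 5 k l)) := by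
  obtain ⟨w, hw, hY⟩ := C.wit 1 0 (by simp) (by simp)
  have h1 := Rz.Pj (by norm_num) C.Y C.R (cz 5 k l) 6 3 (by norm_num) w hw
  rw [Module.finrank_pos_iff_exists_ne_zero]
  refine ⟨⟨Pj 5 (mB x d u) (cz 5 k l) w, Module.End.mem_eigenspace_iff.2 (Pj_mem hu l w)⟩, fun h0 => ?_⟩
  have h0' : Pj 5 (mB x d u) (cz 5 k l) w = 0 := congrArg Subtype.val h0
  rw [LinearMap.add_apply, h0', zero_add, hY] at h1
  refine C.nmem 1 0 (fun h => ?_) ?_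
  · have := TA.ker_pow1.1 h; simp at this
  · have := Submodule.smul_mem _ (2 : k)⁻¹ h1
    rwa [smul_smul, inv_mul_cancel₀ two_ne, one_smul] at this

theorem TA.typeC1 (T : TA 5 x d ε) (H : MH x d) {u v : MS k A} (hu : mB x d u ^ 5 = mB x d u) (hv : mB x d v ^ 5 = mB x d v)
    (hc : Commute (mB x d u) (mB x d v)) (h2 : u ∈ Psi x ε 2) (h3 : u ∉ Psi x ε 3) (hv2 : v ∉ Psi x ε 2) (l : ZMod 5) :
    Module.finrank k ((mB x d u).eigenspace (cz 5 k l)) = 25 := by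
  have := T.finMS
  have C := T.cdata h2 h3
  refine T.all25 T.rankMS hu (fun l => ?_) l
  obtain ⟨n, α, β, hn, hN, hm, hl⟩ := two_count hu hv hc
  rw [T.rankMS] at hn
  have h25 : ∀ r i, (Finset.univ.filter fun t => β t + r * α t = i).card = 25 := by
    intro r i
    rw [← hl]
    have e : mB x d v + cz 5 k r • mB x d u = mB x d (v + cz 5 k r • u) := by simp
    have ht : mB x d (v + cz 5 k r • u) ^ 5 = mB x d (v + cz 5 k r • u) := by
      rw [← e]
      have hcc : Commute (mB x d v) (cz 5 k r • mB x d u) := hc.symm.smul_right _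
      rw [comm_pow5 hcc, smul_pow, hu, hv, cz_pow]
    have hn2 : v + cz 5 k r • u ∉ Psi x ε 2 := fun h => hv2 (by
      have := Submodule.sub_mem _ h (Submodule.smul_mem _ (cz 5 k r) h2)
      simpa using this)
    rw [e]
    by_cases h1 : v + cz 5 k r • u ∈ Psi x ε 1
    · exact T.typeB H ht h1 hn2 i
    · exact T.typeA ht h1 i
  have h5 := lines25 hn α β h25 l 0
  rw [← hm, ← hN] at h5
  have hp := C.pos hu l
  obtain ⟨q, hq⟩ := T.joint5 H hu hv hc l 0
  omega

theorem TA.yn (T : TA 5 x d ε) {η : Derivation k A A} {y : A} (hy : η y = 1) (m : ℕ) (hm : m < 5) : y ^ m ∉ RingHom.ker ε ^ (m + 1) := by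
  induction m with
  | zero => intro h; have := TA.ker_pow1.1 h; simp at this
  | succ m ih =>
    intro h
    have h1 := der_pow _ η _ h
    rw [Derivation.leibniz_pow, hy] at h1
    simp only [Nat.add_sub_cancel, smul_eq_mul, mul_one] at h1
    rw [← Nat.cast_smul_eq_nsmul k] at h1
    have hne : ((m + 1 : ℕ) : k) ≠ 0 := by
      rw [Ne, CharP.cast_eq_zero_iff k 5]
      intro hd
      have := Nat.le_of_dvd (by omega) hd
      omega
    refine ih (by omega) ?_
    have := Submodule.smul_of_tower_mem (RingHom.ker ε ^ (m + 1)) (((m + 1 : ℕ) : k)⁻¹) h1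
    rwa [smul_smul, inv_mul_cancel₀ hne, one_smul] at this

end P4h


section P4i
set_option linter.unusedSectionVars false
variable {k : Type*} [Field k] [CharP k 5] [IsAlgClosed k] {A : Type*} [CommRing A] [Algebra k A]
variable {x : Fin 2 → A} {d : Fin 2 → Derivation k A A} {ε : A →ₐ[k] k}

theorem der_scale (D : Derivation k A A) {y : A} {ν : k} (h : D y = ν • y) (m : ℕ) : D (y ^ m) = ((m : k) * ν) • y ^ m := by
  induction m with
  | zero => simp
  | succ m ih =>
    rw [pow_succ, Derivation.leibniz, ih, h, smul_eq_mul, smul_eq_mul]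
    simp only [Algebra.smul_def, map_mul, map_natCast, map_add, map_one, Nat.cast_succ]
    ring

theorem smul_eig {M : Type*} [AddCommGroup M] [Module k M] {B : Module.End k M} {v : M} {c : k} (h : B v = c • v) (b : k) :
    B (b • v) = c • (b • v) := by rw [map_smul, h, smul_comm]

theorem comm_eig {M : Type*} [AddCommGroup M] [Module k M] {B P : Module.End k M} (hc : Commute B P) {v : M} {c : k} (h : B v = c • v) :
    B (P v) = c • P v := by rw [← Module.End.mul_apply, hc.eq, Module.End.mul_apply, h, map_smul]

theorem two_mem {S : Submodule k (MS k A)} {v : MS k A} (h : (2 : k) • v ∈ S) : v ∈ S := by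
  have := S.smul_mem (2 : k)⁻¹ h
  rwa [smul_smul, inv_mul_cancel₀ two_ne, one_smul] at this

theorem blk {X Z E Y : Module.End k (MS k A)} {w v : MS k A} {b c : k} {m : ℕ}
    (hw : w ∈ Psi x ε (3 * m + 6)) (h1 : Rz x ε (4 * (-1) + 1) (Pj 5 X b + Y ^ 4)) (hYR : Rz x ε (-1) Y)
    (hP0 : Rz x ε 0 (Pj 5 Z c)) (hPR : Rz x ε 1 (_root_.Pj 5 Z c - _root_.Pj 5 E c)) (hY : (Y ^ 4) w = v)
    (hQ : Pj 5 E c v = v) (h0 : Pj 5 Z c (Pj 5 X b w) = 0) : v ∈ Psi x ε (3 * m + 3) := by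
  have h1 := h1 _ (3 * m + 3) (by push_cast; linarith) w hw
  have hYm := hYR.pow 4 _ (3 * m + 2) (by push_cast; linarith) w hw
  have h4 := hP0 _ (3 * m + 3) (by push_cast; linarith) _ h1
  have h5 := hPR _ (3 * m + 3) (by push_cast; linarith) _ hYm
  have e4 : Pj 5 Z c ((Pj 5 X b + Y ^ 4 : Module.End k (MS k A)) w) = Pj 5 Z c (Pj 5 X b w) + Pj 5 Z c ((Y ^ 4) w) := map_add _ _ _
  have e5 : (Pj 5 Z c - Pj 5 E c : Module.End k (MS k A)) ((Y ^ 4) w) = Pj 5 Z c ((Y ^ 4) w) - Pj 5 E c ((Y ^ 4) w) := rfl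
  have h6 := (Psi x ε (3 * m + 3)).sub_mem h4 h5
  rw [e4, e5, h0, zero_add, hY, hQ, sub_sub_cancel] at h6
  exact h6

set_option maxHeartbeats 1000000 in
theorem TA.typeC2 (T : TA 5 x d ε) (H : MH x d) {u z : MS k A} (hu : mB x d u ^ 5 = mB x d u) (hz : mB x d z ^ 5 = mB x d z)
    (hc : Commute (mB x d u) (mB x d z)) (hzu : mB x d z u = 0) (h2 : u ∈ Psi x ε 2) (h3 : u ∉ Psi x ε 3) (hz3 : z ∈ Psi x ε 3) (hz0 : z ≠ 0) (l : ZMod 5) :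
    Module.finrank k ((mB x d u).eigenspace (cz 5 k l)) = 25 := by
  have := T.finMS
  have C := T.cdata h2 h3
  set a : Fin 2 → k := fun i => ε (u.2.2 (x i)) with ha
  obtain ⟨hD5, hB5, hR, hY⟩ := T.typeD_data hz hz3
  have hD0 := T.lin_ne H hz hz3 hz0
  obtain ⟨M, hM⟩ : ∃ M : Fin 2 → Fin 2 → k, M = fun i j => ε (d j (z.1 (x i))) := ⟨_, rfl⟩
  have hDx : ∀ i, lin x d ε z.1 (x i) = M i 0 • x 0 + M i 1 • x 1 := by
    intro i; rw [T.lin_x, hM]; rfl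
  have hτ : TA.dv x d (lin x d ε z.1) = algebraMap k A (M 0 0 + M 1 1) := by
    rw [TA.dv2, hDx, hDx]; simp [T.dx, Algebra.algebraMap_eq_smul_one, add_smul]
  have hsub := T.lin_sub hz3
  have hmem := T.lin_mem z.1
  generalize lin x d ε z.1 = D at *
  -- leading parts commute
  have hlead : mB x d (eD D) (eG (cd d a)) = 0 := by
    have h1 : mB x d (eD D) (eG (cd d a)) ∈ Psi x ε 3 := by
      have e : mB x d (eD D) (eG (cd d a)) = mB x d z u - mB x d (z - eD D) u - mB x d (eD D) (u - eG (cd d a)) := by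
        simp only [map_sub, LinearMap.sub_apply]; abel
      rw [e, hzu, zero_sub]
      refine Submodule.sub_mem _ (Submodule.neg_mem _ ?_) ?_
      · exact T.mbr_fil (by norm_num) hsub h2
      · exact T.mbr_fil (by norm_num) hmem C.sub
    rw [TA.Y_G hτ] at h1 ⊢
    have h4 : ∀ i, ((LieAlgebra.ad k (Derivation k A A) D + (2 * (M 0 0 + M 1 1)) • (1 : Module.End k (Derivation k A A))) (cd d a)) (x i)
        = algebraMap k A (- (M i 0 * a 0 + M i 1 * a 1) + 2 * (M 0 0 + M 1 1) * a i) := by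
      intro i
      show (⁅D, cd d a⁆ + (2 * (M 0 0 + M 1 1)) • cd d a) (x i) = _
      rw [Derivation.add_apply, Derivation.commutator_apply, Derivation.smul_apply, hDx, map_add, Derivation.map_smul, Derivation.map_smul]
      simp only [T.cd_x, Derivation.map_algebraMap, Algebra.smul_def, map_add, map_mul, map_neg]
      ring
    have h5 : (LieAlgebra.ad k (Derivation k A A) D + (2 * (M 0 0 + M 1 1)) • (1 : Module.End k (Derivation k A A))) (cd d a) = 0 := by
      refine T.dext fun i => ?_
      have h6 : ε (((LieAlgebra.ad k (Derivation k A A) D + (2 * (M 0 0 + M 1 1)) • (1 : Module.End k (Derivation k A A))) (cd d a)) (x i)) = 0 :=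
        TA.ker_pow1.1 (h1.2.2 i)
      rw [h4, AlgHom.commutes] at h6
      have h7 : (- (M i 0 * a 0 + M i 1 * a 1) + 2 * (M 0 0 + M 1 1) * a i) = 0 := h6
      rw [h4, h7, map_zero]; rfl
    rw [h5]; rfl
  have hMa : ∀ i, M i 0 * a 0 + M i 1 * a 1 = 2 * (M 0 0 + M 1 1) * a i := by
    intro i
    have h1 : ε ((mB x d (eD D) (eG (cd d a))).2.2 (x i)) = 0 := by rw [hlead]; simp
    rw [TA.Y_G hτ] at h1
    have h2 : ε ((⁅D, cd d a⁆ + (2 * (M 0 0 + M 1 1)) • cd d a) (x i)) = 0 := h1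
    rw [Derivation.add_apply, Derivation.commutator_apply, Derivation.smul_apply, hDx, map_add (cd d a), Derivation.map_smul, Derivation.map_smul] at h2
    simp [T.cd_x] at h2
    linear_combination -h2
  obtain ⟨y, hyd⟩ : ∃ y : A, y = a 1 • x 0 - a 0 • x 1 := ⟨_, rfl⟩
  have hDy : D y = (-(M 0 0 + M 1 1)) • y := by
    have c0 : a 1 * M 0 0 - a 0 * M 1 0 = -(M 0 0 + M 1 1) * a 1 := by linear_combination -hMa 1
    have c1 : a 1 * M 0 1 - a 0 * M 1 1 = -(M 0 0 + M 1 1) * (-a 0) := by linear_combination hMa 0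
    have c0' := congrArg (algebraMap k A) c0
    have c1' := congrArg (algebraMap k A) c1
    simp only [map_sub, map_mul, map_neg, map_add] at c0' c1'
    simp only [hyd, map_sub, Derivation.map_smul, hDx]
    simp only [Algebra.smul_def, map_neg, map_add]
    linear_combination x 0 * c0' + x 1 * c1'
  have hay : cd d a y = 0 := by
    simp only [hyd, map_sub, Derivation.map_smul, T.cd_x]; simp only [Algebra.smul_def]; ring
  have hne := C.ne
  have he : ∃ e : Fin 2 → k, cd d e y = 1 := by
    have : ∃ e : Fin 2 → k, a 1 * e 0 - a 0 * e 1 = 1 := by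
      by_cases h0 : a 0 = 0
      · have h1 : a 1 ≠ 0 := fun h1 => hne (funext fun i => by fin_cases i <;> simp [h0, h1])
        exact ⟨![(a 1)⁻¹, 0], by simp [h1]⟩
      · exact ⟨![0, -(a 0)⁻¹], by simp [h0]⟩
    obtain ⟨e, he⟩ := this
    refine ⟨e, ?_⟩
    simp only [hyd, map_sub, Derivation.map_smul, T.cd_x]
    simp only [Algebra.smul_def, ← map_mul]
    rw [← map_sub, he, map_one]
  obtain ⟨e, he⟩ := he
  have hymem : y ∈ RingHom.ker ε := by
    show ε y = 0
    simp [hyd, T.eps]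
  have hy0 : y ≠ 0 := by
    intro h; rw [h, map_zero] at he
    have := congrArg ε he
    simp at this
  have hτ0 : -(M 0 0 + M 1 1) ≠ 0 := by
    intro h
    have htr : M 1 1 = - M 0 0 := by linear_combination -h
    have h0 := hMa 0
    have h1 := hMa 1
    have hdet : M 0 0 * M 1 1 - M 0 1 * M 1 0 = 0 := by
      have d0 : a 0 * (M 0 0 * M 1 1 - M 0 1 * M 1 0) = 0 := by
        rw [htr] at h0 h1 ⊢; linear_combination -M 0 0 * h0 - M 0 1 * h1
      have d1 : a 1 * (M 0 0 * M 1 1 - M 0 1 * M 1 0) = 0 := by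
        rw [htr] at h0 h1 ⊢; linear_combination M 0 0 * h1 - M 1 0 * h0
      by_contra hd
      exact hne (funext fun i => by
        fin_cases i
        · exact (mul_eq_zero.1 d0).resolve_right hd
        · exact (mul_eq_zero.1 d1).resolve_right hd)
    have hsq : ∀ i, D (D (x i)) = 0 := by
      intro i
      rw [htr] at hdet
      have hdet' := congrArg (algebraMap k A) hdet
      have htr' := congrArg (algebraMap k A) htr
      simp only [map_sub, map_mul, map_neg, map_zero] at hdet' htr'
      fin_cases i
      · show D (D (x 0)) = 0
        rw [hDx, map_add, Derivation.map_smul, Derivation.map_smul, hDx, hDx]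
        simp only [Algebra.smul_def, htr']
        linear_combination - x 0 * hdet'
      · show D (D (x 1)) = 0
        rw [hDx, map_add, Derivation.map_smul, Derivation.map_smul, hDx, hDx]
        simp only [Algebra.smul_def, htr']
        linear_combination - x 1 * hdet'
    refine hD0 (T.dext fun i => ?_)
    have h5 : ((D : Module.End k A) ^ 5) (x i) = D (x i) := by rw [hD5]; rfl
    rw [← h5]
    show D (D (D (D (D (x i))))) = 0
    rw [hsq, map_zero, map_zero, map_zero]
  obtain ⟨ν, hν⟩ : ∃ ν : ZMod 5, cz 5 k ν = -(M 0 0 + M 1 1) := by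
    apply cz_of_fixed
    have h5 : ((D : Module.End k A) ^ 5) y = D y := by rw [hD5]; rfl
    have h6 : D (D (D (D (D y)))) = D y := h5
    simp only [hDy, Derivation.map_smul, smul_smul] at h6
    rw [← sub_eq_zero, ← sub_smul] at h6
    have := (smul_eq_zero.1 h6).resolve_right hy0
    linear_combination this
  have hν0 : ν ≠ 0 := by
    rintro rfl; rw [map_zero] at hν; exact hτ0 hν.symm
  rw [← hν] at hDy
  have key : ∀ i j : ZMod 5, 0 < Module.finrank k ((mB x d u).eigenspace (cz 5 k i) ⊓ (mB x d z).eigenspace (cz 5 k j) : Submodule k (MS k A)) := by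
    intro i j
    obtain ⟨m, hm, hmν⟩ : ∃ m : ℕ, m < 5 ∧ ((m : ZMod 5) * ν) = j := ⟨(j * ν⁻¹).val, ZMod.val_lt _, by
      rw [ZMod.natCast_zmod_val, mul_assoc, inv_mul_cancel₀ hν0, mul_one]⟩
    have hZG : mB x d (eD D) ((2 : k) • (y ^ m • eG (cd d a))) = cz 5 k j • ((2 : k) • (y ^ m • eG (cd d a))) := by
      refine smul_eig ((mB_leib D _ _).trans ?_) 2
      rw [hlead, smul_zero, add_zero, der_scale D hDy, ← map_natCast (cz 5 k) m, ← map_mul, hmν]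
      exact smul_assoc _ _ _
    obtain ⟨w, hw, hYw⟩ := C.wit (y ^ m) m (Ideal.pow_mem_pow hymem m) (by
      rw [Derivation.leibniz_pow, hay]; simp)
    have h1 := Rz.Pj (by norm_num) C.Y C.R (cz 5 k i)
    have hPR := Rz.Pj0 hY hR (cz 5 k j)
    have hP0 : Rz x ε 0 (Pj 5 (mB x d z) (cz 5 k j)) := by
      have hz' : Rz x ε 0 (mB x d z) := (T.Rz_mB hz3).mono (by norm_num)
      have := ((hz'.sub (Rz.one.smul (cz 5 k j))).pow 4)
      exact Rz.one.sub (this.mono (by norm_num))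
    have hPv := (Pj_eig j j hZG).trans (if_pos rfl)
    have hcc : Commute (mB x d u) (Pj 5 (mB x d z) (cz 5 k j)) := by
      refine (Commute.one_right _).sub_right (Commute.pow_right (hc.sub_right ?_) _)
      exact (Commute.one_right _).smul_right _
    rw [Module.finrank_pos_iff_exists_ne_zero]
    refine ⟨⟨Pj 5 (mB x d z) (cz 5 k j) (Pj 5 (mB x d u) (cz 5 k i) w), ?_, ?_⟩, fun h0 => ?_⟩
    · exact Module.End.mem_eigenspace_iff.2 (comm_eig hcc (Pj_mem hu i w))
    · exact Module.End.mem_eigenspace_iff.2 (Pj_mem hz j _)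
    · have h0' : Pj 5 (mB x d z) (cz 5 k j) (Pj 5 (mB x d u) (cz 5 k i) w) = 0 := congrArg Subtype.val h0
      have q := blk hw h1 C.Y hP0 hPR hYw hPv h0'
      have q2 := two_mem q
      exact C.nmem (y ^ m) m (T.yn he m hm) q2
  refine T.all25 T.rankMS hu (fun l => ?_) l
  obtain ⟨n, α, β, hn, hN, hm, hl⟩ := two_count hu hz hc
  have h5 : ∀ j, 5 ≤ (Finset.univ.filter fun t => α t = l ∧ β t = j).card := by
    intro j
    rw [← hN]
    exact Nat.le_of_dvd (key l j) (T.joint5 H hu hz hc l j)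
  rw [hm]
  have h6 : (Finset.univ.filter fun t => α t = l).card = ∑ j : ZMod 5, (Finset.univ.filter fun t => α t = l ∧ β t = j).card := by
    rw [Finset.card_eq_sum_card_fiberwise (f := β) (t := Finset.univ) (by intro t _; simp)]
    simp only [Finset.filter_filter]
  rw [h6]
  calc 25 = ∑ j : ZMod 5, 5 := by simp
    _ ≤ _ := Finset.sum_le_sum fun j _ => h5 j

theorem TA.typeC (T : TA 5 x d ε) (H : MH x d) {u : MS k A} (hu : mB x d u ^ 5 = mB x d u) (h2 : u ∈ Psi x ε 2) (h3 : u ∉ Psi x ε 3) :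
    (∀ l, Module.finrank k ((mB x d u).eigenspace (cz 5 k l)) = 25) ∨
    ∀ v, mB x d v ^ 5 = mB x d v → mB x d u v = 0 → ∃ c : k, v = c • u := by
  rw [or_iff_not_imp_right]
  intro hcon l
  push Not at hcon
  obtain ⟨v, hv, huv, hne⟩ := hcon
  have hc : Commute (mB x d u) (mB x d v) := by
    have := H.jac u v
    rw [huv, map_zero] at this
    exact (sub_eq_zero.1 this.symm)
  by_cases hv2 : v ∈ Psi x ε 2
  swap
  · exact T.typeC1 H hu hv hc h2 h3 hv2 l
  have C := T.cdata h2 h3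
  set a : Fin 2 → k := fun i => ε (u.2.2 (x i)) with ha
  have hab : a 0 * ε (v.2.2 (x 1)) - a 1 * ε (v.2.2 (x 0)) = 0 := by
    have h := congrArg (fun m : MS k A => ε m.2.1) huv
    simp only [mB_apply, br2] at h
    have e1 : ε (u.1 v.2.1) = 0 := TA.ker_pow1.1 (T.der_fil (s := 1) (t := 0) h2.1 (by simp) (by omega))
    have e2 : ε (v.1 u.2.1) = 0 := TA.ker_pow1.1 (T.der_fil (s := 1) (t := 0) hv2.1 (by simp) (by omega))
    have e3 : ε u.2.1 = 0 := TA.ker_pow1.1 h2.2.1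
    have e4 : ε v.2.1 = 0 := TA.ker_pow1.1 hv2.2.1
    simpa [e1, e2, e3, e4] using h
  have hκ : ∃ κ : k, ∀ i, ε (v.2.2 (x i)) = κ * a i := by
    by_cases h0 : a 0 = 0
    · have h1 : a 1 ≠ 0 := fun h1 => C.ne (funext fun i => by fin_cases i <;> simp [h0, h1])
      have hb : ε (v.2.2 (x 0)) = 0 := by
        rw [h0, zero_mul, zero_sub, neg_eq_zero] at hab
        exact (mul_eq_zero.1 hab).resolve_left h1
      refine ⟨ε (v.2.2 (x 1)) / a 1, fun i => ?_⟩
      fin_cases i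
      · show ε (v.2.2 (x 0)) = _ * a 0
        rw [hb, h0, mul_zero]
      · show ε (v.2.2 (x 1)) = _ * a 1
        rw [div_mul_cancel₀ _ h1]
    · refine ⟨ε (v.2.2 (x 0)) / a 0, fun i => ?_⟩
      fin_cases i
      · show ε (v.2.2 (x 0)) = _ * a 0
        rw [div_mul_cancel₀ _ h0]
      · show ε (v.2.2 (x 1)) = _ * a 1
        rw [div_mul_eq_mul_div, eq_div_iff h0]; linear_combination hab
  obtain ⟨κ, hκ⟩ := hκ
  let z := v + (-κ) • u
  have hz3 : z ∈ Psi x ε 3 := by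
    have hz2 : z ∈ Psi x ε 2 := Submodule.add_mem _ hv2 (Submodule.smul_mem _ _ h2)
    refine ⟨hz2.1, hz2.2.1, fun i => TA.ker_pow1.2 ?_⟩
    show ε ((v.2.2 + (-κ) • u.2.2) (x i)) = 0
    rw [Derivation.add_apply, Derivation.smul_apply, map_add, map_smul, hκ, smul_eq_mul]
    show κ * a i + -κ * a i = 0
    ring
  have hBz : mB x d z = mB x d v + (-κ) • mB x d u := by rw [map_add, map_smul]
  have hzR : Rz x ε 0 (mB x d z) := (T.Rz_mB hz3).mono (by norm_num)
  have hz5 : mB x d z ^ 5 = mB x d v + (-κ) ^ 5 • mB x d u := by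
    rw [hBz, comm_pow5 (hc.symm.smul_right _), smul_pow, hv, hu]
  have hκ5 : (-κ) ^ 5 = -κ := by
    by_contra hn
    have hr : Rz x ε 0 (mB x d z ^ 5 - mB x d z) := ((hzR.pow 5).mono (by norm_num)).sub hzR
    have e : mB x d u = ((-κ) ^ 5 - -κ)⁻¹ • (mB x d z ^ 5 - mB x d z) := by
      have e2 : mB x d z ^ 5 - mB x d z = ((-κ) ^ 5 - -κ) • mB x d u := by
        rw [hz5, hBz, add_sub_add_left_eq_sub]; exact (sub_smul _ _ _).symm
      rw [e2, smul_smul, inv_mul_cancel₀ (sub_ne_zero.2 hn), one_smul]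
    have hur : Rz x ε 0 (mB x d u) := by rw [e]; exact hr.smul _
    have hYr : Rz x ε 0 (mB x d (eG (cd d a))) := by
      have := hur.sub (C.R.mono (s := 0) (by norm_num))
      rwa [sub_sub_cancel] at this
    obtain ⟨w, hw, hYw⟩ := C.wit 1 0 (by simp) (by simp)
    have h := hYr.pow 4 _ 3 (by norm_num) w hw
    rw [hYw] at h
    refine C.nmem 1 0 (fun h => ?_) ?_
    · have := TA.ker_pow1.1 h; simp at this
    · have := Submodule.smul_mem _ (2 : k)⁻¹ h
      rwa [smul_smul, inv_mul_cancel₀ two_ne, one_smul] at this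
  have hzt : mB x d z ^ 5 = mB x d z := by rw [hz5, hκ5, hBz]
  have huu : mB x d u u = 0 := by
    have h := H.anti u u
    have h2' : (2 : k) • mB x d u u = 0 := by rw [two_smul]; nth_rewrite 1 [h]; exact neg_add_cancel _
    exact (smul_eq_zero.1 h2').resolve_left two_ne
  have hzu : mB x d z u = 0 := by
    rw [H.anti, map_add, map_smul, huv, huu, smul_zero, add_zero, neg_zero]
  have hcz : Commute (mB x d u) (mB x d z) := by
    rw [hBz]; exact hc.add_right ((Commute.refl _).smul_right _)
  refine T.typeC2 H hu hzt hcz hzu h2 h3 hz3 ?_ l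
  intro h0
  refine hne κ ?_
  have : v + (-κ) • u = 0 := h0
  rw [neg_smul, ← sub_eq_add_neg, sub_eq_zero] at this
  exact this

end P4i


section P4j
set_option linter.unusedSectionVars false

theorem noCenter_of_simple {k L : Type*} [Field k] [LieRing L] [LieAlgebra k L] (hs : LieAlgebra.IsSimple k L) : NoCenter k L := by
  intro y hy
  have hc : LieAlgebra.center k L = ⊥ := by
    rcases hs.eq_bot_or_eq_top (LieAlgebra.center k L) with h | h
    · exact h
    · exact absurd ((LieAlgebra.isLieAbelian_iff_center_eq_top k L).2 h) hs.non_abelian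
  have : y ∈ LieAlgebra.center k L := by
    rw [LieModule.mem_maxTrivSubmodule]
    intro z
    have := LinearMap.congr_fun hy z
    rw [LieAlgebra.ad_apply] at this
    rw [← lie_skew, this]; simp
  rw [hc] at this
  simpa using this

variable {k : Type*} [Field k] [CharP k 5] [IsAlgClosed k] {A : Type*} [CommRing A] [Algebra k A]
variable {x : Fin 2 → A} {d : Fin 2 → Derivation k A A} {ε : A →ₐ[k] k}

theorem TA.toral_eD (T : TA 5 x d ε) {z : Derivation k A A} {τ : k} (hτ : TA.dv x d z = algebraMap k A τ) (hz5 : (z : Module.End k A) ^ 5 = z)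
    (hτ5 : τ ^ 5 = τ) (h32 : (32 : k) = 2) : mB x d (eD z) ^ 5 = mB x d (eD z) := by
  have h2 : (-2 * τ) ^ 5 = -2 * τ := by linear_combination (-32) * hτ5 + (-τ) * h32
  have h25 : (2 * τ) ^ 5 = 2 * τ := by linear_combination (32) * hτ5 + (τ) * h32
  have hS := it_pow (T.Y_F hτ) (k := k)
  have hG : ∀ n E, ((mB x d (eD z)) ^ n) (eG E) = eG (((LieAlgebra.ad k (Derivation k A A) z + (2 * τ) • (1 : Module.End k (Derivation k A A))) ^ n) E) :=
    it_pow (TA.Y_G hτ)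
  have hDD : ∀ n E, ((mB x d (eD z)) ^ n) (eD E) = eD (((LieAlgebra.ad k (Derivation k A A) z) ^ n) E) := it_pow (fun E => TA.Y_D E)
  refine T.toral_of (D := z) hz5 (fun a m => mB_leib z a m) (fun i => ?_) ?_ (fun i => ?_)
  · have := hDD 5 (d i)
    rw [ad_toral hz5] at this
    rw [this]; exact (TA.Y_D _).symm
  · have := hS 5 1
    rw [add_toral hz5 h2] at this
    rw [this]; exact (T.Y_F hτ _).symm
  · have := hG 5 (d i)
    rw [add_toral (ad_toral hz5) h25] at this
    rw [this]; exact (TA.Y_G hτ _).symm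

theorem TA.good_M (T : TA 5 x d ε) {L : Type*} [LieRing L] [LieAlgebra k L] [FiniteDimensional k L] (hs : LieAlgebra.IsSimple k L)
    (e : L ≃ₗ[k] MS k A) (he : ∀ y z : L, e ⁅y, z⁆ = mB x d (e y) (e z)) : GoodData 5 k L := by
  have := T.finMS
  have hnc := noCenter_of_simple hs
  have hes : ∀ u v : MS k A, mB x d u v = e ⁅e.symm u, e.symm v⁆ := by
    intro u v; rw [he, e.apply_symm_apply, e.apply_symm_apply]
  have H : MH x d := by
    refine ⟨fun u v => LinearMap.ext fun w => ?_, fun u v => ?_, fun I hI => ?_, fun u hu => ?_⟩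
    · rw [LinearMap.sub_apply, Module.End.mul_apply, Module.End.mul_apply]
      simp only [hes, e.symm_apply_apply]
      rw [← map_sub, lie_lie]
    · rw [hes, hes v u, ← map_neg, lie_skew]
    · let J : LieIdeal k L := { Submodule.comap (e : L →ₗ[k] MS k A) I with
        lie_mem := by
          intro y m hm
          show e ⁅y, m⁆ ∈ I
          rw [he]; exact hI _ _ hm }
      have hJ : ∀ v, v ∈ I ↔ e.symm v ∈ J := by
        intro v
        show v ∈ I ↔ e (e.symm v) ∈ I
        rw [e.apply_symm_apply]
      rcases hs.eq_bot_or_eq_top J with h | h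
      · left
        rw [eq_bot_iff]
        intro v hv
        rw [hJ, h] at hv
        simpa using hv
      · right
        rw [eq_top_iff]
        intro v _
        rw [hJ, h]; trivial
    · have : e.symm u = 0 := hnc _ (LinearMap.ext fun w => e.injective (by
        rw [LieAlgebra.ad_apply, he, e.apply_symm_apply, hu]; simp))
      simpa using this
  have hpow : ∀ (y : L) (m : ℕ) (v : L), e ((LieAlgebra.ad k L y ^ m) v) = (mB x d (e y) ^ m) (e v) := by
    intro y m v
    induction m with
    | zero => rfl
    | succ m ih => rw [pow_succ', pow_succ', Module.End.mul_apply, Module.End.mul_apply, ← ih, LieAlgebra.ad_apply, he]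
  have htor : ∀ y : L, LieAlgebra.ad k L y ^ 5 = LieAlgebra.ad k L y ↔ mB x d (e y) ^ 5 = mB x d (e y) := by
    intro y
    constructor
    · intro h
      refine LinearMap.ext fun v => ?_
      obtain ⟨v, rfl⟩ : ∃ w, e w = v := e.surjective v
      rw [← hpow, h, LieAlgebra.ad_apply, he]
    · intro h
      refine LinearMap.ext fun v => e.injective ?_
      rw [hpow, h, LieAlgebra.ad_apply, he]
  have heig : ∀ (y : L) (a : k), Module.finrank k ((LieAlgebra.ad k L y).eigenspace a) = Module.finrank k ((mB x d (e y)).eigenspace a) := by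
    intro y a
    refine LinearEquiv.finrank_eq (e.submoduleMap _ |>.trans (LinearEquiv.ofEq _ _ ?_))
    refine Submodule.ext fun v => ?_
    rw [Submodule.mem_map, Module.End.mem_eigenspace_iff]
    constructor
    · rintro ⟨w, hw, rfl⟩
      rw [Module.End.mem_eigenspace_iff, LieAlgebra.ad_apply] at hw
      show mB x d (e y) (e w) = a • e w
      rw [← he, hw, map_smul]
    · intro hv
      refine ⟨e.symm v, ?_, e.apply_symm_apply v⟩
      rw [Module.End.mem_eigenspace_iff, LieAlgebra.ad_apply]
      apply e.injective
      rw [he, e.apply_symm_apply, hv, map_smul, e.apply_symm_apply]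
  have hfr : Module.finrank k L = 125 := e.finrank_eq.trans T.rankMS
  have hz5 : ∀ i, ((x i • d i : Derivation k A A) : Module.End k A) ^ 5 = (x i • d i : Derivation k A A) := fun i => T.diag_toral fun j => ⟨_, T.xd_x i j⟩
  have h32 : (32 : k) = 2 := by
    have h5 : ((5 : ℕ) : k) = 0 := CharP.cast_eq_zero k 5
    have h5' : (5 : k) = 0 := by exact_mod_cast h5
    linear_combination 6 * h5'
  have hdv : ∀ i, TA.dv x d (x i • d i) = algebraMap k A 1 := by
    intro i
    rw [TA.dv2, T.xd_x, T.xd_x]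
    fin_cases i <;> simp [T.dx]
  refine ⟨25, 5, 2, by norm_num, by norm_num, by rw [hfr]; norm_num, fun h h0 hh => ?_,
    fun i => e.symm (eD (x i • d i)), ?_, fun i j => ?_, fun i => ?_⟩
  · have hu := (htor h).1 hh
    have hu0 : e h ≠ 0 := fun hc => h0 (by simpa using hc)
    simp only [heig, hfr]
    by_cases h1 : e h ∈ Psi x ε 1
    swap
    · exact Or.inl fun l _ => T.typeA hu h1 l
    by_cases h2 : e h ∈ Psi x ε 2
    swap
    · exact Or.inl fun l _ => T.typeB H hu h1 h2 l
    by_cases h3 : e h ∈ Psi x ε 3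
    · exact Or.inl fun l _ => T.typeD H hu h3 hu0 l
    rcases T.typeC H hu h2 h3 with hC | hC
    · exact Or.inl fun l _ => hC l
    refine Or.inr ⟨fun h' ht' hc' => ?_, le_rfl, ?_⟩
    · obtain ⟨c, hc⟩ := hC (e h') ((htor h').1 ht') (by rw [← he, hc', map_zero])
      exact ⟨c, e.injective (by rw [hc, map_smul])⟩
    · have h5 := T.single5 H hu 0
      rw [show cz 5 k 0 = 0 by simp] at h5
      have hpos : 0 < Module.finrank k ((mB x d (e h)).eigenspace 0) := by
        rw [Module.finrank_pos_iff_exists_ne_zero]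
        refine ⟨⟨e h, ?_⟩, fun hc => hu0 (congrArg Subtype.val hc)⟩
        rw [Module.End.mem_eigenspace_iff, ← he, lie_self, map_zero, zero_smul]
      have := Nat.le_of_dvd hpos h5
      omega
  · refine LinearIndependent.map' (li_of_dual (fun i => (eD (x i • d i) : MS k A))
      (fun j => { toFun := fun m => ε (d j (m.1 (x j))), map_add' := fun a b => by simp, map_smul' := fun c a => by simp }) fun i j => ?_)
      (e.symm : MS k A →ₗ[k] L) (LinearEquiv.ker _)
    show ε (d j ((x i • d i) (x j))) = _
    rw [T.xd_x]
    split_ifs with hij <;> simp [T.dx]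
  · apply e.injective
    rw [he, e.apply_symm_apply, e.apply_symm_apply, TA.Y_D, map_zero]
    have : ⁅x i • d i, x j • d j⁆ = 0 := by
      refine T.dext fun l => ?_
      rw [Derivation.commutator_apply, T.xd_x, T.xd_x, Derivation.map_smul, Derivation.map_smul, T.xd_x, T.xd_x, smul_comm, sub_self]; rfl
    rw [this]; rfl
  · rw [htor, e.apply_symm_apply]
    exact T.toral_eD (hdv i) (hz5 i) (one_pow 5) h32

theorem good_melikian {L : Type*} [LieRing L] [LieAlgebra k L] [FiniteDimensional k L] (hs : LieAlgebra.IsSimple k L)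
    (h : IsMelikian 5 k L) : GoodData 5 k L := by
  obtain ⟨-, e, he⟩ := h
  obtain ⟨ε, T⟩ := trunc_TA (p := 5) (k := k) 2
  exact T.good_M hs e he

end P4j

/-- Remark at the end of §3.  Suppose `p > 3`.  Let `L` be a
non-classical finite-dimensional restricted simple Lie algebra over `k` and `t` a torus
of maximal dimension.  Then `dim L = rk(L) + (p^{μ(L)} − 1)·dim L_α` for some root `α` of
`L` relative to `t`, and `dim L_α = max {m ∈ ℕ | m·(p^{μ(L)} − 1) < dim L}`. -/
theorem nonclassical_simple_root_space_dim
    (p : ℕ) (hp : p.Prime) (hp3 : 3 < p)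
    (k : Type*) [Field k] [IsAlgClosed k] [CharP k p]
    {L : Type*} [LieRing L] [LieAlgebra k L] [FiniteDimensional k L]
    (hsimple : LieAlgebra.IsSimple k L)
    (op : L → L) (hop : IsPMap p k op)
    (hnc : IsNonClassicalRestrictedSimple p k L)
    (t : LieSubalgebra k L) (ht : IsTorus k op t)
    (htmax : Module.finrank k t = mu k op) :
    ∃ χ : (t : LieSubalgebra k L) →ₗ[k] k, χ ≠ 0 ∧ charWeightSpace k t χ L ≠ ⊥ ∧
      Module.finrank k L = lieRank k L
        + (p ^ (mu k op) - 1) * Module.finrank k (charWeightSpace k t χ L) ∧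
      Module.finrank k (charWeightSpace k t χ L)
        = sSup {m : ℕ | m * (p ^ (mu k op) - 1) < Module.finrank k L} := by
  haveI : Fact p.Prime := ⟨hp⟩
  refine main_abstract hop (noCenter_of_simple hsimple) ?_ t ht htmax
  rcases hnc with h | h
  · exact good_cartan hp3 h
  · obtain rfl : p = 5 := h.1
    exact good_melikian hsimple h
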